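/- Let n ≥ 3, let q be a prime power, and let c be a code word of C_{n-1}(n,q) with wt(c) ≤ B_{n,q}. Then c is a code word of type 𝒯, i.e., there exists an (n−3)-space κ of PG(n,q) with c|_κ a scalar multiple of the all-one function, a plane π disjoint from κ whose restriction c|_π is of one of the types T_0, T_{q+1}, T_{2q}, T_{2q+1}, T^odd, T^△, T^★, and c(P) = c(⟨κ,P⟩ ∩ π) for all points P outside κ. -/

import Mathlib

open scoped Classical

noncomputable section

namespace PGCode

open Projectivization

/-- The points of `PG(n, q)`, where the field `F` has order `q`. -/
abbrev Pt (F : Type) [Field F] (n : ℕ) := Projectivization F (Fin (n + 1) → F)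

variable {F : Type} [Field F]

/-- A point of `PG(n,q)` lies in the projective subspace determined by a linear subspace `W`. -/
def ptIn {n : ℕ} (P : Pt F n) (W : Submodule F (Fin (n + 1) → F)) : Prop :=
  Projectivization.submodule P ≤ W

/-- The set of points of the projective subspace determined by a linear subspace `W`. -/
def ptsIn {n : ℕ} (W : Submodule F (Fin (n + 1) → F)) : Set (Pt F n) :=
  {P | ptIn P W}

/-- The incidence vector (over `F_p = ZMod p`) of the projective subspace determined by `W`. -/
def incVec (p : ℕ) {n : ℕ} (W : Submodule F (Fin (n + 1) → F)) : Pt F n → ZMod p :=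
  fun P => if ptIn P W then (1 : ZMod p) else 0

/-- The code `C_{n-1}(n,q)`: the `F_p`-span of the incidence vectors of all hyperplanes
(projective dimension `n-1`, i.e. linear dimension `n`). -/
def code (F : Type) [Field F] (p n : ℕ) : Submodule (ZMod p) (Pt F n → ZMod p) :=
  Submodule.span (ZMod p)
    {v | ∃ W : Submodule F (Fin (n + 1) → F), Module.finrank F W = n ∧ v = incVec p W}

/-- The support of a word. -/
def supp {p n : ℕ} (v : Pt F n → ZMod p) : Set (Pt F n) := {P | v P ≠ 0}

/-- The weight of a word. -/
def wt {p n : ℕ} (v : Pt F n → ZMod p) : ℕ := (supp v).ncard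

/-- The weight of the restriction of a word to the subspace determined by `W`. -/
def wtRes {p n : ℕ} (c : Pt F n → ZMod p) (W : Submodule F (Fin (n + 1) → F)) : ℕ :=
  (ptsIn W ∩ supp c).ncard

/-- `θ_m = (q^(m+1) - 1)/(q - 1)`, with `θ_m = 0` for `m < 0`. -/
def theta (q : ℕ) (m : ℤ) : ℕ :=
  if m < 0 then 0 else ∑ i ∈ Finset.range (m.toNat + 1), q ^ i

/-- The bound `B_{n,q}` from the paper. -/
def B (n q : ℕ) : ℝ :=
  if q < 7 ∨ q = 8 ∨ q = 9 ∨ q = 16 ∨ q = 25 ∨ q = 27 ∨ q = 49 then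
    2 * (q : ℝ) ^ (n - 1)
  else if q = 7 ∨ q = 11 ∨ q = 13 ∨ q = 17 then
    (3 * q - Real.sqrt (6 * q) - 1 / 2) * (q : ℝ) ^ (n - 2)
  else if q = 19 ∨ q = 121 then
    (3 * q - Real.sqrt (6 * q) + 9 / 2) * (q : ℝ) ^ (n - 2)
  else if q = 29 ∨ q = 31 ∨ q = 32 then
    (4 * q - 4 * Real.sqrt q - 25 / 2) * (q : ℝ) ^ (n - 2)
  else
    (4 * q - Real.sqrt (8 * q) - 33 / 2) * (q : ℝ) ^ (n - 2)

/-- A line of `PG(n,q)`: a linear subspace of dimension `2`. -/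
def IsLine {n : ℕ} (l : Submodule F (Fin (n + 1) → F)) : Prop := Module.finrank F l = 2

/-- A plane of `PG(n,q)`: a linear subspace of dimension `3`. -/
def IsPlane {n : ℕ} (W : Submodule F (Fin (n + 1) → F)) : Prop := Module.finrank F W = 3

/-- The line `l` is an `α`-secant to `supp c`. -/
def secant {p n : ℕ} (c : Pt F n → ZMod p) (l : Submodule F (Fin (n + 1) → F)) (α : ℕ) : Prop :=
  IsLine l ∧ (ptsIn l ∩ supp c).ncard = α

/-- The restriction of `c` to the plane `W` is a linear combination of at most two lines of `W`. -/
def TwoLineComb (p : ℕ) {n : ℕ} (c : Pt F n → ZMod p) (W : Submodule F (Fin (n + 1) → F)) :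
    Prop :=
  ∃ l₁ l₂ : Submodule F (Fin (n + 1) → F), IsLine l₁ ∧ IsLine l₂ ∧ l₁ ≤ W ∧ l₂ ≤ W ∧
    ∃ a b : ZMod p, ∀ P : Pt F n, ptIn P W → c P = a * incVec p l₁ P + b * incVec p l₂ P

/-- Type `T^△`: the restriction of `c` to the plane `W` is a linear combination (with nonzero
coefficients) of three nonconcurrent lines of `W`. -/
def TypeTri (p : ℕ) {n : ℕ} (c : Pt F n → ZMod p) (W : Submodule F (Fin (n + 1) → F)) : Prop :=
  ∃ l₁ l₂ l₃ : Submodule F (Fin (n + 1) → F),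
    IsLine l₁ ∧ IsLine l₂ ∧ IsLine l₃ ∧ l₁ ≤ W ∧ l₂ ≤ W ∧ l₃ ≤ W ∧
    l₁ ≠ l₂ ∧ l₁ ≠ l₃ ∧ l₂ ≠ l₃ ∧
    (¬ ∃ P : Pt F n, ptIn P l₁ ∧ ptIn P l₂ ∧ ptIn P l₃) ∧
    ∃ a₁ a₂ a₃ : ZMod p, a₁ ≠ 0 ∧ a₂ ≠ 0 ∧ a₃ ≠ 0 ∧
      ∀ P : Pt F n, ptIn P W →
        c P = a₁ * incVec p l₁ P + a₂ * incVec p l₂ P + a₃ * incVec p l₃ P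

/-- Type `T^★`: the restriction of `c` to the plane `W` is a linear combination (with nonzero
coefficients) of three distinct concurrent lines of `W`. -/
def TypeStar (p : ℕ) {n : ℕ} (c : Pt F n → ZMod p) (W : Submodule F (Fin (n + 1) → F)) : Prop :=
  ∃ l₁ l₂ l₃ : Submodule F (Fin (n + 1) → F),
    IsLine l₁ ∧ IsLine l₂ ∧ IsLine l₃ ∧ l₁ ≤ W ∧ l₂ ≤ W ∧ l₃ ≤ W ∧
    l₁ ≠ l₂ ∧ l₁ ≠ l₃ ∧ l₂ ≠ l₃ ∧
    (∃ P : Pt F n, ptIn P l₁ ∧ ptIn P l₂ ∧ ptIn P l₃) ∧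
    ∃ a₁ a₂ a₃ : ZMod p, a₁ ≠ 0 ∧ a₂ ≠ 0 ∧ a₃ ≠ 0 ∧
      ∀ P : Pt F n, ptIn P W →
        c P = a₁ * incVec p l₁ P + a₂ * incVec p l₂ P + a₃ * incVec p l₃ P

/-- The base code word `c₀` of the `T^odd` construction on `PG(2,p)`:
`c₀(0,1,a) = a`, `c₀(1,0,b) = b`, `c₀(1,1,c) = -c`, and `c₀ = 0` elsewhere. -/
def oddBase (p : ℕ) [Fact p.Prime] : Pt (ZMod p) 2 → ZMod p := fun P =>
  if P.rep 0 = 0 ∧ P.rep 1 ≠ 0 then P.rep 2 / P.rep 1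
  else if P.rep 1 = 0 ∧ P.rep 0 ≠ 0 then P.rep 2 / P.rep 0
  else if P.rep 0 = P.rep 1 ∧ P.rep 0 ≠ 0 then -(P.rep 2 / P.rep 0)
  else 0

/-- The line `m : X₀ = 0` of `PG(2,p)`. -/
def lineM1 (p : ℕ) [Fact p.Prime] : Submodule (ZMod p) (Fin 3 → ZMod p) :=
  LinearMap.ker (LinearMap.proj 0 : (Fin 3 → ZMod p) →ₗ[ZMod p] ZMod p)

/-- The line `m' : X₁ = 0` of `PG(2,p)`. -/
def lineM2 (p : ℕ) [Fact p.Prime] : Submodule (ZMod p) (Fin 3 → ZMod p) :=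
  LinearMap.ker (LinearMap.proj 1 : (Fin 3 → ZMod p) →ₗ[ZMod p] ZMod p)

/-- The line `m'' : X₀ = X₁` of `PG(2,p)`. -/
def lineM3 (p : ℕ) [Fact p.Prime] : Submodule (ZMod p) (Fin 3 → ZMod p) :=
  LinearMap.ker ((LinearMap.proj 0 : (Fin 3 → ZMod p) →ₗ[ZMod p] ZMod p) - LinearMap.proj 1)

/-- The code word `d = (γ c₀ + λ m + λ' m' + λ'' m'')^π` of the `T^odd` construction, where the
collineation `π` of `PG(2,p)` is the inverse of the homography induced by the linear
equivalence `g`. -/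
def oddWord (p : ℕ) [Fact p.Prime] (g : (Fin 3 → ZMod p) ≃ₗ[ZMod p] (Fin 3 → ZMod p))
    (γ lam lam' lam'' : ZMod p) : Pt (ZMod p) 2 → ZMod p := fun P =>
  γ * oddBase p (Projectivization.map g.toLinearMap g.injective P) +
    lam * incVec p (lineM1 p) (Projectivization.map g.toLinearMap g.injective P) +
    lam' * incVec p (lineM2 p) (Projectivization.map g.toLinearMap g.injective P) +
    lam'' * incVec p (lineM3 p) (Projectivization.map g.toLinearMap g.injective P)

/-- The semilinear embedding of `PG(2,p)` onto the plane of `PG(n,q)` spanned by the linearly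
independent vectors `b 0, b 1, b 2`, relative to the field embedding `σ : F_p → F`. -/
def planeEmbed {n : ℕ} {p : ℕ} [Fact p.Prime] (σ : ZMod p →+* F)
    (b : Fin 3 → (Fin (n + 1) → F)) (hb : LinearIndependent F b) :
    Pt (ZMod p) 2 → Pt F n := fun P =>
  Projectivization.mk F (∑ i, σ (P.rep i) • b i) (by
    intro hzero
    have h0 : ∀ i ∈ Finset.univ, σ (P.rep i) = 0 :=
      linearIndependent_iff'.mp hb Finset.univ (fun i => σ (P.rep i)) hzero
    have h1 : P.rep = 0 := funext fun i => σ.injective (by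
      simp only [Pi.zero_apply, map_zero]; exact h0 i (Finset.mem_univ i))
    exact P.rep_nonzero h1)

/-- Type `T^odd`: this requires `q = p` to be prime (`|F| = p`), and `c` restricted to the plane
`W` (spanned by the frame `b`) must coincide, via a semilinear identification of `W` with
`PG(2,p)`, with a code word `d` of the `T^odd` construction. -/
def TypeOdd (p : ℕ) [Fact p.Prime] [Fintype F] {n : ℕ} (c : Pt F n → ZMod p)
    (W : Submodule F (Fin (n + 1) → F)) : Prop :=
  Fintype.card F = p ∧
  ∃ (σ : ZMod p →+* F) (b : Fin 3 → (Fin (n + 1) → F)) (hb : LinearIndependent F b),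
    Submodule.span F (Set.range b) = W ∧
    ∃ (g : (Fin 3 → ZMod p) ≃ₗ[ZMod p] (Fin 3 → ZMod p)) (γ lam lam' lam'' : ZMod p), γ ≠ 0 ∧
      ∀ Q : Pt (ZMod p) 2, c (planeEmbed σ b hb Q) = oddWord p g γ lam lam' lam'' Q

/-- The list of plane types `T_0, T_{q+1}, T_{2q}, T_{2q+1}, T^odd, T^△, T^★`. -/
inductive PlaneT : Type where
  | T0 | Tq1 | T2q | T2q1 | Todd | Ttri | Tstar
deriving DecidableEq

/-- The restriction of `c` to the plane `W` is a code word of the given type. -/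
def PlaneIsType (p q : ℕ) [Fact p.Prime] [Fintype F] {n : ℕ} (c : Pt F n → ZMod p)
    (W : Submodule F (Fin (n + 1) → F)) : PlaneT → Prop
  | .T0 => TwoLineComb p c W ∧ wtRes c W = 0
  | .Tq1 => TwoLineComb p c W ∧ wtRes c W = q + 1
  | .T2q => TwoLineComb p c W ∧ wtRes c W = 2 * q
  | .T2q1 => TwoLineComb p c W ∧ wtRes c W = 2 * q + 1
  | .Todd => TypeOdd p c W
  | .Ttri => TypeTri p c W
  | .Tstar => TypeStar p c W

/-- The plane `W` is of type `𝒯`. -/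
def TypeT (p q : ℕ) [Fact p.Prime] [Fintype F] {n : ℕ} (c : Pt F n → ZMod p)
    (W : Submodule F (Fin (n + 1) → F)) : Prop :=
  IsPlane W ∧ ∃ t : PlaneT, PlaneIsType p q c W t

/-- The plane `W` is of type `𝒪`. -/
def TypeO (p q : ℕ) [Fact p.Prime] [Fintype F] {n : ℕ} (c : Pt F n → ZMod p)
    (W : Submodule F (Fin (n + 1) → F)) : Prop :=
  IsPlane W ∧ ¬ TypeT p q c W

/-- The restriction of `c` to the `k`-space `Sp` (linear dimension `k+1`) is of type `t`:
there is a `(k-3)`-space `κ ⊆ Sp` on which `c` is a scalar multiple of the all-one function,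
a plane `π ⊆ Sp` of type `t` disjoint from `κ`, and `c P = c (⟨κ, P⟩ ∩ π)` for every point
`P` of `Sp` outside `κ`. -/
def SpaceIsType (p q : ℕ) [Fact p.Prime] [Fintype F] {n : ℕ} (c : Pt F n → ZMod p)
    (Sp : Submodule F (Fin (n + 1) → F)) (k : ℕ) (t : PlaneT) : Prop :=
  Module.finrank F Sp = k + 1 ∧
  ∃ κ : Submodule F (Fin (n + 1) → F), Module.finrank F κ = k - 2 ∧ κ ≤ Sp ∧
    (∃ a : ZMod p, ∀ P : Pt F n, ptIn P κ → c P = a) ∧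
    ∃ π : Submodule F (Fin (n + 1) → F), IsPlane π ∧ π ≤ Sp ∧ π ⊓ κ = ⊥ ∧
      PlaneIsType p q c π t ∧
      ∀ P : Pt F n, ptIn P Sp → ¬ ptIn P κ →
        ∃ Q : Pt F n, ptIn Q π ∧
          Projectivization.submodule Q ≤ κ ⊔ Projectivization.submodule P ∧ c P = c Q

set_option linter.unusedSectionVars false
set_option linter.unusedFintypeInType false
set_option linter.unusedDecidableInType false

local notation "𝔮" => Fintype.card F

section LinearCode

variable {V : Type} [AddCommGroup V] [Module F V] {p : ℕ}

/-- The indicator function of the kernel of a linear functional. -/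
def hyp (p : ℕ) (φ : Module.Dual F V) : V → ZMod p := fun v => if φ v = 0 then 1 else 0

/-- The span of the indicator functions of the kernels of linear functionals. -/
def lcode (F : Type) [Field F] (p : ℕ) (V : Type) [AddCommGroup V] [Module F V] :
    Submodule (ZMod p) (V → ZMod p) :=
  Submodule.span (ZMod p) (Set.range (hyp (F := F) (V := V) p))

theorem hyp_mem (φ : Module.Dual F V) : hyp p φ ∈ lcode F p V :=
  Submodule.subset_span ⟨φ, rfl⟩

theorem lcode_induction {P : (f : V → ZMod p) → f ∈ lcode F p V → Prop}
    (h0 : P 0 (Submodule.zero_mem _))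
    (hadd : ∀ f g hf hg, P f hf → P g hg → P (f + g) (Submodule.add_mem _ hf hg))
    (hsmul : ∀ (a : ZMod p) f hf, P f hf → P (a • f) (Submodule.smul_mem _ a hf))
    (hhyp : ∀ φ : Module.Dual F V, P (hyp p φ) (hyp_mem φ))
    {f : V → ZMod p} (hf : f ∈ lcode F p V) : P f hf := by
  refine Submodule.span_induction (p := P) ?_ h0 hadd hsmul hf
  rintro _ ⟨φ, rfl⟩
  exact hhyp φ

theorem lcode_comp {V' : Type} [AddCommGroup V'] [Module F V'] (g : V' →ₗ[F] V)
    {f : V → ZMod p} (hf : f ∈ lcode F p V) : (fun v => f (g v)) ∈ lcode F p V' := by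
  induction hf using lcode_induction with
  | h0 => exact Submodule.zero_mem _
  | hadd f g _ _ hf hg => exact Submodule.add_mem _ hf hg
  | hsmul a f _ hf => exact Submodule.smul_mem _ a hf
  | hhyp φ => exact hyp_mem (φ.comp g)

theorem lcode_smul {f : V → ZMod p} (hf : f ∈ lcode F p V) {μ : F} (hμ : μ ≠ 0) (v : V) :
    f (μ • v) = f v := by
  induction hf using lcode_induction with
  | h0 => rfl
  | hadd f g _ _ hf hg => simp [hf, hg]
  | hsmul a f _ hf => simp [hf]
  | hhyp φ => simp [hyp, hμ]

variable [Fintype F] [Fact p.Prime] [Algebra (ZMod p) F]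

theorem card_cast_zmod : ((𝔮 : ℕ) : ZMod p) = 0 := by
  apply (algebraMap (ZMod p) F).injective
  simp

theorem two_le_card : 2 ≤ 𝔮 := Fintype.one_lt_card

theorem exists_unique_zero (φ : Module.Dual F V) {R : V} (hR : φ R ≠ 0) (v : V) (x : F) :
    φ (x • R + v) = 0 ↔ x = -φ v / φ R := by
  simp only [map_add, map_smul, smul_eq_mul]
  rw [eq_div_iff hR]
  constructor <;> intro h <;> linear_combination h

theorem line_sum {f : V → ZMod p} (hf : f ∈ lcode F p V) (R v : V) :
    ∑ x : F, f (x • R + v) = f 0 - f R := by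
  induction hf using lcode_induction with
  | h0 => simp
  | hadd f g _ _ hf hg => simp only [Pi.add_apply, Finset.sum_add_distrib, hf, hg]; ring
  | hsmul a f _ hf => simp only [Pi.smul_apply, smul_eq_mul, ← Finset.mul_sum, hf]; ring
  | hhyp φ =>
    by_cases hR : φ R = 0
    · simp [hyp, hR, card_cast_zmod]
    · have : ∀ x : F, hyp p φ (x • R + v) = if x = -φ v / φ R then 1 else 0 := by
        intro x
        simp only [hyp, exists_unique_zero φ hR]
      simp only [this]
      simp [hyp, hR]

/-- The `m`-th moment of `f` along the direction `R` at `v`. -/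
def mom (f : V → ZMod p) (R : V) (m : ℕ) (v : V) : F :=
  ∑ x : F, algebraMap (ZMod p) F (f (x • R + v)) * x ^ m

theorem mom_add (f g : V → ZMod p) (R : V) (m : ℕ) (v : V) :
    mom (F := F) (f + g) R m v = mom f R m v + mom g R m v := by
  simp [mom, add_mul, Finset.sum_add_distrib]

theorem mom_smul (a : ZMod p) (f : V → ZMod p) (R : V) (m : ℕ) (v : V) :
    mom (F := F) (a • f) R m v = algebraMap (ZMod p) F a * mom f R m v := by
  simp [mom, Finset.mul_sum, mul_assoc]

theorem mom_hyp_of_ne (φ : Module.Dual F V) {R : V} (hR : φ R ≠ 0) (m : ℕ) (v : V) :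
    mom (hyp p φ) R m v = (-φ v / φ R) ^ m := by
  have : ∀ x : F, algebraMap (ZMod p) F (hyp p φ (x • R + v)) * x ^ m =
      if x = -φ v / φ R then x ^ m else 0 := by
    intro x
    simp only [hyp, exists_unique_zero φ hR]
    split_ifs <;> simp
  simp only [mom, this]
  simp

theorem mom_hyp_of_eq (φ : Module.Dual F V) {R : V} (hR : φ R = 0) (m : ℕ) (v : V) :
    mom (hyp p φ) R m v = (∑ x : F, x ^ m) * (1 - (φ v) ^ (𝔮 - 1)) := by
  have h2 := two_le_card (F := F)
  have : ∀ x : F, algebraMap (ZMod p) F (hyp p φ (x • R + v)) * x ^ m =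
      x ^ m * (1 - (φ v) ^ (𝔮 - 1)) := by
    intro x
    simp only [hyp, map_add, map_smul, hR, smul_zero, zero_add]
    by_cases h : φ v = 0
    · simp [h, zero_pow (show 𝔮 - 1 ≠ 0 by omega)]
    · simp [h, FiniteField.pow_card_sub_one_eq_one]
  simp only [mom, this, Finset.sum_mul]

/-- `g` restricts to a polynomial of degree at most `d` on every affine line, with leading
coefficient the value of `g` at the direction. -/
def IsForm (d : ℕ) (g : V → F) : Prop :=
  ∀ u w : V, ∃ P : Polynomial F, P.natDegree ≤ d ∧ P.coeff d = g w ∧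
    ∀ t : F, P.eval t = g (u + t • w)

theorem natDegree_affine_le (a b : F) :
    (Polynomial.C a + Polynomial.C b * Polynomial.X).natDegree ≤ 1 := by
  rw [add_comm]; exact Polynomial.natDegree_linear_le

theorem mom_isForm {f : V → ZMod p} (hf : f ∈ lcode F p V) (R : V) {m : ℕ} (hm : m + 1 < 𝔮) :
    IsForm m (mom (F := F) f R m) := by
  induction hf using lcode_induction with
  | h0 => exact fun u w => ⟨0, by simp [mom]⟩
  | hadd f g _ _ hf hg =>
    intro u w
    obtain ⟨P, hP1, hP2, hP3⟩ := hf u w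
    obtain ⟨Q, hQ1, hQ2, hQ3⟩ := hg u w
    exact ⟨P + Q, (Polynomial.natDegree_add_le_of_degree_le hP1 hQ1), by simp [hP2, hQ2, mom_add],
      by simp [hP3, hQ3, mom_add]⟩
  | hsmul a f _ hf =>
    intro u w
    obtain ⟨P, hP1, hP2, hP3⟩ := hf u w
    exact ⟨Polynomial.C (algebraMap (ZMod p) F a) * P,
      (Polynomial.natDegree_C_mul_le _ _).trans hP1, by simp [hP2, mom_smul],
      by simp [hP3, mom_smul]⟩
  | hhyp φ =>
    intro u w
    by_cases hR : φ R = 0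
    · refine ⟨0, ?_⟩
      simp [mom_hyp_of_eq φ hR, FiniteField.sum_pow_lt_card_sub_one F m (by omega)]
    · refine ⟨(Polynomial.C (-φ u / φ R) + Polynomial.C (-φ w / φ R) * Polynomial.X) ^ m, ?_, ?_, ?_⟩
      · exact (Polynomial.natDegree_pow_le_of_le m (natDegree_affine_le _ _)).trans (by simp)
      · have := Polynomial.coeff_pow_of_natDegree_le
          (natDegree_affine_le (-φ u / φ R) (-φ w / φ R)) (m := m)
        rw [mul_one] at this
        rw [this, mom_hyp_of_ne φ hR]
        simp
      · intro t
        rw [mom_hyp_of_ne φ hR]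
        simp only [Polynomial.eval_pow, Polynomial.eval_add, Polynomial.eval_mul,
          Polynomial.eval_C, Polynomial.eval_X, map_add, map_smul, smul_eq_mul]
        congr 1
        ring

theorem mom_polynomial {f : V → ZMod p} (hf : f ∈ lcode F p V) (R : V) (m : ℕ) (u w : V) :
    ∃ P : Polynomial F, P.natDegree ≤ m ∧ ∀ t : F, P.eval t = mom f R m (u + t • w) := by
  induction hf using lcode_induction with
  | h0 => exact ⟨0, by simp [mom]⟩
  | hadd f g _ _ hf hg =>
    obtain ⟨P, hP1, hP3⟩ := hf
    obtain ⟨Q, hQ1, hQ3⟩ := hg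
    exact ⟨P + Q, (Polynomial.natDegree_add_le_of_degree_le hP1 hQ1),
      by simp [hP3, hQ3, mom_add]⟩
  | hsmul a f _ hf =>
    obtain ⟨P, hP1, hP3⟩ := hf
    exact ⟨Polynomial.C (algebraMap (ZMod p) F a) * P,
      (Polynomial.natDegree_C_mul_le _ _).trans hP1, by simp [hP3, mom_smul]⟩
  | hhyp φ =>
    by_cases hR : φ R = 0
    · by_cases hm : m < 𝔮 - 1
      · refine ⟨0, ?_⟩
        simp [mom_hyp_of_eq φ hR, FiniteField.sum_pow_lt_card_sub_one F m hm]
      · refine ⟨Polynomial.C (∑ x : F, x ^ m) *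
          (1 - (Polynomial.C (φ u) + Polynomial.C (φ w) * Polynomial.X) ^ (𝔮 - 1)), ?_, ?_⟩
        · refine (Polynomial.natDegree_C_mul_le _ _).trans ?_
          refine (Polynomial.natDegree_sub_le _ _).trans ?_
          refine max_le (by simp) ?_
          exact (Polynomial.natDegree_pow_le_of_le _ (natDegree_affine_le _ _)).trans (by omega)
        · intro t
          rw [mom_hyp_of_eq φ hR]
          simp [mul_comm t, Polynomial.eval_finsetSum]
    · refine ⟨(Polynomial.C (-φ u / φ R) + Polynomial.C (-φ w / φ R) * Polynomial.X) ^ m, ?_, ?_⟩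
      · exact (Polynomial.natDegree_pow_le_of_le m (natDegree_affine_le _ _)).trans (by simp)
      · intro t
        rw [mom_hyp_of_ne φ hR]
        simp only [Polynomial.eval_pow, Polynomial.eval_add, Polynomial.eval_mul,
          Polynomial.eval_C, Polynomial.eval_X, map_add, map_smul, smul_eq_mul]
        congr 1
        ring

theorem mom_zero {f : V → ZMod p} (hf : f ∈ lcode F p V) (R v : V) :
    mom f R 0 v = algebraMap (ZMod p) F (f 0 - f R) := by
  simp only [mom, pow_zero, mul_one, ← map_sum, line_sum hf]

end LinearCode

section Moments

variable [Fintype F]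

theorem sum_mul_eval (g : F → F) (Q : Polynomial F) :
    ∑ x, g x * Q.eval x = Q.sum fun j a => a * ∑ x, g x * x ^ j := by
  simp only [Polynomial.eval_eq_sum, Polynomial.sum, Finset.mul_sum]
  rw [Finset.sum_comm]
  refine Finset.sum_congr rfl fun j _ => Finset.sum_congr rfl fun x _ => by ring

theorem support_card_of_moment (g : F → F) {m : ℕ} (h0 : ∀ j < m, ∑ x, g x * x ^ j = 0)
    (hm : ∑ x, g x * x ^ m ≠ 0) : m + 1 ≤ (Finset.univ.filter fun x => g x ≠ 0).card := by
  by_contra! hlt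
  set S := Finset.univ.filter fun x => g x ≠ 0 with hS
  let Q : Polynomial F := (∏ x ∈ S, (Polynomial.X - Polynomial.C x)) * Polynomial.X ^ (m - S.card)
  have hQm : Q.Monic :=
    (Polynomial.monic_prod_of_monic _ _ fun x _ => Polynomial.monic_X_sub_C x).mul
      (Polynomial.monic_X_pow _)
  have hQd : Q.natDegree = m := by
    rw [Polynomial.Monic.natDegree_mul
      (Polynomial.monic_prod_of_monic _ _ fun x _ => Polynomial.monic_X_sub_C x)
      (Polynomial.monic_X_pow _), Polynomial.natDegree_prod_of_monic _ _
      (fun x _ => Polynomial.monic_X_sub_C x)]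
    simp
    omega
  have hz : ∑ x, g x * Q.eval x = 0 := by
    refine Finset.sum_eq_zero fun x _ => ?_
    by_cases hx : g x = 0
    · simp [hx]
    · have : x ∈ S := by simp [hS, hx]
      simp [Q, Polynomial.eval_prod, Finset.prod_eq_zero this]
  rw [sum_mul_eval, Polynomial.sum_over_range _ (by simp), hQd, Finset.sum_range_succ,
    Finset.sum_eq_zero] at hz
  · have : Q.coeff m = 1 := by rw [← hQd]; exact hQm
    rw [this] at hz
    simp at hz
    exact hm hz
  · intro j hj
    rw [h0 j (Finset.mem_range.mp hj), mul_zero]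

theorem sum_delta (g : F → F) (y : F) : ∑ x, g x * (1 - (x - y) ^ (𝔮 - 1)) = g y := by
  have h2 : 2 ≤ 𝔮 := Fintype.one_lt_card
  rw [Finset.sum_eq_single y]
  · simp [show 𝔮 - 1 ≠ 0 by omega]
  · intro x _ hx
    rw [FiniteField.pow_card_sub_one_eq_one _ (sub_ne_zero.mpr hx)]
    simp
  · simp

theorem affine_of_moments (g : F → F) (h3 : 3 ≤ 𝔮) (h0 : ∀ j < 𝔮 - 2, ∑ x, g x * x ^ j = 0)
    (y : F) : g y = -(∑ x, g x * x ^ (𝔮 - 2)) * y - ∑ x, g x * x ^ (𝔮 - 1) := by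
  obtain ⟨k, hk⟩ : ∃ k, 𝔮 = k + 2 := ⟨𝔮 - 2, by omega⟩
  have hk' : k + 2 - 1 = k + 1 := rfl
  have hcast : ((k : F) + 2) = 0 := by
    have := FiniteField.cast_card_eq_zero F
    rw [hk] at this
    exact_mod_cast this
  rw [← sum_delta g y]
  have hz := h0 0 (by omega)
  simp only [hk, Nat.add_sub_cancel, hk'] at *
  have : ∀ x : F, g x * (1 - (x - y) ^ (k + 1)) = g x -
      ∑ j ∈ Finset.range (k + 2), (g x * x ^ j) * ((-y) ^ (k + 1 - j) * ((k + 1).choose j : F)) := by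
    intro x
    rw [sub_eq_add_neg x y, add_pow, mul_sub, mul_one, Finset.mul_sum]
    congr 1
    exact Finset.sum_congr rfl fun j _ => by ring
  simp only [this, Finset.sum_sub_distrib]
  rw [Finset.sum_comm]
  rw [Finset.sum_congr rfl fun j _ => (Finset.sum_mul Finset.univ (fun x : F => g x * x ^ j)
    ((-y) ^ (k + 1 - j) * ((k + 1).choose j : F))).symm]
  rw [Finset.sum_range_succ, Finset.sum_range_succ, Finset.sum_eq_zero (s := Finset.range k)
    fun j hj => by rw [h0 j (Finset.mem_range.mp hj), zero_mul]]
  simp only [pow_zero, mul_one] at hz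
  simp only [hz, Nat.choose_succ_self_right, Nat.choose_self, Nat.cast_add, Nat.cast_one,
    Nat.sub_self, pow_zero, Nat.add_sub_cancel_left, pow_one, zero_sub, zero_add, mul_one]
  linear_combination (∑ x, g x * x ^ k) * y * hcast

end Moments

section Forms

variable {V : Type} [AddCommGroup V] [Module F V] [Fintype F] [Fintype V]

theorem IsForm.congr {d : ℕ} {g g' : V → F} (h : IsForm d g) (e : ∀ v, g v = g' v) :
    IsForm d g' := by
  rwa [← funext e]

theorem IsForm.line_zeros {d : ℕ} {g : V → F} (h : IsForm d g) {w : V} (hw : g w ≠ 0) (u : V) :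
    (Finset.univ.filter fun t : F => g (u + t • w) = 0).card ≤ d := by
  obtain ⟨P, hP, hc, he⟩ := h u w
  have hP0 : P ≠ 0 := by rintro rfl; simp at hc; exact hw hc.symm
  calc _ ≤ P.roots.toFinset.card := by
        refine Finset.card_le_card fun t ht => ?_
        simp only [Finset.mem_filter, Finset.mem_univ, true_and] at ht
        simp [hP0, he, ht]
    _ ≤ P.roots.card := Multiset.toFinset_card_le _
    _ ≤ P.natDegree := P.card_roots'
    _ ≤ d := hP

theorem IsForm.line_nonzeros {d : ℕ} {g : V → F} (h : IsForm d g) {w : V} (hw : g w ≠ 0) (u : V) :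
    𝔮 - d ≤ (Finset.univ.filter fun t : F => g (u + t • w) ≠ 0).card := by
  have h1 := h.line_zeros hw u
  have h2 := Finset.card_filter_add_card_filter_not (s := (Finset.univ : Finset F))
    (fun t : F => g (u + t • w) = 0)
  rw [Finset.card_univ] at h2
  simp only [ne_eq]
  omega

/-- Averaging a predicate over parallel lines. -/
theorem sum_card_line (A : V → Prop) [DecidablePred A] (w : V) :
    ∑ u : V, (Finset.univ.filter fun t : F => A (t • w + u)).card =
      𝔮 * (Finset.univ.filter A).card := by
  simp only [Finset.card_filter]
  rw [Finset.sum_comm]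
  have : ∀ t : F, (∑ u : V, if A (t • w + u) then 1 else 0) = ∑ u : V, if A u then 1 else 0 :=
    fun t => Fintype.sum_equiv (Equiv.addLeft (t • w)) _ _ fun u => rfl
  simp [this]

theorem IsForm.nonzeros {d : ℕ} {g : V → F} (h : IsForm d g) {w : V} (hw : g w ≠ 0) :
    (𝔮 - d) * Fintype.card V ≤ 𝔮 * (Finset.univ.filter fun v : V => g v ≠ 0).card := by
  rw [← sum_card_line (F := F) (fun v => g v ≠ 0) w, mul_comm, ← smul_eq_mul, ← Finset.card_univ,
    ← Finset.sum_const]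
  refine Finset.sum_le_sum fun u _ => ?_
  simpa [add_comm] using h.line_nonzeros hw u

end Forms

section Counts

variable {V : Type} [AddCommGroup V] [Module F V] {p : ℕ} [Fintype F]

/-- The number of support points on the affine line through `v` with direction `R`. -/
def cnt (F : Type) [Field F] [Fintype F] {V : Type} [AddCommGroup V] [Module F V] {p : ℕ}
    (f : V → ZMod p) (R v : V) : ℕ :=
  (Finset.univ.filter fun x : F => f (x • R + v) ≠ 0).card

theorem cnt_le (f : V → ZMod p) (R v : V) : cnt F f R v ≤ 𝔮 :=
  (Finset.card_filter_le _ _).trans (by simp)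

theorem cnt_shift (f : V → ZMod p) (R v : V) (y : F) : cnt F f R (y • R + v) = cnt F f R v := by
  unfold cnt
  refine Finset.card_equiv (Equiv.addRight y) fun x => ?_
  simp [add_smul, add_assoc]

variable [Fact p.Prime] [Algebra (ZMod p) F]

theorem cnt_smul {f : V → ZMod p} (hf : f ∈ lcode F p V) (R v : V) {μ : F} (hμ : μ ≠ 0) :
    cnt F f R (μ • v) = cnt F f R v := by
  unfold cnt
  refine Finset.card_equiv (Equiv.mulLeft₀ μ⁻¹ (inv_ne_zero hμ)) fun x => ?_
  have : f ((μ⁻¹ * x) • R + v) = f (x • R + μ • v) := by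
    rw [← lcode_smul hf hμ]; simp [smul_smul, hμ]
  simp [this]

theorem cnt_smul_dir (f : V → ZMod p) (R v : V) {μ : F} (hμ : μ ≠ 0) :
    cnt F f (μ • R) v = cnt F f R v := by
  unfold cnt
  refine Finset.card_equiv (Equiv.mulRight₀ μ hμ) fun x => ?_
  simp [smul_smul]

theorem algebraMap_ne_zero_iff (a : ZMod p) : algebraMap (ZMod p) F a ≠ 0 ↔ a ≠ 0 := by
  simp

theorem cnt_ge_of_mom {f : V → ZMod p} {R v : V} {m : ℕ}
    (h0 : ∀ j < m, mom (F := F) f R j v = 0) (hm : mom (F := F) f R m v ≠ 0) :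
    m + 1 ≤ cnt F f R v := by
  have := support_card_of_moment (fun x : F => algebraMap (ZMod p) F (f (x • R + v))) h0 hm
  refine this.trans (le_of_eq ?_)
  unfold cnt
  congr 1
  ext x
  simp

theorem affine_of_mom {f : V → ZMod p} {R v : V} (h3 : 3 ≤ 𝔮)
    (h0 : ∀ j < 𝔮 - 2, mom (F := F) f R j v = 0) (y : F) :
    algebraMap (ZMod p) F (f (y • R + v)) =
      -(mom f R (𝔮 - 2) v) * y - mom f R (𝔮 - 1) v :=
  affine_of_moments (fun x : F => algebraMap (ZMod p) F (f (x • R + v))) h3 h0 y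

theorem const_of_mom {f : V → ZMod p} {R v : V} (h3 : 3 ≤ 𝔮)
    (h0 : ∀ j < 𝔮 - 1, mom (F := F) f R j v = 0) (y : F) : f (y • R + v) = f v := by
  apply (algebraMap (ZMod p) F).injective
  have h1 := affine_of_mom h3 (fun j hj => h0 j (by omega)) y
  have h2 := affine_of_mom h3 (fun j hj => h0 j (by omega)) (0 : F)
  rw [zero_smul, zero_add] at h2
  rw [h1, h2, h0 (𝔮 - 2) (by omega)]
  simp

variable [Fintype V]

/-- The number of vectors at which `f` does not vanish. -/
def nz (f : V → ZMod p) : ℕ := (Finset.univ.filter fun v : V => f v ≠ 0).card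

/-- The number of nonzero vectors at which `f` does not vanish. -/
def wtv (f : V → ZMod p) : ℕ := (Finset.univ.filter fun v : V => v ≠ 0 ∧ f v ≠ 0).card

theorem nz_eq (f : V → ZMod p) : nz f = wtv f + if f 0 ≠ 0 then 1 else 0 := by
  unfold nz wtv
  have h := Finset.card_filter_add_card_filter_not (s := Finset.univ.filter fun v : V => f v ≠ 0)
    (fun v => v ≠ 0)
  rw [← h, Finset.filter_filter, Finset.filter_filter]
  congr 2
  · ext v; simp [and_comm]
  · split_ifs with h0
    · rw [Finset.card_eq_one]
      refine ⟨0, ?_⟩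
      ext v
      simp only [Finset.mem_filter, Finset.mem_univ, true_and, Finset.mem_singleton]
      constructor
      · rintro ⟨_, h⟩; simpa using h
      · rintro rfl; exact ⟨h0, by simp⟩
    · rw [Finset.card_eq_zero]
      ext v
      simp only [Finset.mem_filter, Finset.mem_univ, true_and, Finset.notMem_empty, iff_false]
      rintro ⟨h1, h2⟩
      have : v = 0 := by simpa using h2
      subst this
      exact h0 h1

theorem sum_cnt (f : V → ZMod p) (R : V) : ∑ v, cnt F f R v = 𝔮 * nz f :=
  sum_card_line (F := F) (fun v => f v ≠ 0) R

end Counts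

section Hankel

open Polynomial

theorem hankel_det_ne_zero {s : ℕ} {S : Finset F} (hS : S.card = s) {g : F → F}
    (hg : ∀ x ∈ S, g x ≠ 0) :
    (Matrix.of fun i j : Fin s => ∑ x ∈ S, g x * x ^ ((i : ℕ) + j)).det ≠ 0 := by
  let e : Fin s ≃ S := (S.equivFinOfCardEq hS).symm
  let v : Fin s → F := fun i => e i
  have hM : (Matrix.of fun i j : Fin s => ∑ x ∈ S, g x * x ^ ((i : ℕ) + j)) =
      (Matrix.vandermonde v).transpose * Matrix.diagonal (fun i => g (v i)) *
        Matrix.vandermonde v := by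
    ext i j
    rw [Matrix.mul_apply, Matrix.of_apply, ← Finset.sum_coe_sort, ← Equiv.sum_comp e]
    refine Finset.sum_congr rfl fun k _ => ?_
    simp only [Matrix.mul_diagonal, Matrix.transpose_apply, Matrix.vandermonde_apply, v]
    ring
  rw [hM, Matrix.det_mul, Matrix.det_mul, Matrix.det_transpose, Matrix.det_diagonal]
  have hv : Function.Injective v := Subtype.val_injective.comp e.injective
  have h1 : (Matrix.vandermonde v).det ≠ 0 := Matrix.det_vandermonde_ne_zero_iff.mpr hv
  exact mul_ne_zero (mul_ne_zero h1 (Finset.prod_ne_zero_iff.mpr fun i _ => hg _ (e i).2)) h1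

theorem hankel_natDegree_le {s : ℕ} (P : ℕ → F[X]) (hP : ∀ k, (P k).natDegree ≤ k) :
    (Matrix.of fun i j : Fin s => P (i + j)).det.natDegree ≤ s * (s - 1) := by
  rw [Matrix.det_apply]
  refine natDegree_sum_le_of_forall_le _ _ fun σ _ => ?_
  have h1 : (∏ i : Fin s, P ((σ i : ℕ) + i)).natDegree ≤ s * (s - 1) := by
    refine (natDegree_prod_le _ _).trans ?_
    calc _ ≤ ∑ i : Fin s, ((σ i : ℕ) + i) := Finset.sum_le_sum fun i _ => hP _
      _ = ∑ i : Fin s, (i : ℕ) + ∑ i : Fin s, (i : ℕ) := by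
        rw [Finset.sum_add_distrib, Equiv.sum_comp σ (fun i : Fin s => (i : ℕ))]
      _ = s * (s - 1) := by
        rw [Fin.sum_univ_eq_sum_range (fun i => i) s, ← mul_two, Finset.sum_range_id_mul_two]
  rcases Int.units_eq_one_or (Equiv.Perm.sign σ) with h | h <;> simpa [h] using h1

theorem hankel_dvd {s : ℕ} (P : ℕ → F[X]) (t : F) (S : Finset F) (g : F → F)
    (hP : ∀ k, (P k).eval t = ∑ x ∈ S, g x * x ^ k) :
    (X - C t) ^ (s - S.card) ∣ (Matrix.of fun i j : Fin s => P (i + j)).det := by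
  set Q : F[X] := ∏ x ∈ S, (X - C x) with hQ
  have hQm : Q.Monic := monic_prod_of_monic _ _ fun x _ => monic_X_sub_C x
  have hQd : Q.natDegree = S.card := by
    rw [hQ, natDegree_prod_of_monic _ _ fun x _ => monic_X_sub_C x]; simp
  let r : ℕ → F[X] := fun i => if i < S.card then X ^ i else X ^ (i - S.card) * Q
  have hrm : ∀ i, (r i).Monic := fun i => by
    simp only [r]; split_ifs
    · exact monic_X_pow _
    · exact (monic_X_pow _).mul hQm
  have hrd : ∀ i, (r i).natDegree = i := fun i => by
    simp only [r]; split_ifs with h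
    · simp
    · rw [(monic_X_pow _).natDegree_mul hQm, hQd, natDegree_X_pow]; omega
  let U : Matrix (Fin s) (Fin s) F[X] := Matrix.of fun i k => C ((r i).coeff k)
  have hU : U.det = 1 := by
    rw [Matrix.det_of_isLowerTriangular]
    · refine Finset.prod_eq_one fun i _ => ?_
      have : (r i).coeff i = 1 := by
        have := hrm i
        rw [Monic, leadingCoeff, hrd] at this
        exact this
      simp [U, this]
    · intro i j hij
      have hij' : (i : ℕ) < j := hij
      simp only [U, Matrix.of_apply]
      rw [coeff_eq_zero_of_natDegree_lt (by rw [hrd]; exact hij')]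
      simp
  set N : Matrix (Fin s) (Fin s) F[X] := Matrix.of fun i j : Fin s => P (i + j) with hN
  have hdiv : ∀ i j : Fin s, (if (i : ℕ) < S.card then 1 else X - C t) ∣ (U * N) i j := by
    intro i j
    split_ifs with hi
    · exact one_dvd _
    rw [dvd_iff_isRoot, IsRoot.def, Matrix.mul_apply, eval_finsetSum]
    simp only [U, hN, Matrix.of_apply, eval_mul, eval_C, hP, Finset.mul_sum]
    rw [Finset.sum_comm]
    refine Finset.sum_eq_zero fun x hx => ?_
    have h1 : ∑ k : Fin s, (r i).coeff k * (g x * x ^ ((k : ℕ) + j)) =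
        g x * x ^ (j : ℕ) * (r i).eval x := by
      rw [eval_eq_sum_range' (n := s) (by rw [hrd]; exact i.2), Finset.mul_sum,
        ← Fin.sum_univ_eq_sum_range (fun k => g x * x ^ (j : ℕ) * ((r i).coeff k * x ^ k))]
      refine Finset.sum_congr rfl fun k _ => by ring
    rw [h1]
    have : (r i).eval x = 0 := by
      have hQx : Q.eval x = 0 := by
        rw [hQ, eval_prod]
        exact Finset.prod_eq_zero hx (by simp)
      simp only [r, hi, if_false, eval_mul, hQx, mul_zero]
    rw [this, mul_zero]
  choose A hA using hdiv
  have hdet : N.det = (∏ i : Fin s, if (i : ℕ) < S.card then 1 else X - C t) *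
      (Matrix.of A).det := by
    have hUN : U * N = Matrix.of fun i j : Fin s =>
        (if (i : ℕ) < S.card then 1 else X - C t) * (Matrix.of A) i j := by
      ext1 i j
      exact hA i j
    rw [← Matrix.det_mul_column, ← hUN, Matrix.det_mul, hU, one_mul]
  rw [hdet]
  refine Dvd.dvd.mul_right (dvd_of_eq ?_) _
  rw [Fin.prod_univ_eq_prod_range (fun i => if i < S.card then (1 : F[X]) else X - C t) s,
    Finset.prod_ite, Finset.prod_const_one, one_mul, Finset.prod_const]
  congr 1
  have : (Finset.range s).filter (fun i => ¬ i < S.card) = Finset.Ico S.card s := by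
    ext i; simp; omega
  rw [this, Nat.card_Ico]

theorem hankel_sum_le [Fintype F] {s : ℕ} (P : ℕ → F[X]) (hP : ∀ k, (P k).natDegree ≤ k)
    (S : F → Finset F) (g : F → F → F)
    (he : ∀ t k, (P k).eval t = ∑ x ∈ S t, g t x * x ^ k) (hS : (S 0).card = s)
    (hg : ∀ x ∈ S 0, g 0 x ≠ 0) : ∑ t, (s - (S t).card) ≤ s * (s - 1) := by
  have h0 : (Matrix.of fun i j : Fin s => P (i + j)).det ≠ 0 := by
    intro h
    apply hankel_det_ne_zero hS hg
    have := congrArg (evalRingHom (0 : F)) h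
    rw [RingHom.map_det, map_zero] at this
    refine Eq.trans (congrArg Matrix.det ?_) this
    ext i j
    simp [he]
  have hd : ∏ t : F, (X - C t) ^ (s - (S t).card) ∣
      (Matrix.of fun i j : Fin s => P (i + j)).det := by
    refine Finset.prod_dvd_of_coprime (fun a _ b _ hab => ?_) fun t _ => ?_
    · exact (pairwise_coprime_X_sub_C Function.injective_id hab).pow
    · exact hankel_dvd P t (S t) (g t) (he t)
  have h1 := natDegree_le_of_dvd hd h0
  rw [natDegree_prod_of_monic _ _ fun t _ => (monic_X_sub_C t).pow _] at h1
  simp only [natDegree_pow, natDegree_X_sub_C, mul_one] at h1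
  exact h1.trans (hankel_natDegree_le P hP)

end Hankel

section LineInequality

variable {V : Type} [AddCommGroup V] [Module F V] {p : ℕ} [Fintype F] [Fact p.Prime]
  [Algebra (ZMod p) F]

theorem sum_cnt_ne_zero {f : V → ZMod p} (hf : f ∈ lcode F p V) (u v κ : V) :
    cnt F f u v * (𝔮 - cnt F f u v) ≤
      ∑ c ∈ Finset.univ.erase (0 : F), cnt F f u (κ + c • v) := by
  set s := cnt F f u v with hs
  choose P hP he using fun k => mom_polynomial hf u k v κ
  have key := hankel_sum_le (s := s) P hP
    (fun t => Finset.univ.filter fun x : F => f (x • u + (v + t • κ)) ≠ 0)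
    (fun t x => algebraMap (ZMod p) F (f (x • u + (v + t • κ))))
    (fun t k => by
      rw [he, mom, Finset.sum_filter_of_ne]
      intro x _ hx h0
      simp [h0] at hx)
    (by simp [hs, cnt]) (by simp)
  have h1 : 𝔮 * s ≤ s * (s - 1) + ∑ t : F, cnt F f u (v + t • κ) := by
    refine le_trans ?_ (Nat.add_le_add_right key _)
    rw [← Finset.sum_add_distrib, ← smul_eq_mul, ← Finset.card_univ, ← Finset.sum_const]
    refine Finset.sum_le_sum fun t _ => ?_
    unfold cnt
    omega
  have h2 : ∑ t : F, cnt F f u (v + t • κ) =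
      s + ∑ t ∈ Finset.univ.erase (0 : F), cnt F f u (v + t • κ) := by
    rw [← Finset.add_sum_erase _ _ (Finset.mem_univ (0 : F))]
    simp [hs]
  have h3 : ∑ t ∈ Finset.univ.erase (0 : F), cnt F f u (v + t • κ) =
      ∑ c ∈ Finset.univ.erase (0 : F), cnt F f u (κ + c • v) := by
    refine Finset.sum_nbij' (fun t => t⁻¹) (fun t => t⁻¹) ?_ ?_ ?_ ?_ ?_
    · intro a ha; simpa using ha
    · intro a ha; simpa using ha
    · intro a ha; simp
    · intro a ha; simp
    · intro a ha
      have ha' : a ≠ 0 := by simpa using ha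
      rw [← cnt_smul hf u (κ + a⁻¹ • v) ha']
      congr 1
      rw [smul_add, smul_smul, mul_inv_cancel₀ ha', one_smul, add_comm]
  rw [← h3]
  rw [h2] at h1
  have hsq : s ≤ 𝔮 := cnt_le f u v
  rcases Nat.eq_zero_or_pos s with h0 | h0
  · simp [h0]
  · obtain ⟨k, hk⟩ : ∃ k, s = k + 1 := ⟨s - 1, by omega⟩
    obtain ⟨d, hd⟩ : ∃ d, 𝔮 = s + d := ⟨𝔮 - s, by omega⟩
    rw [hd] at h1 ⊢
    rw [Nat.add_sub_cancel_left]
    rw [hk] at h1 ⊢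
    rw [Nat.add_sub_cancel] at h1
    nlinarith

theorem line_inequality {f : V → ZMod p} (hf : f ∈ lcode F p V) (u v κ : V) :
    𝔮 * (cnt F f u v * (𝔮 - cnt F f u v)) ≤ (𝔮 - 1) * ∑ c : F, cnt F f u (κ + c • v) := by
  have h1 : ∀ c₀ : F, cnt F f u v * (𝔮 - cnt F f u v) + cnt F f u (κ + c₀ • v) ≤
      ∑ c : F, cnt F f u (κ + c • v) := by
    intro c₀
    have := sum_cnt_ne_zero hf u v (κ + c₀ • v)
    have e : ∑ c : F, cnt F f u (κ + c₀ • v + c • v) = ∑ c : F, cnt F f u (κ + c • v) :=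
      Fintype.sum_equiv (Equiv.addLeft c₀) _ _ fun c => by simp [add_smul, add_assoc]
    rw [← e, ← Finset.add_sum_erase _ _ (Finset.mem_univ (0 : F))]
    simp only [zero_smul, add_zero]
    omega
  have h2 := Finset.sum_le_sum fun c (_ : c ∈ (Finset.univ : Finset F)) => h1 c
  rw [Finset.sum_add_distrib, Finset.sum_const, Finset.sum_const, Finset.card_univ] at h2
  simp only [smul_eq_mul] at h2
  obtain ⟨k, hk⟩ : ∃ k, 𝔮 = k + 1 := ⟨𝔮 - 1, by have := two_le_card (F := F); omega⟩
  rw [hk] at h2 ⊢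
  rw [Nat.add_sub_cancel]
  rw [Nat.succ_mul k (∑ c : F, _)] at h2
  omega

end LineInequality

section Lines

variable {V : Type} [AddCommGroup V] [Module F V] {p : ℕ} [Fintype F]

/-- Linear independence of two vectors. -/
def Ind (F : Type) [Field F] {V : Type} [AddCommGroup V] [Module F V] (u v : V) : Prop :=
  ∀ a b : F, a • u + b • v = 0 → a = 0 ∧ b = 0

theorem Ind.symm {u v : V} (h : Ind F u v) : Ind F v u := fun a b hab =>
  (h b a (by rw [add_comm]; exact hab)).symm

theorem Ind.left_ne {u v : V} (h : Ind F u v) : u ≠ 0 := fun h0 =>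
  one_ne_zero (h 1 0 (by simp [h0])).1

theorem Ind.right_ne {u v : V} (h : Ind F u v) : v ≠ 0 := h.symm.left_ne

theorem ind_of_notMem {R v : V} (hR : R ≠ 0) (hv : v ∉ Submodule.span F {R}) : Ind F R v := by
  intro a b hab
  have hb : b = 0 := by
    by_contra hb
    apply hv
    rw [Submodule.mem_span_singleton]
    refine ⟨-(b⁻¹ * a), ?_⟩
    have : v = b⁻¹ • (b • v) := by rw [smul_smul, inv_mul_cancel₀ hb, one_smul]
    rw [this, eq_neg_of_add_eq_zero_right hab, neg_smul, smul_neg, smul_smul]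
  subst hb
  simp only [zero_smul, add_zero, smul_eq_zero, hR, or_false] at hab
  exact ⟨hab, rfl⟩

theorem Ind.notMem {R v : V} (h : Ind F R v) : v ∉ Submodule.span F {R} := by
  rw [Submodule.mem_span_singleton]
  rintro ⟨a, ha⟩
  have := (h a (-1) (by rw [ha]; simp)).2
  simp at this

theorem Ind.add_smul {u v : V} (h : Ind F u v) (x : F) : Ind F u (x • u + v) := by
  intro a b hab
  have := h (a + b * x) b (by rw [← hab]; module)
  refine ⟨?_, this.2⟩
  have h1 := this.1
  rw [this.2] at h1
  simpa using h1

/-- The number of support points on the projective line spanned by `u` and `v`. -/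
def tot (F : Type) [Field F] [Fintype F] {V : Type} [AddCommGroup V] [Module F V] {p : ℕ}
    (f : V → ZMod p) (u v : V) : ℕ :=
  (if f u ≠ 0 then 1 else 0) + cnt F f u v

theorem tot_eq_cnt_add_one {f : V → ZMod p} {u : V} (h : f u ≠ 0) (v : V) :
    tot F f u v = cnt F f u v + 1 := by simp [tot, h, add_comm]

variable [Fact p.Prime] [Algebra (ZMod p) F] {f : V → ZMod p}

theorem card_smul_ne (hf : f ∈ lcode F p V) (u : V) :
    (Finset.univ.filter fun a : F => f (a • u) ≠ 0).card =
      (𝔮 - 1) * (if f u ≠ 0 then 1 else 0) + if f 0 ≠ 0 then 1 else 0 := by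
  rw [Finset.card_filter, ← Finset.add_sum_erase _ _ (Finset.mem_univ (0 : F)), zero_smul, add_comm]
  congr 1
  rw [Finset.sum_congr rfl fun a ha => by
    rw [lcode_smul hf (Finset.ne_of_mem_erase ha)]]
  rw [Finset.sum_const, Finset.card_erase_of_mem (Finset.mem_univ _), Finset.card_univ,
    smul_eq_mul]

theorem sum_cnt_line (hf : f ∈ lcode F p V) (u v : V) :
    ∑ b : F, cnt F f u (b • v) = (𝔮 - 1) * tot F f u v + if f 0 ≠ 0 then 1 else 0 := by
  rw [← Finset.add_sum_erase _ _ (Finset.mem_univ (0 : F)), zero_smul,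
    Finset.sum_congr rfl fun b hb => cnt_smul hf u v (Finset.ne_of_mem_erase hb),
    Finset.sum_const, Finset.card_erase_of_mem (Finset.mem_univ _), Finset.card_univ]
  have : cnt F f u 0 = (Finset.univ.filter fun a : F => f (a • u) ≠ 0).card := by simp [cnt]
  rw [this, card_smul_ne hf, tot, smul_eq_mul]
  ring

variable [Fintype V]

theorem card_line (hf : f ∈ lcode F p V) {u v : V} (h : Ind F u v) :
    (Finset.univ.filter fun w : V => w ∈ Submodule.span F {u, v} ∧ f w ≠ 0).card =
      (𝔮 - 1) * tot F f u v + if f 0 ≠ 0 then 1 else 0 := by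
  rw [← sum_cnt_line hf]
  unfold cnt
  rw [← Finset.card_sigma]
  symm
  refine Finset.card_bij (fun ab _ => ab.2 • u + ab.1 • v) ?_ ?_ ?_
  · rintro ⟨b, a⟩ hab
    simp only [Finset.mem_sigma, Finset.mem_filter, Finset.mem_univ, true_and] at hab ⊢
    exact ⟨Submodule.mem_span_pair.mpr ⟨a, b, rfl⟩, hab⟩
  · rintro ⟨b, a⟩ _ ⟨b', a'⟩ _ hab
    have := h (a - a') (b - b') (by
      have : a • u + b • v = a' • u + b' • v := hab
      rw [sub_smul, sub_smul, sub_add_sub_comm, this, sub_self])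
    rw [sub_eq_zero, sub_eq_zero] at this
    rw [this.1, this.2]
  · intro w hw
    simp only [Finset.mem_filter, Finset.mem_univ, true_and] at hw
    obtain ⟨a, b, rfl⟩ := Submodule.mem_span_pair.mp hw.1
    exact ⟨⟨b, a⟩, by simpa using hw.2, rfl⟩

theorem tot_congr (hf : f ∈ lcode F p V) {u v u' v' : V} (h : Ind F u v) (h' : Ind F u' v')
    (hs : Submodule.span F {u, v} = Submodule.span F {u', v'}) : tot F f u v = tot F f u' v' := by
  have h1 := card_line hf h
  have h2 := card_line hf h'
  rw [hs, h2] at h1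
  have h3 := two_le_card (F := F)
  exact (Nat.eq_of_mul_eq_mul_left (show 0 < 𝔮 - 1 by omega) (Nat.add_right_cancel h1)).symm

theorem card_span_pair {u v : V} (h : Ind F u v) :
    (Finset.univ.filter fun w : V => w ∈ Submodule.span F {u, v}).card = 𝔮 ^ 2 := by
  rw [sq, ← Fintype.card_prod, ← Finset.card_univ]
  symm
  refine Finset.card_bij (fun (ab : F × F) _ => ab.1 • u + ab.2 • v) ?_ ?_ ?_
  · rintro ⟨a, b⟩ _
    simpa using Submodule.mem_span_pair.mpr ⟨a, b, rfl⟩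
  · rintro ⟨a, b⟩ _ ⟨a', b'⟩ _ hab
    have := h (a - a') (b - b') (by
      have : a • u + b • v = a' • u + b' • v := hab
      rw [sub_smul, sub_smul, sub_add_sub_comm, this, sub_self])
    rw [sub_eq_zero, sub_eq_zero] at this
    rw [this.1, this.2]
  · intro w hw
    simp only [Finset.mem_filter, Finset.mem_univ, true_and] at hw
    obtain ⟨a, b, rfl⟩ := Submodule.mem_span_pair.mp hw
    exact ⟨⟨a, b⟩, by simp⟩

theorem card_span_singleton {u : V} (h : u ≠ 0) :
    (Finset.univ.filter fun w : V => w ∈ Submodule.span F {u}).card = 𝔮 := by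
  rw [← Finset.card_univ (α := F)]
  symm
  refine Finset.card_bij (fun (a : F) _ => a • u) ?_ ?_ ?_
  · intro a _
    simpa using Submodule.mem_span_singleton.mpr ⟨a, rfl⟩
  · intro a _ a' _ hab
    exact smul_left_injective F h hab
  · intro w hw
    simp only [Finset.mem_filter, Finset.mem_univ, true_and] at hw
    obtain ⟨a, rfl⟩ := Submodule.mem_span_singleton.mp hw
    exact ⟨a, by simp⟩

theorem sum_plane (f : V → ZMod p) (u v : V) :
    ∑ κ : V, ∑ c : F, cnt F f u (κ + c • v) = 𝔮 ^ 2 * nz f := by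
  rw [Finset.sum_comm]
  have : ∀ c : F, ∑ κ : V, cnt F f u (κ + c • v) = 𝔮 * nz f := fun c => by
    rw [← sum_cnt f u]
    exact Fintype.sum_equiv (Equiv.addRight (c • v)) _ _ fun κ => rfl
  simp [this, sq, mul_assoc]

theorem sum_plane_notMem (hf : f ∈ lcode F p V) {u v : V} (h : Ind F u v) :
    ∑ κ ∈ Finset.univ.filter (fun κ : V => κ ∉ Submodule.span F {u, v}),
      ∑ c : F, cnt F f u (κ + c • v) + 𝔮 ^ 2 * ((𝔮 - 1) * tot F f u v) = 𝔮 ^ 2 * wtv f := by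
  have h1 := sum_plane (F := F) f u v
  rw [← Finset.sum_filter_add_sum_filter_not Finset.univ
    (fun κ : V => κ ∈ Submodule.span F {u, v})] at h1
  have h2 : ∀ κ ∈ Finset.univ.filter (fun κ : V => κ ∈ Submodule.span F {u, v}),
      ∑ c : F, cnt F f u (κ + c • v) = (𝔮 - 1) * tot F f u v + if f 0 ≠ 0 then 1 else 0 := by
    intro κ hκ
    simp only [Finset.mem_filter, Finset.mem_univ, true_and] at hκ
    obtain ⟨a, b, rfl⟩ := Submodule.mem_span_pair.mp hκ
    rw [← sum_cnt_line hf]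
    refine Fintype.sum_equiv (Equiv.addLeft b) _ _ fun c => ?_
    rw [add_assoc, cnt_shift, ← add_smul]
    rfl
  rw [Finset.sum_congr rfl h2, Finset.sum_const, card_span_pair h, nz_eq, smul_eq_mul] at h1
  nlinarith

/-- Every line meets the support in at most `σ` or at least `q + 1 - τ` points. -/
def LineGap (F : Type) [Field F] [Fintype F] {V : Type} [AddCommGroup V] [Module F V] {p : ℕ}
    (f : V → ZMod p) (σ τ : ℕ) : Prop :=
  ∀ u v : V, Ind F u v → tot F f u v ≤ σ ∨ Fintype.card F + 1 ≤ tot F f u v + τ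

theorem exists_zero_on_line {f : V → ZMod p} {u v : V} (h : Ind F u v)
    (hs : tot F f u v ≤ 𝔮) :
    ∃ u' v', Ind F u' v' ∧ Submodule.span F {u', v'} = Submodule.span F {u, v} ∧ f u' = 0 := by
  by_cases hu : f u = 0
  · exact ⟨u, v, h, rfl, hu⟩
  rw [tot_eq_cnt_add_one hu] at hs
  have : ∃ x : F, f (x • u + v) = 0 := by
    by_contra! hx
    have : cnt F f u v = 𝔮 := by
      unfold cnt
      rw [Finset.filter_true_of_mem fun x _ => hx x, Finset.card_univ]
    omega
  obtain ⟨x, hx⟩ := this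
  refine ⟨x • u + v, u, (h.add_smul x).symm, ?_, hx⟩
  apply le_antisymm
  · rw [Submodule.span_le]
    rintro w (rfl | rfl)
    · exact Submodule.mem_span_pair.mpr ⟨x, 1, by simp⟩
    · exact Submodule.mem_span_pair.mpr ⟨1, 0, by simp⟩
  · rw [Submodule.span_le]
    rintro w (rfl | rfl)
    · exact Submodule.mem_span_pair.mpr ⟨0, 1, by simp⟩
    · exact Submodule.mem_span_pair.mpr ⟨1, -x, by simp⟩

theorem lineGap_of_wtv (hf : f ∈ lcode F p V) {n : ℕ} (hV : Fintype.card V = 𝔮 ^ (n + 2))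
    {σ τ M : ℕ} (hτ : 1 ≤ τ) (hM : M ≤ (𝔮 - 1) * (σ + 1))
    (hs : ∀ s, σ < s → s + τ ≤ 𝔮 → (𝔮 - 1) * (M - 1) < 𝔮 * (s * (𝔮 - s)))
    (hw : wtv f < M * 𝔮 ^ n) : LineGap F f σ τ := by
  intro u₀ v₀ h₀
  by_contra! hcon
  obtain ⟨u, v, h, hsp, hu⟩ := exists_zero_on_line (f := f) h₀ (by omega)
  rw [← tot_congr hf h h₀ hsp] at hcon
  obtain ⟨h1, h2⟩ := hcon
  have htot : tot F f u v = cnt F f u v := by simp [tot, hu]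
  rw [htot] at h1 h2
  have key : ∀ κ : V, M ≤ ∑ c : F, cnt F f u (κ + c • v) := by
    intro κ
    have h3 := line_inequality hf u v κ
    have h4 := hs _ h1 (by omega)
    have := lt_of_mul_lt_mul_left (lt_of_lt_of_le h4 h3) (Nat.zero_le _)
    omega
  have h5 := sum_plane_notMem hf h
  have h6 : (𝔮 ^ (n + 2) - 𝔮 ^ 2) * M ≤
      ∑ κ ∈ Finset.univ.filter (fun κ : V => κ ∉ Submodule.span F {u, v}),
      ∑ c : F, cnt F f u (κ + c • v) := by
    have h7 : (Finset.univ.filter (fun κ : V => κ ∉ Submodule.span F {u, v})).card =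
        𝔮 ^ (n + 2) - 𝔮 ^ 2 := by
      have := Finset.card_filter_add_card_filter_not (s := (Finset.univ : Finset V))
        (fun κ : V => κ ∈ Submodule.span F {u, v})
      rw [Finset.card_univ, hV, card_span_pair h] at this
      omega
    rw [← h7, ← smul_eq_mul, ← Finset.sum_const]
    exact Finset.sum_le_sum fun κ _ => key κ
  rw [htot] at h5
  have h8 : 𝔮 ^ (n + 2) = 𝔮 ^ 2 * 𝔮 ^ n := by ring
  have h9 : 1 ≤ 𝔮 ^ n := Nat.one_le_pow _ _ (by have := two_le_card (F := F); omega)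
  have h10 : (𝔮 - 1) * (σ + 1) ≤ (𝔮 - 1) * cnt F f u v := Nat.mul_le_mul_left _ h1
  have h11 : (𝔮 ^ (n + 2) - 𝔮 ^ 2) * M = 𝔮 ^ 2 * (M * 𝔮 ^ n - M) := by
    rw [h8, ← Nat.mul_sub_one, Nat.mul_assoc, mul_comm M, Nat.sub_one_mul]
  have h12 : 𝔮 ^ 2 * (M * 𝔮 ^ n) ≤ 𝔮 ^ 2 * wtv f := by
    rw [← h5]
    refine le_trans ?_ (Nat.add_le_add_right h6 _)
    rw [h11, ← mul_add]
    exact Nat.mul_le_mul_left _ (by omega)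
  have h13 : 0 < 𝔮 ^ 2 := by have := two_le_card (F := F); positivity
  have := Nat.le_of_mul_le_mul_left h12 h13
  omega

theorem LineGap.comp {V' : Type} [AddCommGroup V'] [Module F V'] {σ τ : ℕ} {f : V → ZMod p}
    (h : LineGap F f σ τ) (g : V' →ₗ[F] V) (hg : Function.Injective g) :
    LineGap F (fun v => f (g v)) σ τ := by
  intro u v huv
  have h1 : Ind F (g u) (g v) := fun a b hab =>
    huv a b (hg (by simpa using hab))
  have h2 : tot F (fun v => f (g v)) u v = tot F f (g u) (g v) := by simp [tot, cnt]
  rw [h2]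
  exact h _ _ h1

end Lines

section Cone

variable {V : Type} [AddCommGroup V] [Module F V] {p : ℕ} [Fintype F] [Fact p.Prime]
  [Algebra (ZMod p) F] {f : V → ZMod p}

/-- Away from the origin, the support of `f` is covered by `t` hyperplanes. -/
def Covered (F : Type) [Field F] {V : Type} [AddCommGroup V] [Module F V] {p : ℕ} (t : ℕ)
    (f : V → ZMod p) : Prop :=
  ∃ φ : Fin t → Module.Dual F V, (∀ i, φ i ≠ 0) ∧ ∀ v, v ≠ 0 → f v ≠ 0 → ∃ i, φ i v = 0

theorem Covered.succ {t : ℕ} (h : Covered F (t + 1) f) : Covered F (t + 2) f := by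
  obtain ⟨φ, h1, h2⟩ := h
  refine ⟨Fin.cons (φ 0) φ, ?_, fun v hv hfv => ?_⟩
  · intro i
    refine Fin.cases ?_ (fun j => ?_) i
    · exact h1 0
    · exact h1 j
  · obtain ⟨i, hi⟩ := h2 v hv hfv
    exact ⟨i.succ, by simpa using hi⟩

theorem Covered.comp {K : Type} [AddCommGroup K] [Module F K] {t : ℕ} {g : K → ZMod p}
    (h : Covered F t g) (π : V →ₗ[F] K) (hπ : Function.Surjective π) {φ : Module.Dual F V}
    (hφ : φ ≠ 0) (hf : ∀ v, v ≠ 0 → f v ≠ 0 → φ v ≠ 0 → π v ≠ 0 ∧ g (π v) ≠ 0) :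
    Covered F (t + 1) f := by
  obtain ⟨ψ, h1, h2⟩ := h
  refine ⟨Fin.cons φ fun i => (ψ i).comp π, ?_, fun v hv hfv => ?_⟩
  · intro i
    refine Fin.cases ?_ (fun j => ?_) i
    · exact hφ
    · intro h0
      apply h1 j
      ext k
      obtain ⟨v, rfl⟩ := hπ k
      exact LinearMap.congr_fun h0 v
  · by_cases hv0 : φ v = 0
    · exact ⟨0, hv0⟩
    · obtain ⟨h3, h4⟩ := hf v hv hfv hv0
      obtain ⟨i, hi⟩ := h2 _ h3 h4
      exact ⟨i.succ, hi⟩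

theorem Covered.comp' {K : Type} [AddCommGroup K] [Module F K] {t : ℕ} {g : K → ZMod p}
    (h : Covered F (t + 1) g) (π : V →ₗ[F] K) (hπ : Function.Surjective π)
    (hf : ∀ v, v ≠ 0 → f v ≠ 0 → π v ≠ 0 → g (π v) ≠ 0) :
    Covered F (t + 1) f := by
  obtain ⟨ψ, h1, h2⟩ := h
  refine ⟨fun i => (ψ i).comp π, ?_, fun v hv hfv => ?_⟩
  · intro i h0
    apply h1 i
    ext k
    obtain ⟨v, rfl⟩ := hπ k
    exact LinearMap.congr_fun h0 v
  · by_cases hv0 : π v = 0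
    · exact ⟨0, by simp [hv0]⟩
    · exact h2 _ hv0 (hf v hv hfv hv0)

theorem exists_dual_one {R : V} (hR : R ≠ 0) : ∃ φ : Module.Dual F V, φ R = 1 := by
  obtain ⟨φ, hφ⟩ := (Module.forall_dual_apply_eq_zero_iff F R).not.mpr hR |> not_forall.mp
  exact ⟨(φ R)⁻¹ • φ, by simp [hφ]⟩

theorem exists_complement {R : V} (hR : R ≠ 0) : ∃ (K : Submodule F V) (π : V →ₗ[F] K),
    (∀ k : K, π k = k) ∧ π R = 0 ∧ (∀ v, ∃ x : F, v = x • R + π v) ∧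
    (∀ v, π v = 0 ↔ v ∈ Submodule.span F {R}) := by
  obtain ⟨φ, hφ⟩ := exists_dual_one (F := F) hR
  let π : V →ₗ[F] LinearMap.ker φ :=
    { toFun := fun v => ⟨v - φ v • R, by simp [hφ]⟩
      map_add' := fun u v => by ext; simp only [map_add, Submodule.coe_add]; module
      map_smul' := fun a v => by
        ext; simp only [map_smul, smul_eq_mul, RingHom.id_apply, Submodule.coe_smul]; module }
  have hπ : ∀ v, (π v : V) = v - φ v • R := fun v => rfl
  refine ⟨LinearMap.ker φ, π, ?_, ?_, fun v => ⟨φ v, by rw [hπ]; abel⟩, fun v => ?_⟩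
  · rintro ⟨k, hk⟩
    rw [LinearMap.mem_ker] at hk
    ext
    simp [hπ, hk]
  · ext; simp [hπ, hφ]
  · rw [Submodule.mem_span_singleton, ← Submodule.coe_eq_zero, hπ, sub_eq_zero]
    constructor
    · intro h
      exact ⟨φ v, h.symm⟩
    · rintro ⟨a, rfl⟩
      simp [hφ]

theorem mom_span {R v : V} {m : ℕ} (hf : f ∈ lcode F p V) (hS : f 0 = f R) (hm : m + 1 < 𝔮)
    (hv : v ∈ Submodule.span F {R}) : mom (F := F) f R m v = 0 := by
  obtain ⟨y, rfl⟩ := Submodule.mem_span_singleton.mp hv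
  have h1 : ∀ x : F, f (x • R + y • R) = f R := by
    intro x
    rw [← add_smul]
    by_cases h : x + y = 0
    · rw [h, zero_smul, hS]
    · rw [lcode_smul hf h]
  simp only [mom, h1, ← Finset.mul_sum]
  rw [FiniteField.sum_pow_lt_card_sub_one F m (by omega), mul_zero]

theorem cone_or_moment {R : V} (hf : f ∈ lcode F p V) (h3 : 3 ≤ 𝔮) (hS : f 0 = f R) :
    (∀ (v : V) (x : F), f (x • R + v) = f v) ∨ ∃ m, 1 ≤ m ∧ m + 2 ≤ 𝔮 ∧
      (∀ j < m, ∀ v, mom (F := F) f R j v = 0) ∧ ∃ v, mom (F := F) f R m v ≠ 0 := by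
  by_cases h : ∃ m, m + 2 ≤ 𝔮 ∧ ∃ v, mom (F := F) f R m v ≠ 0
  · right
    obtain ⟨h1, h2⟩ := Nat.find_spec h
    refine ⟨Nat.find h, ?_, h1, ?_, h2⟩
    · rw [Nat.one_le_iff_ne_zero]
      intro h0
      rw [h0] at h2
      obtain ⟨v, hv⟩ := h2
      rw [mom_zero hf, hS, sub_self, map_zero] at hv
      exact hv rfl
    · intro j hj
      have := Nat.find_min h hj
      push Not at this
      exact this (by omega)
  · left
    push Not at h
    intro v x
    exact const_of_mom h3 (fun j hj => h j (by omega) v) x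

theorem exists_dual_moment {R : V} (hf : f ∈ lcode F p V) (h3 : 3 ≤ 𝔮) (hS : f 0 ≠ f R) :
    ∃ φ : Module.Dual F V, φ R ≠ 0 ∧ f - (f 0 - f R) • hyp p φ ∈ lcode F p V ∧
      (f - (f 0 - f R) • hyp p φ) 0 = (f - (f 0 - f R) • hyp p φ) R ∧
      ∀ v, mom (F := F) (f - (f 0 - f R) • hyp p φ) R 1 v = 0 := by
  set a := f 0 - f R with ha
  have ha0 : a ≠ 0 := sub_ne_zero.mpr hS
  set α : F := algebraMap (ZMod p) F a with hα
  have hα0 : α ≠ 0 := by simpa [hα] using ha0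
  have hform := mom_isForm (F := F) hf R (m := 1) (by omega)
  have hlin : ∀ u w (t : F), mom f R 1 (u + t • w) = mom f R 1 u + t * mom f R 1 w := by
    intro u w t
    obtain ⟨P, h1, h2, hP3⟩ := hform u w
    have h4 := Polynomial.eq_X_add_C_of_natDegree_le_one h1
    have h5 := hP3 0
    have h6 := hP3 t
    rw [zero_smul, add_zero] at h5
    rw [← h6, ← h5, ← h2, h4]
    simp
    ring
  have hz : mom (F := F) f R 1 0 = 0 := by
    have := hlin 0 0 1
    simp at this
    exact this
  let X : Module.Dual F V :=
    { toFun := fun v => mom f R 1 v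
      map_add' := fun u w => by simpa using hlin u w 1
      map_smul' := fun t w => by simpa [hz] using hlin 0 w t }
  have hXR : X R = -α := by
    have h2 : ∀ x : F, algebraMap (ZMod p) F (f (x • R + R)) * x ^ 1 =
        algebraMap (ZMod p) F (f R) * x + if x = -1 then -α else 0 := by
      intro x
      have : x • R + R = (x + 1) • R := by rw [add_smul, one_smul]
      rw [this]
      by_cases hx : x = -1
      · simp only [hx, neg_add_cancel, zero_smul, hα, ha, map_sub, if_true]; ring
      · rw [lcode_smul hf (fun h => hx (eq_neg_of_add_eq_zero_left h))]
        simp [hx]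
    have h1 : mom (F := F) f R 1 R = -α := by
      simp only [mom, h2]
      rw [Finset.sum_add_distrib, ← Finset.mul_sum]
      have := FiniteField.sum_pow_lt_card_sub_one F 1 (by omega)
      simp only [pow_one] at this
      simp [this]
    exact h1
  have hφR : (α⁻¹ • X) R ≠ 0 := by simp [hXR, hα0]
  have hφ : ∀ v, -(α⁻¹ • X) v / (α⁻¹ • X) R = α⁻¹ * mom f R 1 v := by
    intro v
    have : (α⁻¹ • X) R = -1 := by simp [hXR, hα0]
    rw [this]
    simp only [LinearMap.smul_apply, smul_eq_mul, div_neg, div_one, neg_neg]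
    rfl
  refine ⟨α⁻¹ • X, hφR, Submodule.sub_mem _ hf (Submodule.smul_mem _ _ (hyp_mem _)), ?_, ?_⟩
  · simp only [Pi.sub_apply, Pi.smul_apply, smul_eq_mul, hyp, map_zero, if_true, hφR, if_false, ha]
    ring
  · intro v
    rw [sub_eq_add_neg, ← neg_smul, mom_add, mom_smul, mom_hyp_of_ne _ hφR, hφ]
    rw [map_neg, ← hα]
    field_simp
    ring

variable [Fintype V]

theorem sum_cnt_notMem (hf : f ∈ lcode F p V) {R : V} (hR : R ≠ 0) (hfR : f R ≠ 0) :
    𝔮 * (𝔮 - 1) + ∑ v ∈ Finset.univ.filter (fun v : V => v ∉ Submodule.span F {R}), cnt F f R v =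
      𝔮 * wtv f := by
  have h1 := sum_cnt (F := F) f R
  rw [← Finset.sum_filter_add_sum_filter_not Finset.univ
    (fun v : V => v ∈ Submodule.span F {R})] at h1
  have h2 : ∀ v ∈ Finset.univ.filter (fun v : V => v ∈ Submodule.span F {R}),
      cnt F f R v = (𝔮 - 1) + if f 0 ≠ 0 then 1 else 0 := by
    intro v hv
    simp only [Finset.mem_filter, Finset.mem_univ, true_and] at hv
    obtain ⟨y, rfl⟩ := Submodule.mem_span_singleton.mp hv
    have := cnt_shift (F := F) f R 0 y
    rw [add_zero] at this
    rw [this, cnt]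
    simp only [add_zero]
    rw [card_smul_ne hf, if_pos hfR, mul_one]
  rw [Finset.sum_congr rfl h2, Finset.sum_const, card_span_singleton hR, nz_eq, smul_eq_mul] at h1
  nlinarith

theorem card_notMem_singleton {R : V} (hR : R ≠ 0) :
    (Finset.univ.filter fun v : V => v ∉ Submodule.span F {R}).card + 𝔮 = Fintype.card V := by
  have := Finset.card_filter_add_card_filter_not (s := (Finset.univ : Finset V))
    (fun v : V => v ∈ Submodule.span F {R})
  rw [Finset.card_univ, card_span_singleton hR] at this
  omega

/-- A lower bound on the weight from the lines through a support point. -/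
theorem wtv_ge (hf : f ∈ lcode F p V) {R : V} (hR : R ≠ 0) (hfR : f R ≠ 0) {l M : ℕ}
    {T : V → Prop} (hl : ∀ v, v ∉ Submodule.span F {R} → l ≤ cnt F f R v)
    (hT : ∀ v, T v → v ∉ Submodule.span F {R}) (hM : ∀ v, T v → l + M ≤ cnt F f R v) :
    𝔮 * (𝔮 - 1) + l * (Fintype.card V - 𝔮) + M * (Finset.univ.filter T).card ≤ 𝔮 * wtv f := by
  rw [← sum_cnt_notMem hf hR hfR, add_assoc]
  refine Nat.add_le_add_left ?_ _
  have h1 : ∀ v ∈ Finset.univ.filter (fun v : V => v ∉ Submodule.span F {R}),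
      l + (if T v then M else 0) ≤ cnt F f R v := by
    intro v hv
    simp only [Finset.mem_filter, Finset.mem_univ, true_and] at hv
    split_ifs with h
    · exact hM v h
    · exact hl v hv
  refine le_trans (le_of_eq ?_) (Finset.sum_le_sum h1)
  rw [Finset.sum_add_distrib, Finset.sum_const, ← card_notMem_singleton (F := F) hR,
    Nat.add_sub_cancel, smul_eq_mul, mul_comm l, ← Finset.sum_filter, Finset.filter_filter,
    Finset.sum_const, smul_eq_mul, mul_comm M]
  congr 3
  ext v
  simp only [Finset.mem_filter, Finset.mem_univ, true_and]
  exact ⟨fun h => ⟨hT v h, h⟩, fun h => h.2⟩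

theorem card_eq_mul_complement {R : V} (hR : R ≠ 0) {K : Submodule F V} {π : V →ₗ[F] K}
    (h1 : ∀ k : K, π k = k) (h2 : π R = 0) (h3 : ∀ v, ∃ x : F, v = x • R + π v)
    (A : K → Prop) [DecidablePred A] :
    (Finset.univ.filter fun v : V => A (π v)).card = 𝔮 * (Finset.univ.filter A).card := by
  rw [← Finset.card_univ (α := F), ← Finset.card_product]
  symm
  refine Finset.card_bij (fun (ab : F × K) _ => ab.1 • R + (ab.2 : V)) ?_ ?_ ?_
  · rintro ⟨x, k⟩ h
    simp only [Finset.mem_product, Finset.mem_filter, Finset.mem_univ, true_and] at h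
    simpa [h1, h2] using h
  · rintro ⟨x, k⟩ _ ⟨x', k'⟩ _ h
    have hk : k = k' := by simpa [h1, h2] using congrArg π h
    subst hk
    have : x • R = x' • R := add_right_cancel h
    rw [smul_left_injective F hR this]
  · intro v hv
    obtain ⟨x, hx⟩ := h3 v
    refine ⟨⟨x, π v⟩, ?_, hx.symm⟩
    simpa using hv

end Cone

section Step

variable {V : Type} [AddCommGroup V] [Module F V] {p : ℕ} [Fintype F] [Fact p.Prime]
  [Algebra (ZMod p) F] {f : V → ZMod p}

theorem cnt_sub_hyp_le (f : V → ZMod p) (a : ZMod p) {φ : Module.Dual F V} {R : V} (hR : φ R ≠ 0)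
    (v : V) : cnt F (f - a • hyp p φ) R v ≤ cnt F f R v + 1 := by
  unfold cnt
  refine le_trans (Finset.card_le_card (t := insert (-φ v / φ R)
    (Finset.univ.filter fun x : F => f (x • R + v) ≠ 0)) ?_) (Finset.card_insert_le _ _)
  intro x hx
  simp only [Finset.mem_filter, Finset.mem_univ, true_and, Finset.mem_insert] at hx ⊢
  by_cases h : x = -φ v / φ R
  · exact Or.inl h
  · right
    rw [← exists_unique_zero φ hR] at h
    simp only [hyp, Pi.sub_apply, Pi.smul_apply, if_neg h, smul_zero, sub_zero] at hx
    exact hx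

theorem one_le_cnt (hf : f ∈ lcode F p V) {R : V} (hS : f 0 ≠ f R) (v : V) : 1 ≤ cnt F f R v := by
  by_contra! h
  have h0 : ∀ x : F, f (x • R + v) = 0 := by
    have : cnt F f R v = 0 := by omega
    simpa [cnt] using this
  have := line_sum hf R v
  simp only [h0, Finset.sum_const_zero] at this
  exact hS (sub_eq_zero.mp this.symm)

theorem cnt_of_const {R : V} (hc : ∀ (v : V) (x : F), f (x • R + v) = f v) {v : V} (hv : f v ≠ 0) :
    cnt F f R v = 𝔮 := by
  simp [cnt, hc, hv]

variable [Fintype V]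

theorem zero_step (hf : f ∈ lcode F p V) (h3 : 3 ≤ 𝔮) {n : ℕ} (hV : Fintype.card V = 𝔮 ^ (n + 1))
    {R : V} (hR : R ≠ 0) (hfR : f R ≠ 0) (hS : f 0 = f R) :
    (∃ K : Submodule F V, Fintype.card V = 𝔮 * Fintype.card K ∧
      wtv f = (𝔮 - 1) + 𝔮 * wtv (fun k : K => f k) ∧
      ∀ t, Covered F (t + 1) (fun k : K => f k) → Covered F (t + 1) f) ∨
    ∃ m, 1 ≤ m ∧ m + 2 ≤ 𝔮 ∧ (∀ j < m, ∀ v, mom (F := F) f R j v = 0) ∧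
      (∃ v, mom (F := F) f R m v ≠ 0) ∧
      ∀ M, (∀ v, mom (F := F) f R m v ≠ 0 → M ≤ cnt F f R v) →
        𝔮 * (𝔮 - 1) + M * ((𝔮 - m) * 𝔮 ^ n) ≤ 𝔮 * wtv f := by
  rcases cone_or_moment hf h3 hS with hc | ⟨m, h1, h2, h0, v, hv⟩
  · left
    obtain ⟨K, π, hK1, hK2, hK3, hK4⟩ := exists_complement (F := F) hR
    have hfπ : ∀ v, f v = f (π v) := fun v => by
      obtain ⟨x, hx⟩ := hK3 v
      conv_lhs => rw [hx, hc]
    refine ⟨K, ?_, ?_, ?_⟩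
    · have := card_eq_mul_complement hR hK1 hK2 hK3 (fun _ => True)
      simpa using this
    · have h1 := card_eq_mul_complement hR hK1 hK2 hK3 (fun k : K => f k ≠ 0)
      have h2 : nz f = 𝔮 * nz (fun k : K => f k) := by
        unfold nz
        rw [← h1]
        congr 1
        ext v
        simp [← hfπ]
      rw [nz_eq, nz_eq] at h2
      have h4 : f ((0 : K) : V) = f 0 := rfl
      have h5 : f 0 ≠ 0 := by rwa [hS]
      rw [h4, if_pos h5, mul_add] at h2
      omega
    · intro t ht
      refine ht.comp' π (fun k => ⟨k, hK1 k⟩) fun v _ hfv _ => ?_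
      rwa [hfπ] at hfv
  · right
    refine ⟨m, h1, h2, h0, ⟨v, hv⟩, fun M hM => ?_⟩
    have h4 := wtv_ge hf hR hfR (l := 0) (M := M) (T := fun v => mom (F := F) f R m v ≠ 0)
      (fun _ _ => Nat.zero_le _)
      (fun v hv hmem => hv (mom_span hf hS (by omega) hmem)) (fun v hv => by simpa using hM v hv)
    have h5 := (mom_isForm (F := F) hf R (m := m) (by omega)).nonzeros hv
    rw [hV, pow_succ', mul_left_comm] at h5
    have h6 := Nat.le_of_mul_le_mul_left h5 (by omega)
    refine le_trans ?_ h4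
    rw [zero_mul, add_zero]
    refine Nat.add_le_add_left (Nat.mul_le_mul_left _ ?_) _
    convert h6

theorem ne_step (hf : f ∈ lcode F p V) (h3 : 3 ≤ 𝔮) {n : ℕ} (hV : Fintype.card V = 𝔮 ^ (n + 1))
    {R : V} (hR : R ≠ 0) (hfR : f R ≠ 0) (hS : f 0 ≠ f R) :
    (∃ (K : Submodule F V) (g : K → ZMod p), Fintype.card V = 𝔮 * Fintype.card K ∧
      g ∈ lcode F p K ∧ g 0 = f R ∧
      𝔮 * (𝔮 - 1) + (𝔮 ^ (n + 1) - 𝔮) + (𝔮 - 2) * (𝔮 * wtv g) ≤ 𝔮 * wtv f ∧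
      ∀ t, Covered F (t + 1) g → Covered F (t + 2) f) ∨
    ∃ (m : ℕ) (c : V → ZMod p), c ∈ lcode F p V ∧ 2 ≤ m ∧ m + 2 ≤ 𝔮 ∧
      (∀ j < m, ∀ v, mom (F := F) c R j v = 0) ∧ (∃ v, mom (F := F) c R m v ≠ 0) ∧
      (∀ v, cnt F c R v ≤ cnt F f R v + 1) ∧
      (∃ φ : Module.Dual F V, φ R ≠ 0 ∧ c = f - (f 0 - f R) • hyp p φ) ∧
      ∀ M, (∀ v, mom (F := F) c R m v ≠ 0 → 1 + M ≤ cnt F f R v) →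
        𝔮 * (𝔮 - 1) + (𝔮 ^ (n + 1) - 𝔮) + M * ((𝔮 - m) * 𝔮 ^ n) ≤ 𝔮 * wtv f := by
  obtain ⟨φ, hφR, hc, hc0, hc1⟩ := exists_dual_moment (F := F) hf h3 hS
  set c := f - (f 0 - f R) • hyp p φ with hcdef
  have hcnt : ∀ v, cnt F c R v ≤ cnt F f R v + 1 := cnt_sub_hyp_le f _ hφR
  rcases cone_or_moment hc h3 hc0 with hk | ⟨m, h1, h2, h0, v, hv⟩
  · left
    obtain ⟨K, π, hK1, hK2, hK3, hK4⟩ := exists_complement (F := F) hR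
    have hcπ : ∀ v, c v = c (π v) := fun v => by
      obtain ⟨x, hx⟩ := hK3 v
      conv_lhs => rw [hx, hk]
    refine ⟨K, fun k => c k, ?_, lcode_comp K.subtype hc, ?_, ?_, ?_⟩
    · have := card_eq_mul_complement hR hK1 hK2 hK3 (fun _ => True)
      simpa using this
    · change c 0 = f R
      rw [hc0, hcdef]
      simp [hyp, hφR]
    · have h1 := card_eq_mul_complement hR hK1 hK2 hK3 (fun k : K => k ≠ 0 ∧ c k ≠ 0)
      rw [show wtv (fun k : K => c k) =
        (Finset.univ.filter fun k : K => k ≠ 0 ∧ c k ≠ 0).card by unfold wtv; congr, ← h1, ← one_mul (_ - 𝔮),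
        ← hV]
      have h4 := wtv_ge hf hR hfR (l := 1) (M := 𝔮 - 2) (T := fun v => π v ≠ 0 ∧ c (π v) ≠ 0)
        (fun v _ => one_le_cnt hf hS v) (fun v hv hmem => hv.1 ((hK4 v).mpr hmem))
        (fun v hv => by
          have h5 := hv.2
          rw [← hcπ] at h5
          have := hcnt v
          rw [cnt_of_const hk h5] at this
          omega)
      convert h4
    · intro t ht
      have hφ0 : φ ≠ 0 := by rintro rfl; simp at hφR
      obtain ⟨ψ, hψ1, hψ2⟩ := ht
      refine ⟨Fin.cons φ fun i => (ψ i).comp π, ?_, fun v hv hfv => ?_⟩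
      · intro i
        refine Fin.cases hφ0 (fun j h0 => ?_) i
        apply hψ1 j
        ext k
        have := LinearMap.congr_fun h0 (k : V)
        simpa [hK1] using this
      · by_cases hv0 : φ v = 0
        · exact ⟨0, hv0⟩
        have hcv : c (π v) ≠ 0 := by
          rw [← hcπ, hcdef]
          simpa [hyp, hv0] using hfv
        by_cases hπ : π v = 0
        · exact ⟨Fin.succ 0, by simp [hπ]⟩
        · obtain ⟨i, hi⟩ := hψ2 _ hπ hcv
          exact ⟨i.succ, by simpa using hi⟩
  · right
    have hm2 : 2 ≤ m := by
      by_contra! h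
      have : m = 1 := by omega
      subst this
      exact hv (hc1 v)
    refine ⟨m, c, hc, hm2, h2, h0, ⟨v, hv⟩, hcnt, ⟨φ, hφR, rfl⟩, fun M hM => ?_⟩
    have h4 := wtv_ge hf hR hfR (l := 1) (M := M) (T := fun v => mom (F := F) c R m v ≠ 0)
      (fun v _ => one_le_cnt hf hS v)
      (fun v hv hmem => hv (mom_span hc hc0 (by omega) hmem)) (fun v hv => hM v hv)
    have h5 := (mom_isForm (F := F) hc R (m := m) (by omega)).nonzeros hv
    rw [hV, pow_succ', mul_left_comm] at h5
    have h6 := Nat.le_of_mul_le_mul_left h5 (by omega)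
    refine le_trans ?_ h4
    rw [one_mul, hV]
    refine Nat.add_le_add_left (Nat.mul_le_mul_left _ ?_) _
    convert h6

end Step

section Small

variable {V : Type} [AddCommGroup V] [Module F V] {p : ℕ} [Fintype F] [Fact p.Prime]
  [Algebra (ZMod p) F] {f : V → ZMod p}

theorem arith_zero {q m : ℕ} (h1 : 1 ≤ m) (h2 : m + 2 ≤ q) : 2 * (q - 1) ≤ (m + 1) * (q - m) := by
  obtain ⟨a, rfl⟩ := Nat.exists_eq_add_of_le h2
  obtain ⟨b, rfl⟩ := Nat.exists_eq_add_of_le h1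
  rw [show 1 + b + 2 + a - 1 = b + a + 2 by omega, show 1 + b + 2 + a - (1 + b) = a + 2 by omega]
  nlinarith [Nat.zero_le (a * b)]

theorem arith_ne {q m : ℕ} (h1 : 2 ≤ m) (h2 : m + 2 ≤ q) :
    2 * (q - 1) ≤ q + (m - 1) * (q - m) := by
  obtain ⟨a, rfl⟩ := Nat.exists_eq_add_of_le h2
  obtain ⟨b, rfl⟩ := Nat.exists_eq_add_of_le h1
  rw [show 2 + b + 2 + a - 1 = b + a + 3 by omega, show 2 + b + 2 + a - (2 + b) = a + 2 by omega,
    show 2 + b - 1 = b + 1 by omega]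
  nlinarith [Nat.zero_le (a * b)]

theorem exists_ne_zero_of_card [Fintype V] {n : ℕ} (hV : Fintype.card V = 𝔮 ^ (n + 1)) :
    ∃ R : V, R ≠ 0 := by
  have h2 := two_le_card (F := F)
  have : 1 < Fintype.card V := by
    rw [hV]
    exact Nat.one_lt_pow (by omega) (by omega)
  have := Fintype.one_lt_card_iff_nontrivial.mp this
  exact exists_ne 0

theorem exists_notMem_span_of_card [Fintype V] {n : ℕ} (hV : Fintype.card V = 𝔮 ^ (n + 2))
    {R : V} (hR : R ≠ 0) : ∃ v, v ∉ Submodule.span F {R} := by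
  by_contra! h
  have h1 := card_notMem_singleton (F := F) hR
  have h2 := two_le_card (F := F)
  rw [hV, pow_succ] at h1
  have h3 : (Finset.univ.filter fun v : V => v ∉ Submodule.span F {R}) = ∅ := by
    ext v; simp [h v]
  rw [h3, Finset.card_empty, zero_add] at h1
  have h4 : 2 ≤ 𝔮 ^ (n + 1) := h2.trans (Nat.le_self_pow (by omega) _)
  nlinarith

theorem vanish_zero (hf : f ∈ lcode F p V) (h0 : ∀ v, v ≠ 0 → f v = 0) {u v : V}
    (h : Ind F u v) : f 0 = 0 := by
  have h1 := line_sum hf u v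
  have h2 : ∀ x : F, f (x • u + v) = 0 := fun x => h0 _ (h.add_smul x).right_ne
  simpa [h2, h0 u h.left_ne] using h1.symm

theorem covered_of_vanish [Fintype V] {n : ℕ} (hV : Fintype.card V = 𝔮 ^ (n + 1))
    (h0 : ∀ v, v ≠ 0 → f v = 0) (t : ℕ) : Covered F t f := by
  obtain ⟨R, hR⟩ := exists_ne_zero_of_card hV
  obtain ⟨φ, hφ⟩ := exists_dual_one (F := F) hR
  exact ⟨fun _ => φ, fun _ h => by simp [h] at hφ, fun v hv hfv => absurd (h0 v hv) hfv⟩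

theorem min_weight [Fintype V] (hf : f ∈ lcode F p V) {n : ℕ}
    (hV : Fintype.card V = 𝔮 ^ (n + 1)) {R : V} (hR : R ≠ 0) (hfR : f R ≠ 0) :
    𝔮 ^ n ≤ wtv f + 1 := by
  have h2 := two_le_card (F := F)
  have hN : 1 ≤ 𝔮 ^ n := Nat.one_le_pow _ _ (by omega)
  by_cases hS : f 0 = f R
  · by_cases hz : ∃ R₀, f R₀ = 0
    · obtain ⟨R₀, hz⟩ := hz
      have h1 : ∀ v, 1 ≤ cnt F f R₀ v := one_le_cnt hf (by rw [hz, hS]; exact hfR)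
      have h3 := sum_cnt (F := F) f R₀
      have h4 : Fintype.card V ≤ ∑ v, cnt F f R₀ v := by
        rw [← Finset.card_univ, Finset.card_eq_sum_ones]
        exact Finset.sum_le_sum fun v _ => h1 v
      rw [h3, nz_eq, hV, pow_succ', if_pos (by rwa [hS])] at h4
      exact Nat.le_of_mul_le_mul_left h4 (by omega)
    · push Not at hz
      have h1 := nz_eq f
      have h3 : nz f = Fintype.card V := by simp [nz, hz]
      rw [h3, hV, if_pos (hz 0), pow_succ'] at h1
      nlinarith
  · have h4 := wtv_ge hf hR hfR (l := 1) (M := 0) (T := fun _ => False)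
      (fun v _ => one_le_cnt hf hS v) (by simp) (by simp)
    rw [hV, pow_succ'] at h4
    have h5 : 𝔮 * (𝔮 ^ n) ≤ 𝔮 * (wtv f + 1) := by
      obtain ⟨a, ha⟩ := Nat.exists_eq_add_of_le h2
      rw [ha] at h4 ⊢
      have : 2 + a ≤ (2 + a) * (2 + a) ^ n := by rw [ha] at hN; nlinarith
      zify [this, show 1 ≤ 2 + a by omega] at h4 ⊢
      nlinarith
    exact Nat.le_of_mul_le_mul_left h5 (by omega)

theorem card_complement {K : Type} [Fintype V] [Fintype K] {n : ℕ}
    (hV : Fintype.card V = 𝔮 ^ (n + 1))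
    (hK : Fintype.card V = 𝔮 * Fintype.card K) : Fintype.card K = 𝔮 ^ n := by
  rw [hV, pow_succ'] at hK
  exact (Nat.eq_of_mul_eq_mul_left (by have := two_le_card (F := F); omega) hK).symm

/-- A word of weight less than twice the size of an affine hyperplane is supported on a
hyperplane. -/
theorem covered_one (h3 : 3 ≤ 𝔮) (n : ℕ) : ∀ (V : Type) [AddCommGroup V] [Module F V] [Fintype V]
    (f : V → ZMod p), f ∈ lcode F p V → Fintype.card V = 𝔮 ^ (n + 1) →
    𝔮 * wtv f < 2 * (𝔮 - 1) * 𝔮 ^ n → Covered F 1 f := by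
  induction n with
  | zero =>
    intro V _ _ _ f hf hV hw
    refine covered_of_vanish hV (fun v hv => ?_) 1
    by_contra hfv
    have h1 := sum_cnt_notMem hf hv hfv
    have h2 : 𝔮 - 1 ≤ wtv f := by
      refine Nat.le_of_mul_le_mul_left (c := 𝔮) ?_ (by omega)
      omega
    rw [pow_zero, mul_one] at hw
    nlinarith
  | succ n ih =>
    intro V _ _ _ f hf hV hw
    by_cases h0 : ∀ v, v ≠ 0 → f v = 0
    · exact covered_of_vanish hV h0 1
    push Not at h0
    obtain ⟨R, hR, hfR⟩ := h0
    have hN : 1 ≤ 𝔮 ^ n := Nat.one_le_pow _ _ (by omega)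
    by_cases hS : f 0 = f R
    · rcases zero_step hf h3 hV hR hfR hS with ⟨K, hK, hW, hcov⟩ | ⟨m, h1, h2, h0, -, hM⟩
      · refine hcov 0 (ih K _ (lcode_comp K.subtype hf) (card_complement hV hK) ?_)
        rw [pow_succ'] at hw
        refine lt_of_mul_lt_mul_left (a := 𝔮) ?_ (by omega)
        rw [hW] at hw
        generalize 𝔮 - 1 = z at *
        nlinarith
      · have h4 := hM (m + 1) fun v hv => cnt_ge_of_mom (fun j hj => h0 j hj v) hv
        have h5 := Nat.mul_le_mul_right (𝔮 ^ (n + 1)) (arith_zero h1 h2)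
        rw [← mul_assoc] at h4
        omega
    · rcases ne_step hf h3 hV hR hfR hS with ⟨K, g, hK, hg, hg0, hW, -⟩ |
        ⟨m, c, hc, h1, h2, h0, -, hle, -, hM⟩
      · exfalso
        have hKc := card_complement hV hK
        obtain ⟨a, ha⟩ := Nat.exists_eq_add_of_le h3
        have hNq : 𝔮 ≤ 𝔮 * 𝔮 ^ n := by nlinarith
        by_cases h0 : ∀ k, k ≠ 0 → g k = 0
        · rcases n with _ | n
          · simp only [zero_add, pow_one] at hW hw
            rw [show 𝔮 ^ (1 + 1) - 𝔮 = 𝔮 * (𝔮 - 1) by rw [pow_succ, pow_one, Nat.mul_sub_one]] at hW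
            linarith [Nat.zero_le ((𝔮 - 2) * (𝔮 * wtv g))]
          · obtain ⟨r, hr⟩ := exists_ne_zero_of_card hKc
            obtain ⟨s, hs⟩ := exists_notMem_span_of_card hKc hr
            have := vanish_zero hg h0 (ind_of_notMem hr hs)
            exact hfR (by rw [← hg0, this])
        · push Not at h0
          obtain ⟨r, hr, hgr⟩ := h0
          have h5 := min_weight hg hKc hr hgr
          generalize wtv g = w at *
          generalize wtv f = W at *
          rw [pow_succ', pow_succ'] at hW
          rw [pow_succ'] at hw
          generalize 𝔮 ^ n = N at *
          generalize 𝔮 = q at *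
          subst ha
          rw [show 3 + a - 1 = a + 2 by omega, show 3 + a - 2 = a + 1 by omega] at *
          zify [show 3 + a ≤ (3 + a) * ((3 + a) * N) by nlinarith] at *
          nlinarith [mul_le_mul_of_nonneg_left h5 (show (0:ℤ) ≤ (a + 1) * (3 + a) by positivity)]
      · exfalso
        have h4 := hM (m - 1) fun v hv => by
          have := cnt_ge_of_mom (fun j hj => h0 j hj v) hv
          have := hle v
          omega
        have h5 := Nat.mul_le_mul_right (𝔮 ^ (n + 1)) (arith_ne h1 h2)
        rw [← mul_assoc, pow_succ' 𝔮 (n + 1)] at h4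
        have h6 : 2 * 𝔮 ≤ 𝔮 * (𝔮 - 1) := by
          rw [mul_comm]; exact Nat.mul_le_mul_left _ (by omega)
        rw [add_mul] at h5
        omega

theorem covered_two_of_le (h3 : 3 ≤ 𝔮) [Fintype V] (hf : f ∈ lcode F p V) {n : ℕ}
    (hV : Fintype.card V = 𝔮 ^ (n + 2)) (hw : 𝔮 * wtv f ≤ 2 * (𝔮 - 1) * 𝔮 ^ (n + 1)) :
    Covered F 2 f := by
  by_cases h0 : ∀ v, v ≠ 0 → f v = 0
  · exact covered_of_vanish hV h0 2
  push Not at h0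
  obtain ⟨R, hR, hfR⟩ := h0
  have hN : 1 ≤ 𝔮 ^ n := Nat.one_le_pow _ _ (by omega)
  have h6 : 2 * 𝔮 ≤ 𝔮 * (𝔮 - 1) := by
    rw [mul_comm]; exact Nat.mul_le_mul_left _ (by omega)
  by_cases hS : f 0 = f R
  · rcases zero_step hf h3 hV hR hfR hS with ⟨K, hK, hW, hcov⟩ | ⟨m, h1, h2, h0, -, hM⟩
    · refine (hcov 0 (covered_one h3 n K _ (lcode_comp K.subtype hf)
        (card_complement hV hK) ?_)).succ
      rw [pow_succ'] at hw
      refine lt_of_mul_lt_mul_left (a := 𝔮) ?_ (by omega)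
      rw [hW] at hw
      obtain ⟨z, hz⟩ := Nat.exists_eq_add_of_le h3
      rw [show 𝔮 - 1 = z + 2 by omega] at *
      nlinarith
    · have h4 := hM (m + 1) fun v hv => cnt_ge_of_mom (fun j hj => h0 j hj v) hv
      have h5 := Nat.mul_le_mul_right (𝔮 ^ (n + 1)) (arith_zero h1 h2)
      rw [← mul_assoc] at h4
      omega
  · rcases ne_step hf h3 hV hR hfR hS with ⟨K, g, hK, hg, hg0, hW, hcov⟩ |
      ⟨m, c, hc, h1, h2, h0, -, hle, -, hM⟩
    · have hKc := card_complement hV hK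
      refine hcov 0 (covered_one h3 n K g hg hKc ?_)
      obtain ⟨a, ha⟩ := Nat.exists_eq_add_of_le h3
      generalize wtv g = w at *
      generalize wtv f = W at *
      rw [pow_succ', pow_succ'] at hW
      rw [pow_succ'] at hw
      generalize 𝔮 ^ n = N at *
      generalize 𝔮 = q at *
      subst ha
      rw [show 3 + a - 1 = a + 2 by omega, show 3 + a - 2 = a + 1 by omega] at *
      zify [show 3 + a ≤ (3 + a) * ((3 + a) * N) by nlinarith] at *
      have : (a + 1 : ℤ) * ((3 + a) * w) ≤ (a + 1) * ((3 + a) * N - (3 + a)) := by nlinarith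
      have := le_of_mul_le_mul_left this (by positivity)
      nlinarith
    · exfalso
      have h4 := hM (m - 1) fun v hv => by
        have := cnt_ge_of_mom (fun j hj => h0 j hj v) hv
        have := hle v
        omega
      have h5 := Nat.mul_le_mul_right (𝔮 ^ (n + 1)) (arith_ne h1 h2)
      rw [← mul_assoc, pow_succ' 𝔮 (n + 1)] at h4
      rw [add_mul] at h5
      omega

end Small

section CoveredTwo

variable {V : Type} [AddCommGroup V] [Module F V] {p : ℕ} [Fintype F] [Fact p.Prime]
  [Algebra (ZMod p) F] {f : V → ZMod p}

theorem cnt_ge_of_zero {R v : V} {z : F} (h : ∀ x : F, f (x • R + v) = 0 → x = z) :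
    𝔮 - 1 ≤ cnt F f R v := by
  rw [← Finset.card_univ, ← Finset.card_erase_of_mem (Finset.mem_univ z)]
  refine Finset.card_le_card fun x hx => ?_
  simp only [Finset.mem_filter, Finset.mem_univ, true_and]
  exact fun h' => Finset.ne_of_mem_erase hx (h x h')

theorem unique_zero_of_affine {R v : V} (h3 : 3 ≤ 𝔮)
    (h0 : ∀ j < 𝔮 - 2, mom (F := F) f R j v = 0) (h : ∃ x : F, f (x • R + v) ≠ 0) :
    ∃ z : F, ∀ x : F, f (x • R + v) = 0 → x = z := by
  obtain ⟨y, hy⟩ := h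
  have haff := affine_of_mom h3 h0
  have hinj := (algebraMap (ZMod p) F).injective
  by_cases hA : mom (F := F) f R (𝔮 - 2) v = 0
  · refine ⟨0, fun x hx => absurd ?_ hy⟩
    apply hinj
    rw [← hx, haff, haff, hA]
    ring
  · refine ⟨-mom (F := F) f R (𝔮 - 1) v / mom (F := F) f R (𝔮 - 2) v, fun x hx => ?_⟩
    have := haff x
    rw [hx, map_zero] at this
    rw [eq_div_iff hA]
    linear_combination this

theorem exists_ne_of_cnt {R v : V} (h : 1 ≤ cnt F f R v) : ∃ x : F, f (x • R + v) ≠ 0 := by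
  obtain ⟨x, hx⟩ := Finset.card_pos.mp (show 0 < (Finset.univ.filter
    fun x : F => f (x • R + v) ≠ 0).card from h)
  exact ⟨x, by simpa using hx⟩

theorem exists_ne_three (h : 3 ≤ 𝔮) (a b : F) : ∃ x : F, x ≠ a ∧ x ≠ b := by
  have h1 : ({a, b} : Finset F).card < (Finset.univ : Finset F).card := by
    rw [Finset.card_univ]
    have := Finset.card_le_two (a := a) (b := b)
    omega
  obtain ⟨x, -, hx⟩ := Finset.exists_mem_notMem_of_card_lt_card h1
  simp only [Finset.mem_insert, Finset.mem_singleton, not_or] at hx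
  exact ⟨x, hx⟩

theorem Ind.mix {R y κ : V} (h : Ind F R y) (hκ : κ ∉ Submodule.span F {R, y}) (a b c : F) :
    Ind F (a • R + y) (b • R + (κ + c • y)) := by
  intro s t hst
  have ht : t = 0 := by
    by_contra ht
    apply hκ
    rw [Submodule.mem_span_pair]
    refine ⟨-(t⁻¹ * (s * a + t * b)), -(t⁻¹ * (s + t * c)), ?_⟩
    have h1 : t • κ = -((s * a + t * b) • R + (s + t * c) • y) := by
      rw [← sub_eq_zero, ← hst]; module
    have h2 : κ = t⁻¹ • (t • κ) := by rw [smul_smul, inv_mul_cancel₀ ht, one_smul]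
    rw [h2, h1]
    module
  subst ht
  have := h (s * a) s (by rw [← hst]; module)
  exact ⟨this.2, rfl⟩

theorem long_transversal (h3 : 3 ≤ 𝔮) (hgap : LineGap F f 2 3) {R y κ : V} (h : Ind F R y)
    (hκ : κ ∉ Submodule.span F {R, y}) {z₁ z₂ z₃ c₂ c₃ : F} (hc : c₂ ≠ c₃)
    (h₁ : ∀ x : F, f (x • R + y) = 0 → x = z₁)
    (h₂ : ∀ x : F, f (x • R + (κ + c₂ • y)) = 0 → x = z₂)
    (h₃ : ∀ x : F, f (x • R + (κ + c₃ • y)) = 0 → x = z₃) :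
    𝔮 - 3 ≤ (Finset.univ.filter fun c : F => 1 ≤ cnt F f R (κ + c • y)).card := by
  obtain ⟨a, ha, -⟩ := exists_ne_three (F := F) h3 z₁ z₁
  obtain ⟨b, hb2, hb3⟩ := exists_ne_three (F := F) h3 z₂ (z₃ - (c₃ - c₂) * a)
  have hfP : f (a • R + y) ≠ 0 := fun h => ha (h₁ a h)
  have e : ∀ t : F, t • (a • R + y) + (b • R + (κ + c₂ • y)) =
      (t * a + b) • R + (κ + (t + c₂) • y) := fun t => by module
  have htot := hgap _ _ (h.mix hκ a b c₂)
  rw [tot_eq_cnt_add_one hfP] at htot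
  have hcnt : 2 ≤ cnt F f (a • R + y) (b • R + (κ + c₂ • y)) := by
    have hne : (0 : F) ≠ c₃ - c₂ := fun h => hc (sub_eq_zero.mp h.symm).symm
    rw [← Finset.card_pair hne]
    refine Finset.card_le_card fun t ht => ?_
    simp only [Finset.mem_filter, Finset.mem_univ, true_and, e]
    simp only [Finset.mem_insert, Finset.mem_singleton] at ht
    rcases ht with rfl | rfl
    · intro h
      simp only [zero_mul, zero_add] at h
      exact hb2 (h₂ _ h)
    · intro h
      simp only [sub_add_cancel] at h
      exact hb3 (by linear_combination h₃ _ h)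
  have h5 : 𝔮 - 3 ≤ cnt F f (a • R + y) (b • R + (κ + c₂ • y)) := by omega
  refine h5.trans ?_
  unfold cnt
  refine Finset.card_le_card_of_injOn (fun t => t + c₂) (fun t ht => ?_)
    (fun s _ t _ hst => add_right_cancel hst)
  simp only [Finset.coe_filter, Finset.mem_univ, true_and, Set.mem_ofPred_eq, e] at ht ⊢
  exact Finset.card_pos.mpr ⟨t * a + b, by simpa using ht⟩

theorem IsForm.exists_two [Fintype V] {d : ℕ} {g : V → F} (h : IsForm d g) {w : V} (hw : g w ≠ 0)
    (hd : d + 2 ≤ 𝔮) (u : V) : ∃ s t : F, s ≠ t ∧ g (u + s • w) ≠ 0 ∧ g (u + t • w) ≠ 0 := by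
  have h1 := h.line_nonzeros hw u
  obtain ⟨s, hs, t, ht, hst⟩ := Finset.one_lt_card.mp
    (show 1 < (Finset.univ.filter fun t : F => g (u + t • w) ≠ 0).card by omega)
  simp only [Finset.mem_filter, Finset.mem_univ, true_and] at hs ht
  exact ⟨s, t, hst, hs, ht⟩

theorem affine_weight [Fintype V] (hf : f ∈ lcode F p V) (h7 : 7 ≤ 𝔮) (hgap : LineGap F f 2 3)
    {R y : V} (hR : R ≠ 0) (hfR : f R ≠ 0) (hS : f 0 = f R)
    (h0 : ∀ j < 𝔮 - 2, ∀ v, mom (F := F) f R j v = 0) (hy : mom (F := F) f R (𝔮 - 2) y ≠ 0) :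
    Fintype.card V * ((𝔮 - 3) * (𝔮 - 1)) ≤ 𝔮 ^ 2 * wtv f := by
  have hRy : Ind F R y := ind_of_notMem hR fun hmem => hy (mom_span hf hS (by omega) hmem)
  have hform := mom_isForm (F := F) hf R (m := 𝔮 - 2) (by omega)
  have hz : ∀ v, 1 ≤ cnt F f R v → ∃ z : F, ∀ x : F, f (x • R + v) = 0 → x = z := fun v hv =>
    unique_zero_of_affine (by omega) (fun j hj => h0 j hj v) (exists_ne_of_cnt hv)
  have hm : ∀ v, mom (F := F) f R (𝔮 - 2) v ≠ 0 → 1 ≤ cnt F f R v := fun v hv => by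
    have := cnt_ge_of_mom (fun j hj => h0 j hj v) hv
    omega
  obtain ⟨z₁, hz₁⟩ := hz y (hm y hy)
  have hκ : ∀ κ, κ ∉ Submodule.span F {R, y} →
      (𝔮 - 3) * (𝔮 - 1) ≤ ∑ c : F, cnt F f R (κ + c • y) := by
    intro κ hκ
    obtain ⟨c₂, c₃, hc, h2, h3⟩ := hform.exists_two hy (by omega) κ
    obtain ⟨z₂, hz₂⟩ := hz _ (hm _ h2)
    obtain ⟨z₃, hz₃⟩ := hz _ (hm _ h3)
    have h4 := long_transversal (by omega) hgap hRy hκ hc hz₁ hz₂ hz₃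
    refine (Nat.mul_le_mul_right _ h4).trans ?_
    rw [← smul_eq_mul, ← Finset.sum_const]
    refine (Finset.sum_le_sum fun c hc => ?_).trans
      (Finset.sum_le_sum_of_subset (Finset.filter_subset (fun c => 1 ≤ cnt F f R (κ + c • y)) _))
    simp only [Finset.mem_filter, Finset.mem_univ, true_and] at hc
    obtain ⟨z, hz⟩ := hz _ hc
    exact cnt_ge_of_zero hz
  have h1 := sum_plane_notMem hf hRy
  have h2 := Finset.card_filter_add_card_filter_not (s := (Finset.univ : Finset V))
    (fun κ : V => κ ∈ Submodule.span F {R, y})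
  rw [card_span_pair hRy, Finset.card_univ] at h2
  rw [← h1, ← h2, add_mul, add_comm]
  refine Nat.add_le_add ?_ (Nat.mul_le_mul_left _ ?_)
  · rw [← smul_eq_mul, ← Finset.sum_const]
    refine Finset.sum_le_sum fun κ hmem => ?_
    simp only [Finset.mem_filter, Finset.mem_univ, true_and] at hmem
    exact hκ κ hmem
  · rw [mul_comm]
    refine Nat.mul_le_mul_left _ ?_
    rw [tot_eq_cnt_add_one hfR]
    have := cnt_ge_of_zero hz₁
    omega

theorem LineGap.cnt_ge (h : LineGap F f 2 3) {R v : V} (hR : R ≠ 0) (hfR : f R ≠ 0)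
    (hv : v ∉ Submodule.span F {R}) (hc : 2 ≤ cnt F f R v) : 𝔮 - 3 ≤ cnt F f R v := by
  have := h R v (ind_of_notMem hR hv)
  rw [tot_eq_cnt_add_one hfR] at this
  omega

/-- A word of small weight whose lines are either almost empty or almost full is supported on two
hyperplanes. -/
theorem covered_two (h7 : 7 ≤ 𝔮) (n : ℕ) : ∀ (V : Type) [AddCommGroup V] [Module F V] [Fintype V]
    (f : V → ZMod p), f ∈ lcode F p V → Fintype.card V = 𝔮 ^ (n + 1) → LineGap F f 2 3 →
    𝔮 * wtv f < 3 * (𝔮 - 2) * 𝔮 ^ n → Covered F 2 f := by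
  induction n with
  | zero =>
    intro V _ _ _ f hf hV _ hw
    refine covered_of_vanish hV (fun v hv => ?_) 2
    by_contra hfv
    have h1 := sum_cnt_notMem hf hv hfv
    have h2 : 𝔮 * (𝔮 - 1) ≤ 𝔮 * wtv f := by omega
    obtain ⟨a, ha⟩ := Nat.exists_eq_add_of_le h7
    rw [pow_zero, mul_one, ha] at hw
    rw [ha] at h2
    rw [show 7 + a - 1 = a + 6 by omega] at h2
    rw [show 7 + a - 2 = a + 5 by omega] at hw
    nlinarith
  | succ n ih =>
    intro V _ _ _ f hf hV hgap hw
    have h3 : 3 ≤ 𝔮 := by omega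
    by_cases h0 : ∀ v, v ≠ 0 → f v = 0
    · exact covered_of_vanish hV h0 2
    push Not at h0
    obtain ⟨R, hR, hfR⟩ := h0
    have hN : 1 ≤ 𝔮 ^ n := Nat.one_le_pow _ _ (by omega)
    by_cases hS : f 0 = f R
    · rcases zero_step hf h3 hV hR hfR hS with ⟨K, hK, hW, hcov⟩ | ⟨m, h1, h2, h0, ⟨y, hy⟩, hM⟩
      · refine hcov 1 (ih K _ (lcode_comp K.subtype hf) (card_complement hV hK)
          (hgap.comp K.subtype K.injective_subtype) ?_)
        rw [pow_succ'] at hw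
        refine lt_of_mul_lt_mul_left (a := 𝔮) ?_ (by omega)
        rw [hW] at hw
        generalize 𝔮 - 1 = z at *
        generalize 𝔮 - 2 = z' at *
        nlinarith
      · exfalso
        have hcnt : ∀ v, mom (F := F) f R m v ≠ 0 → m + 1 ≤ cnt F f R v ∧ 𝔮 - 3 ≤ cnt F f R v := by
          intro v hv
          have h4 := cnt_ge_of_mom (fun j hj => h0 j hj v) hv
          exact ⟨h4, hgap.cnt_ge hR hfR (fun hmem => hv (mom_span hf hS (by omega) hmem))
            (by omega)⟩
        have key : ∀ M, (∀ v, mom (F := F) f R m v ≠ 0 → M ≤ cnt F f R v) →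
            3 * (𝔮 - 2) ≤ M * (𝔮 - m) → False := by
          intro M hM1 hM2
          have h4 := hM M hM1
          have h5 := Nat.mul_le_mul_right (𝔮 ^ (n + 1)) hM2
          rw [← mul_assoc] at h4
          omega
        rcases lt_trichotomy (m + 3) 𝔮 with hm | hm | hm
        · refine key (𝔮 - 3) (fun v hv => (hcnt v hv).2) ?_
          have : (𝔮 - 3) * 4 ≤ (𝔮 - 3) * (𝔮 - m) := Nat.mul_le_mul_left _ (by omega)
          omega
        · refine key (m + 1) (fun v hv => (hcnt v hv).1) ?_
          rw [show 𝔮 - m = 3 by omega]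
          omega
        · obtain rfl : m = 𝔮 - 2 := by omega
          have h5 := affine_weight hf h7 hgap hR hfR hS h0 hy
          rw [hV, pow_succ', mul_assoc] at h5
          rw [sq, mul_assoc] at h5
          have h6 := Nat.le_of_mul_le_mul_left h5 (by omega)
          have h7' := h6.trans_lt hw
          rw [mul_comm] at h7'
          have h8 := lt_of_mul_lt_mul_right h7' (Nat.zero_le _)
          obtain ⟨a, ha⟩ := Nat.exists_eq_add_of_le h7
          rw [ha, show 7 + a - 1 = a + 6 by omega, show 7 + a - 2 = a + 5 by omega,
            show 7 + a - 3 = a + 4 by omega] at h8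
          nlinarith
    · rcases ne_step hf h3 hV hR hfR hS with ⟨K, g, hK, hg, hg0, hW, hcov⟩ |
        ⟨m, c, hc, h1, h2, h0, -, hle, ⟨φ, hφ, hcdef⟩, hM⟩
      · have hKc := card_complement hV hK
        refine hcov 0 (covered_one h3 n K g hg hKc ?_)
        obtain ⟨a, ha⟩ := Nat.exists_eq_add_of_le h7
        generalize wtv g = w at *
        generalize wtv f = W at *
        rw [pow_succ', pow_succ'] at hW
        rw [pow_succ'] at hw
        generalize 𝔮 ^ n = N at *
        generalize 𝔮 = q at *
        subst ha
        rw [show 7 + a - 1 = a + 6 by omega, show 7 + a - 2 = a + 5 by omega] at *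
        zify [show 7 + a ≤ (7 + a) * ((7 + a) * N) by nlinarith] at *
        have : (a + 5 : ℤ) * ((7 + a) * w) < (a + 5) * (2 * (a + 6) * N) := by nlinarith
        exact lt_of_mul_lt_mul_left this (by positivity)
      · exfalso
        have hcS : c 0 = c R := by
          have := h0 0 (by omega) 0
          rw [mom_zero hc] at this
          exact sub_eq_zero.mp ((algebraMap (ZMod p) F).injective (by rw [this, map_zero]))
        have hcnt : ∀ v, mom (F := F) c R m v ≠ 0 → m ≤ cnt F f R v ∧ 𝔮 - 3 ≤ cnt F f R v := by
          intro v hv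
          have h4 := cnt_ge_of_mom (fun j hj => h0 j hj v) hv
          have h5 := hle v
          exact ⟨by omega, hgap.cnt_ge hR hfR (fun hmem => hv (mom_span hc hcS (by omega) hmem))
            (by omega)⟩
        have key : ∀ M, (∀ v, mom (F := F) c R m v ≠ 0 → 1 + M ≤ cnt F f R v) →
            3 * (𝔮 - 2) ≤ 𝔮 + M * (𝔮 - m) → False := by
          intro M hM1 hM2
          have h4 := hM M hM1
          have h5 := Nat.mul_le_mul_right (𝔮 ^ (n + 1)) hM2
          rw [← mul_assoc, pow_succ' 𝔮 (n + 1)] at h4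
          rw [add_mul] at h5
          have h6 : 2 * 𝔮 ≤ 𝔮 * (𝔮 - 1) := by
            rw [mul_comm]; exact Nat.mul_le_mul_left _ (by omega)
          omega
        rcases Nat.lt_or_ge (m + 2) 𝔮 with hm | hm
        · refine key (𝔮 - 4) (fun v hv => ?_) ?_
          · have := (hcnt v hv).2
            omega
          · have : (𝔮 - 4) * 3 ≤ (𝔮 - 4) * (𝔮 - m) := Nat.mul_le_mul_left _ (by omega)
            omega
        · refine key (m - 1) (fun v hv => ?_) ?_
          · have := (hcnt v hv).1
            omega
          · rw [show 𝔮 - m = 2 by omega]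
            omega

end CoveredTwo

section Structure

variable {V : Type} [AddCommGroup V] [Module F V] {p : ℕ} [Fintype F] [Fact p.Prime]
  [Algebra (ZMod p) F] {f : V → ZMod p}

theorem constant_of_relation {K : Type} [AddCommGroup K] [Module F K] (h3 : 3 ≤ 𝔮) {α : ZMod p}
    {F₁ F₂ F₃ : F → F → K → ZMod p}
    (s₁ : ∀ μ a b k, μ ≠ 0 → F₁ (μ * a) (μ * b) (μ • k) = F₁ a b k)
    (s₂ : ∀ μ a b k, μ ≠ 0 → F₂ (μ * a) (μ * b) (μ • k) = F₂ a b k)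
    (s₃ : ∀ μ a b k, μ ≠ 0 → F₃ (μ * a) (μ * b) (μ • k) = F₃ a b k)
    (rel : ∀ a b c k k', a ≠ 0 → b ≠ 0 → c ≠ 0 →
      F₁ a b k + F₂ c (-b) k' + F₃ c a (k + k') = α) :
    ∃ μ₁ μ₂ μ₃ : ZMod p, μ₁ + μ₂ + μ₃ = α ∧ ∀ a b k, a ≠ 0 → b ≠ 0 →
      F₁ a b k = μ₁ ∧ F₂ a b k = μ₂ ∧ F₃ a b k = μ₃ := by
  have one : (1 : F) ≠ 0 := one_ne_zero
  set δ : K → ZMod p := fun k => F₃ 1 1 k - F₃ 1 1 0 with hδ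
  have e1 : ∀ a b c k, a ≠ 0 → b ≠ 0 → c ≠ 0 →
      F₁ a b k - F₁ a b 0 = F₃ c a 0 - F₃ c a k := fun a b c k ha hb hc => by
    have h1 := rel a b c k 0 ha hb hc
    have h2 := rel a b c 0 0 ha hb hc
    rw [add_zero] at h1 h2
    linear_combination h1 - h2
  have e2 : ∀ a b c k, a ≠ 0 → b ≠ 0 → c ≠ 0 →
      F₂ c (-b) k - F₂ c (-b) 0 = F₃ c a 0 - F₃ c a k := fun a b c k ha hb hc => by
    have h1 := rel a b c 0 k ha hb hc
    have h2 := rel a b c 0 0 ha hb hc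
    rw [zero_add] at h1 h2
    linear_combination h1 - h2
  have d3 : ∀ c a k, c ≠ 0 → a ≠ 0 → F₃ c a k - F₃ c a 0 = δ k := fun c a k hc ha => by
    have h1 := e1 a 1 c k ha one hc
    have h2 := e1 a 1 1 k ha one one
    have h3 := e2 a 1 1 k ha one one
    have h4 := e2 1 1 1 k one one one
    simp only [hδ]
    linear_combination h1 - h2 + h3 - h4
  have d1 : ∀ a b k, a ≠ 0 → b ≠ 0 → F₁ a b k = F₁ a b 0 - δ k := fun a b k ha hb => by
    linear_combination e1 a b 1 k ha hb one - d3 1 a k one ha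
  have d2 : ∀ c b k, c ≠ 0 → b ≠ 0 → F₂ c b k = F₂ c b 0 - δ k := fun c b k hc hb => by
    have := e2 1 (-b) c k one (neg_ne_zero.mpr hb) hc
    rw [neg_neg] at this
    linear_combination this - d3 c 1 k hc one
  have hadd : ∀ k k', δ (k + k') = δ k + δ k' := fun k k' => by
    have h1 := rel 1 1 1 k k' one one one
    have h2 := rel 1 1 1 0 0 one one one
    rw [add_zero] at h2
    linear_combination h1 - h2 - d1 1 1 k one one - d2 1 (-1) k' one (neg_ne_zero.mpr one)
  have hsc : ∀ (μ : F) k, μ ≠ 0 → δ (μ • k) = δ k := fun μ k hμ => by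
    have h1 := s₃ μ 1 1 k hμ
    have h2 := s₃ μ 1 1 0 hμ
    rw [mul_one] at h1 h2
    rw [smul_zero] at h2
    rw [← d3 μ μ _ hμ hμ, ← d3 1 1 k one one, h1, h2]
  have hδ0 : ∀ k, δ k = 0 := fun k => by
    obtain ⟨μ, h1, h2⟩ := exists_ne_three h3 (0 : F) (-1)
    have h5 := hsc (1 + μ) k (fun h => h2 (by linear_combination h))
    rw [add_smul, one_smul, hadd, hsc μ k h1] at h5
    simpa using h5
  have m1 : ∀ s t, s ≠ 0 → t ≠ 0 → F₁ 1 (s * t) 0 - F₁ 1 s 0 = F₃ 1 1 0 - F₃ t 1 0 :=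
    fun s t hs ht => by
      have h1 := rel 1 (s * t) t 0 0 one (mul_ne_zero hs ht) ht
      have h2 := rel 1 s 1 0 0 one hs one
      have h4 := s₂ t 1 (-s) 0 ht
      rw [smul_zero, mul_one, show t * -s = -(s * t) by ring] at h4
      rw [add_zero] at h1 h2
      linear_combination h1 - h2 - h4
  have hχ : ∀ s, s ≠ 0 → F₁ 1 s 0 = F₁ 1 1 0 := fun s hs => by
    have hpow : ∀ n : ℕ, F₁ 1 (s ^ n) 0 - F₁ 1 1 0 = n * (F₁ 1 s 0 - F₁ 1 1 0) := by
      intro n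
      induction n with
      | zero => simp
      | succ n ih =>
        have h1 := m1 (s ^ n) s (pow_ne_zero _ hs) hs
        have h2 := m1 1 s one hs
        rw [one_mul] at h2
        rw [pow_succ]
        push_cast
        linear_combination ih + h1 - h2
    have h1 := hpow (𝔮 - 1)
    rw [FiniteField.pow_card_sub_one_eq_one s hs, Nat.cast_sub (by omega),
      card_cast_zmod (F := F)] at h1
    simp only [sub_self, Nat.cast_one, zero_sub] at h1
    linear_combination h1
  have hF1 : ∀ a b, a ≠ 0 → b ≠ 0 → F₁ a b 0 = F₁ 1 1 0 := fun a b ha hb => by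
    have h1 := s₁ a 1 (a⁻¹ * b) 0 ha
    rw [smul_zero, mul_one, mul_inv_cancel_left₀ ha] at h1
    rw [h1, hχ _ (mul_ne_zero (inv_ne_zero ha) hb)]
  have hF3 : ∀ c a, c ≠ 0 → a ≠ 0 → F₃ c a 0 = F₃ 1 1 0 := fun c a hc ha => by
    have h1 := s₃ a (a⁻¹ * c) 1 0 ha
    rw [smul_zero, mul_one, mul_inv_cancel_left₀ ha] at h1
    have hc' := mul_ne_zero (inv_ne_zero ha) hc
    have h2 := m1 1 _ one hc'
    rw [one_mul, hχ _ hc'] at h2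
    rw [h1]
    linear_combination h2
  have hF2 : ∀ c b, c ≠ 0 → b ≠ 0 → F₂ c b 0 = F₂ 1 (-1) 0 := fun c b hc hb => by
    have h1 := rel 1 (-b) c 0 0 one (neg_ne_zero.mpr hb) hc
    have h2 := rel 1 1 1 0 0 one one one
    rw [neg_neg, hF1 _ _ one (neg_ne_zero.mpr hb), add_zero, hF3 _ _ hc one] at h1
    rw [add_zero] at h2
    linear_combination h1 - h2
  refine ⟨F₁ 1 1 0, F₂ 1 (-1) 0, F₃ 1 1 0, ?_, fun a b k ha hb => ⟨?_, ?_, ?_⟩⟩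
  · have h2 := rel 1 1 1 0 0 one one one
    rwa [add_zero] at h2
  · rw [d1 a b k ha hb, hδ0, sub_zero, hF1 a b ha hb]
  · rw [d2 a b k ha hb, hδ0, sub_zero, hF2 a b ha hb]
  · have := d3 a b k ha hb
    rw [hδ0] at this
    rw [← hF3 a b ha hb]
    linear_combination this

/-- A word supported on three independent hyperplanes is a combination of these hyperplanes. -/
theorem eq_of_independent_cover (h3 : 3 ≤ 𝔮) (hf : f ∈ lcode F p V) {φ₁ φ₂ φ₃ : Module.Dual F V}
    {e₁ e₂ e₃ : V} (h11 : φ₁ e₁ = 1) (h12 : φ₁ e₂ = 0) (h13 : φ₁ e₃ = 0)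
    (h21 : φ₂ e₁ = 0) (h22 : φ₂ e₂ = 1) (h23 : φ₂ e₃ = 0)
    (h31 : φ₃ e₁ = 0) (h32 : φ₃ e₂ = 0) (h33 : φ₃ e₃ = 1)
    (hcov : ∀ v, v ≠ 0 → f v ≠ 0 → φ₁ v = 0 ∨ φ₂ v = 0 ∨ φ₃ v = 0) :
    ∃ μ₁ μ₂ μ₃ : ZMod p, ∀ v, f v = μ₁ * hyp p φ₁ v + μ₂ * hyp p φ₂ v + μ₃ * hyp p φ₃ v := by
  have hz : ∀ v, φ₁ v ≠ 0 → φ₂ v ≠ 0 → φ₃ v ≠ 0 → f v = 0 := by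
    intro v h1 h2 h4
    by_contra h
    rcases hcov v (by rintro rfl; simp at h1) h with h5 | h5 | h5 <;> contradiction
  let κ : Submodule F V := LinearMap.ker φ₁ ⊓ LinearMap.ker φ₂ ⊓ LinearMap.ker φ₃
  have hκ : ∀ k : κ, φ₁ k = 0 ∧ φ₂ k = 0 ∧ φ₃ k = 0 := fun k => by
    have := k.2
    simp only [κ, Submodule.mem_inf, LinearMap.mem_ker] at this
    exact ⟨this.1.1, this.1.2, this.2⟩
  obtain ⟨μ₁, μ₂, μ₃, hsum, hμ⟩ := constant_of_relation (K := κ) (α := f 0) h3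
    (F₁ := fun a b k => f (a • e₂ + b • e₃ + k)) (F₂ := fun c b k => f (c • e₁ + b • e₃ + k))
    (F₃ := fun c a k => f (c • e₁ + a • e₂ + k))
    (fun μ a b k hμ => by
      rw [← lcode_smul hf hμ (a • e₂ + b • e₃ + (k : V))]; congr 1; push_cast; module)
    (fun μ a b k hμ => by
      rw [← lcode_smul hf hμ (a • e₁ + b • e₃ + (k : V))]; congr 1; push_cast; module)
    (fun μ a b k hμ => by
      rw [← lcode_smul hf hμ (a • e₁ + b • e₂ + (k : V))]; congr 1; push_cast; module)
    (fun a b c k k' ha hb hc => by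
      obtain ⟨h1, h2, h4⟩ := hκ k
      obtain ⟨h1', h2', h4'⟩ := hκ k'
      have h5 := line_sum hf (c • e₁ + (-b) • e₃ + k') (a • e₂ + b • e₃ + k)
      rw [← Finset.add_sum_erase _ _ (Finset.mem_univ (0 : F)),
        ← Finset.add_sum_erase _ _ (show (1 : F) ∈ Finset.univ.erase 0 by simp),
        Finset.sum_eq_zero fun x hx => ?_] at h5
      · have e : (1 : F) • (c • e₁ + (-b) • e₃ + (k' : V)) + (a • e₂ + b • e₃ + k) =
            c • e₁ + a • e₂ + ((k + k' : κ) : V) := by push_cast; module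
        rw [e, zero_smul, zero_add] at h5
        linear_combination h5
      · simp only [Finset.mem_erase, Finset.mem_univ, and_true] at hx
        apply hz
        · simp [h11, h12, h13, h1, h1', hc, hx.2]
        · simp [h21, h22, h23, h2, h2', ha]
        · simp only [map_add, map_smul, h31, h32, h33, h4, h4', smul_eq_mul]
          intro h
          have : b * (1 - x) = 0 := by linear_combination h
          rcases mul_eq_zero.mp this with h | h
          · exact hb h
          · exact hx.1 (sub_eq_zero.mp h).symm)
  have hdec : ∀ v, ∃ k : κ, v = φ₁ v • e₁ + φ₂ v • e₂ + φ₃ v • e₃ + k := fun v =>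
    ⟨⟨v - (φ₁ v • e₁ + φ₂ v • e₂ + φ₃ v • e₃), by
      simp [κ, Submodule.mem_inf, h11, h12, h13, h21, h22, h23, h31, h32, h33]⟩, by simp⟩
  have hf1 : ∀ v, φ₁ v = 0 → φ₂ v ≠ 0 → φ₃ v ≠ 0 → f v = μ₁ := fun v h1 h2 h4 => by
    obtain ⟨k, hk⟩ := hdec v
    rw [hk, h1, zero_smul, zero_add]
    exact (hμ _ _ k h2 h4).1
  have hf2 : ∀ v, φ₁ v ≠ 0 → φ₂ v = 0 → φ₃ v ≠ 0 → f v = μ₂ := fun v h1 h2 h4 => by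
    obtain ⟨k, hk⟩ := hdec v
    rw [hk, h2, zero_smul, add_zero]
    exact (hμ _ _ k h1 h4).2.1
  have hf3 : ∀ v, φ₁ v ≠ 0 → φ₂ v ≠ 0 → φ₃ v = 0 → f v = μ₃ := fun v h1 h2 h4 => by
    obtain ⟨k, hk⟩ := hdec v
    rw [hk, h4, zero_smul, add_zero]
    exact (hμ _ _ k h1 h2).2.2
  have hline : ∀ u v, (∀ x : F, x ≠ 0 → f (x • u + v) = 0) → f v = f 0 - f u := fun u v h => by
    have h5 := line_sum hf u v
    rwa [← Finset.add_sum_erase _ _ (Finset.mem_univ (0 : F)),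
      Finset.sum_eq_zero fun x hx => h x (Finset.ne_of_mem_erase hx), add_zero, zero_smul,
      zero_add] at h5
  refine ⟨μ₁, μ₂, μ₃, fun v => ?_⟩
  by_cases h1 : φ₁ v = 0 <;> by_cases h2 : φ₂ v = 0 <;> by_cases h4 : φ₃ v = 0 <;>
    simp only [hyp, h1, h2, h4, if_true, if_false, mul_one, mul_zero, add_zero, zero_add]
  · rw [hline (e₁ + e₂ + e₃) v, hz (e₁ + e₂ + e₃), hsum, sub_zero]
    · simp [h11, h12, h13]
    · simp [h21, h22, h23]
    · simp [h31, h32, h33]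
    · intro x hx
      apply hz
      · simp [h11, h12, h13, h1, hx]
      · simp [h21, h22, h23, h2, hx]
      · simp [h31, h32, h33, h4, hx]
  · rw [hline (e₁ + e₂) v, hf3 (e₁ + e₂), ← hsum, add_sub_cancel_right]
    · simp [h11, h12]
    · simp [h21, h22]
    · simp [h31, h32]
    · intro x hx
      apply hz
      · simp [h11, h12, h1, hx]
      · simp [h21, h22, h2, hx]
      · simp [h31, h32, h4]
  · rw [hline (e₁ + e₃) v, hf2 (e₁ + e₃), ← hsum]
    · ring
    · simp [h11, h13]
    · simp [h21, h23]
    · simp [h31, h33]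
    · intro x hx
      apply hz
      · simp [h11, h13, h1, hx]
      · simp [h21, h23, h2]
      · simp [h31, h33, h4, hx]
  · exact hf1 v h1 h2 h4
  · rw [hline (e₂ + e₃) v, hf1 (e₂ + e₃), ← hsum]
    · ring
    · simp [h12, h13]
    · simp [h22, h23]
    · simp [h32, h33]
    · intro x hx
      apply hz
      · simp [h12, h13, h1]
      · simp [h22, h23, h2, hx]
      · simp [h32, h33, h4, hx]
  · exact hf2 v h1 h2 h4
  · exact hf3 v h1 h2 h4
  · exact hz v h1 h2 h4

/-- The shape of a word supported on three hyperplanes of a pencil. -/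
theorem eq_of_pencil_cover [Fintype V] (h3 : 3 ≤ 𝔮) (hf : f ∈ lcode F p V) {φ₁ φ₂ : Module.Dual F V}
    {e₁ e₂ : V} (h11 : φ₁ e₁ = 1) (h12 : φ₁ e₂ = 0) (h21 : φ₂ e₁ = 0) (h22 : φ₂ e₂ = 1)
    (hcov : ∀ v, v ≠ 0 → f v ≠ 0 → φ₁ v = 0 ∨ φ₂ v = 0 ∨ φ₁ v = φ₂ v) :
    ∃ (α₁ α₂ α₃ : ZMod p) (β : ↥(LinearMap.ker φ₁ ⊓ LinearMap.ker φ₂) →+ ZMod p),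
      (∀ k : ↥(LinearMap.ker φ₁ ⊓ LinearMap.ker φ₂), f (e₁ + k) = α₁ + β k ∧
        f (e₂ + k) = α₂ + β k ∧ f (e₁ + e₂ + k) = α₃ - β k ∧ f k = α₁ + α₂ + α₃) ∧
      (β = 0 ∨ 𝔮 = p) := by
  have hz : ∀ v, φ₁ v ≠ 0 → φ₂ v ≠ 0 → φ₁ v ≠ φ₂ v → f v = 0 := by
    intro v h1 h2 h4
    by_contra h
    rcases hcov v (by rintro rfl; simp at h1) h with h5 | h5 | h5 <;> contradiction
  set K : Submodule F V := LinearMap.ker φ₁ ⊓ LinearMap.ker φ₂ with hKdef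
  have hK : ∀ k : K, φ₁ k = 0 ∧ φ₂ k = 0 := fun k => by
    have := k.2
    simpa only [hKdef, Submodule.mem_inf, LinearMap.mem_ker] using this
  have hone : ∀ (k : K) (t : F), t ≠ 0 → t ≠ 1 → f (e₁ + t • e₂ + k) = 0 := fun k t h0 h1 => by
    obtain ⟨hk1, hk2⟩ := hK k
    apply hz <;> simp [h11, h12, h21, h22, hk1, hk2, h0, Ne.symm h1]
  have rel : ∀ k k' : K, f (e₁ + k) + f (e₂ + k') + f (e₁ + e₂ + (k + k' : K)) = f 0 := by
    intro k k'
    have h5 := line_sum hf (e₂ + k') (e₁ + k)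
    rw [← Finset.add_sum_erase _ _ (Finset.mem_univ (0 : F)),
      ← Finset.add_sum_erase _ _ (show (1 : F) ∈ Finset.univ.erase 0 by simp),
      Finset.sum_eq_zero fun x hx => ?_] at h5
    · have e : (1 : F) • (e₂ + (k' : V)) + (e₁ + k) = e₁ + e₂ + ((k + k' : K) : V) := by
        push_cast; module
      rw [e, zero_smul, zero_add] at h5
      linear_combination h5
    · simp only [Finset.mem_erase, Finset.mem_univ, and_true] at hx
      have e : x • (e₂ + (k' : V)) + (e₁ + k) = e₁ + x • e₂ + ((x • k' + k : K) : V) := by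
        push_cast; module
      rw [e]
      exact hone _ x hx.2 hx.1
  have hfK : ∀ k : K, f k = f 0 := fun k => by
    obtain ⟨t, ht0, ht1⟩ := exists_ne_three h3 (0 : F) 1
    have h5 := line_sum hf (e₁ + t • e₂) k
    have h6 := hone 0 t ht0 ht1
    rw [Submodule.coe_zero, add_zero] at h6
    rw [← Finset.add_sum_erase _ _ (Finset.mem_univ (0 : F)),
      Finset.sum_eq_zero fun x hx => ?_] at h5
    · rw [h6] at h5
      simpa using h5
    · have hx0 := Finset.ne_of_mem_erase hx
      obtain ⟨hk1, hk2⟩ := hK k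
      apply hz <;> simp [h11, h12, h21, h22, hk1, hk2, ht0, hx0, ht1]
  have r0 := rel 0 0
  simp only [add_zero, Submodule.coe_zero] at r0
  have rk : ∀ k : K, f (e₁ + k) + f e₂ + f (e₁ + e₂ + k) = f 0 := fun k => by
    have := rel k 0
    simpa only [add_zero, Submodule.coe_zero] using this
  have rk' : ∀ k : K, f e₁ + f (e₂ + k) + f (e₁ + e₂ + k) = f 0 := fun k => by
    have := rel 0 k
    simpa only [add_zero, zero_add, Submodule.coe_zero] using this
  let β : K →+ ZMod p :=
    { toFun := fun k => f (e₁ + k) - f e₁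
      map_zero' := by simp
      map_add' := fun k k' => by
        linear_combination rk (k + k') - rel k k' - rk k' + rk' k' }
  have hβ : ∀ k : K, β k = f (e₁ + k) - f e₁ := fun k => rfl
  have v1 : ∀ k : K, f (e₁ + k) = f e₁ + β k := fun k => by rw [hβ]; ring
  have v2 : ∀ k : K, f (e₂ + k) = f e₂ + β k := fun k => by
    rw [hβ]; linear_combination rk' k - rk k
  have v3 : ∀ k : K, f (e₁ + e₂ + k) = f (e₁ + e₂) - β k := fun k => by
    rw [hβ]; linear_combination rk k - r0
  refine ⟨f e₁, f e₂, f (e₁ + e₂), β, fun k => ⟨v1 k, v2 k, v3 k, by rw [hfK, r0]⟩, ?_⟩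
  by_cases hp : 𝔮 = p
  · exact Or.inr hp
  left
  ext k
  rw [AddMonoidHom.zero_apply]
  have hmom : ∀ m < 𝔮 - 2, mom (F := F) f (k : V) m e₁ = 0 := by
    intro m hm
    rcases Nat.eq_zero_or_pos m with rfl | hm0
    · rw [mom_zero hf, hfK, sub_self, map_zero]
    have hcoe : ∀ x : F, x • (k : V) = ((x • k : K) : V) := fun x => rfl
    have hsum0 : ∀ c : ZMod p, ∑ x : F, algebraMap (ZMod p) F c * x ^ m = 0 := fun c => by
      rw [← Finset.mul_sum, FiniteField.sum_pow_lt_card_sub_one F m (by omega), mul_zero]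
    have me1 : mom (F := F) f (k : V) m e₁ =
        ∑ x : F, algebraMap (ZMod p) F (β (x • k)) * x ^ m := by
      simp only [mom, hcoe, add_comm _ e₁, v1, map_add, add_mul, Finset.sum_add_distrib, hsum0,
        zero_add]
    have me2 : mom (F := F) f (k : V) m e₂ =
        ∑ x : F, algebraMap (ZMod p) F (β (x • k)) * x ^ m := by
      simp only [mom, hcoe, add_comm _ e₂, v2, map_add, add_mul, Finset.sum_add_distrib, hsum0,
        zero_add]
    by_contra hne
    rw [me1, ← me2] at hne
    have h6 := (mom_isForm (F := F) hf (k : V) (m := m) (by omega)).line_zeros hne e₁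
    have h7 : 𝔮 - 2 ≤ (Finset.univ.filter
        fun t : F => mom (F := F) f (k : V) m (e₁ + t • e₂) = 0).card := by
      have h8 : (Finset.univ \ ({0, 1} : Finset F)).card = 𝔮 - 2 := by
        rw [Finset.card_sdiff_of_subset (Finset.subset_univ _), Finset.card_univ,
          Finset.card_pair zero_ne_one]
      rw [← h8]
      refine Finset.card_le_card fun t ht => ?_
      simp only [Finset.mem_sdiff, Finset.mem_univ, true_and, Finset.mem_insert,
        Finset.mem_singleton, not_or, Finset.mem_filter] at ht ⊢
      simp only [mom, hcoe, add_comm _ (e₁ + t • e₂), hone _ t ht.1 ht.2, map_zero, zero_mul,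
        Finset.sum_const_zero]
    omega
  have haff := affine_of_mom h3 hmom
  by_cases hA : mom (F := F) f (k : V) (𝔮 - 2) e₁ = 0
  · apply (algebraMap (ZMod p) F).injective
    have h1 := haff 1
    have h2 := haff 0
    rw [one_smul, add_comm, v1, map_add] at h1
    rw [zero_smul, zero_add] at h2
    rw [hA] at h1 h2
    rw [map_zero]
    linear_combination h1 - h2
  · exfalso
    have hinj : Function.Injective fun x : F => f (x • (k : V) + e₁) := by
      intro x y hxy
      have hxy : f (x • (k : V) + e₁) = f (y • (k : V) + e₁) := hxy
      have h1 := haff x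
      rw [hxy, haff y] at h1
      have : mom (F := F) f (k : V) (𝔮 - 2) e₁ * (x - y) = 0 := by linear_combination h1
      rcases mul_eq_zero.mp this with h | h
      · exact absurd h hA
      · exact sub_eq_zero.mp h
    have h1 := Fintype.card_le_of_injective _ hinj
    have h2 := Fintype.card_le_of_injective _ (algebraMap (ZMod p) F).injective
    rw [ZMod.card] at h1 h2
    omega

end Structure

section ThreeCover

variable {V : Type} [AddCommGroup V] [Module F V] {p : ℕ} [Fintype F] [Fact p.Prime]
  [Algebra (ZMod p) F] {f : V → ZMod p}

theorem covered_of_greedy {P : V → Module.Dual F V → Prop} (hne : ∃ R : V, R ≠ 0)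
    (h : ∀ v, v ≠ 0 → f v ≠ 0 → ∃ φ : Module.Dual F V, φ ≠ 0 ∧ φ v = 0 ∧ P v φ) :
    Covered F 3 f ∨ ∃ (v₁ v₂ v₃ v₄ : V) (φ₁ φ₂ φ₃ : Module.Dual F V),
      (f v₁ ≠ 0 ∧ f v₂ ≠ 0 ∧ f v₃ ≠ 0 ∧ f v₄ ≠ 0) ∧ (φ₁ v₁ = 0 ∧ φ₂ v₂ = 0 ∧ φ₃ v₃ = 0) ∧
      (P v₁ φ₁ ∧ P v₂ φ₂ ∧ P v₃ φ₃) ∧ (φ₁ v₂ ≠ 0 ∧ φ₁ v₃ ≠ 0 ∧ φ₁ v₄ ≠ 0) ∧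
      (φ₂ v₃ ≠ 0 ∧ φ₂ v₄ ≠ 0) ∧ φ₃ v₄ ≠ 0 := by
  have hcov : ∀ ψ₁ ψ₂ ψ₃ : Module.Dual F V, ψ₁ ≠ 0 → ψ₂ ≠ 0 → ψ₃ ≠ 0 →
      (∀ v, v ≠ 0 → f v ≠ 0 → ψ₁ v = 0 ∨ ψ₂ v = 0 ∨ ψ₃ v = 0) → Covered F 3 f := by
    intro ψ₁ ψ₂ ψ₃ h1 h2 h3 hc
    refine ⟨![ψ₁, ψ₂, ψ₃], fun i => by fin_cases i <;> simp [h1, h2, h3], fun v hv hfv => ?_⟩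
    rcases hc v hv hfv with h | h | h
    · exact ⟨0, h⟩
    · exact ⟨1, h⟩
    · exact ⟨2, h⟩
  refine or_iff_not_imp_left.mpr fun hn => ?_
  obtain ⟨R, hR⟩ := hne
  obtain ⟨ψ, hψ⟩ := exists_dual_one (F := F) hR
  have hψ0 : ψ ≠ 0 := by rintro rfl; simp at hψ
  have key : ∀ ψ₁ ψ₂ ψ₃ : Module.Dual F V, ψ₁ ≠ 0 → ψ₂ ≠ 0 → ψ₃ ≠ 0 →
      ∃ v, v ≠ 0 ∧ f v ≠ 0 ∧ ψ₁ v ≠ 0 ∧ ψ₂ v ≠ 0 ∧ ψ₃ v ≠ 0 := by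
    intro ψ₁ ψ₂ ψ₃ h1 h2 h3
    by_contra! hc
    exact hn (hcov ψ₁ ψ₂ ψ₃ h1 h2 h3 fun v hv hfv => by
      have := hc v hv hfv
      tauto)
  obtain ⟨v₁, n1, f1, -, -, -⟩ := key ψ ψ ψ hψ0 hψ0 hψ0
  obtain ⟨φ₁, a1, b1, c1⟩ := h v₁ n1 f1
  obtain ⟨v₂, n2, f2, d2, -, -⟩ := key φ₁ φ₁ φ₁ a1 a1 a1
  obtain ⟨φ₂, a2, b2, c2⟩ := h v₂ n2 f2
  obtain ⟨v₃, n3, f3, d3, e3, -⟩ := key φ₁ φ₂ φ₂ a1 a2 a2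
  obtain ⟨φ₃, a3, b3, c3⟩ := h v₃ n3 f3
  obtain ⟨v₄, n4, f4, d4, e4, g4⟩ := key φ₁ φ₂ φ₃ a1 a2 a3
  exact ⟨v₁, v₂, v₃, v₄, φ₁, φ₂, φ₃, ⟨f1, f2, f3, f4⟩, ⟨b1, b2, b3⟩, ⟨c1, c2, c3⟩,
    ⟨d2, d3, d4⟩, ⟨e3, e4⟩, g4⟩

/-- A line with at least four support points is contained in one of three covering hyperplanes. -/
theorem exists_cover_line {φ : Fin 3 → Module.Dual F V}
    (hcov : ∀ v, v ≠ 0 → f v ≠ 0 → ∃ i, φ i v = 0) {u v : V} (h : Ind F u v)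
    (ht : 4 ≤ tot F f u v) : ∃ i, φ i u = 0 ∧ φ i v = 0 := by
  by_contra! hc
  have hsub : (if f u ≠ 0 then 1 else 0) + cnt F f u v ≤
      ∑ i, ((if φ i u = 0 then 1 else 0) +
        (Finset.univ.filter fun x : F => φ i (x • u + v) = 0).card) := by
    rw [Finset.sum_add_distrib]
    refine add_le_add ?_ ?_
    · split_ifs with hu
      · obtain ⟨i, hi⟩ := hcov u h.left_ne hu
        exact (by simp [hi] : 1 ≤ if φ i u = 0 then 1 else 0).trans
          (Finset.single_le_sum (f := fun i => if φ i u = 0 then 1 else 0)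
            (fun _ _ => Nat.zero_le _) (Finset.mem_univ i))
      · exact Nat.zero_le _
    · refine le_trans (Finset.card_le_card fun x hx => ?_) Finset.card_biUnion_le
      simp only [Finset.mem_filter, Finset.mem_univ, true_and, Finset.mem_biUnion] at hx ⊢
      exact hcov _ (h.add_smul x).right_ne hx
  have hle : ∀ i, ((if φ i u = 0 then 1 else 0) +
        (Finset.univ.filter fun x : F => φ i (x • u + v) = 0).card) ≤ 1 := by
    intro i
    by_cases hu : φ i u = 0
    · have := hc i hu
      simp [hu, this]
    · rw [if_neg hu, zero_add]
      refine Finset.card_le_one.mpr fun x hx y hy => ?_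
      simp only [Finset.mem_filter, Finset.mem_univ, true_and,
        exists_unique_zero _ hu] at hx hy
      rw [hx, hy]
  have := Finset.sum_le_sum fun i (_ : i ∈ Finset.univ) => hle i
  simp only [Finset.sum_const, Finset.card_univ, Fintype.card_fin, smul_eq_mul] at this
  unfold tot at ht
  omega

variable [Fintype V]

theorem sum_cnt_span (f : V → ZMod p) {u v : V} (h : Ind F u v) (κ : V) :
    ∑ c : F, cnt F f u (κ + c • v) =
      (Finset.univ.filter fun w : V => w ∈ Submodule.span F {u, v} ∧ f (w + κ) ≠ 0).card := by
  unfold cnt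
  rw [← Finset.card_sigma]
  refine Finset.card_bij (fun (ab : Σ _ : F, F) _ => ab.2 • u + ab.1 • v) ?_ ?_ ?_
  · rintro ⟨a, b⟩ hab
    simp only [Finset.mem_sigma, Finset.mem_univ, Finset.mem_filter, true_and] at hab ⊢
    exact ⟨Submodule.mem_span_pair.mpr ⟨b, a, rfl⟩, by convert hab using 2; abel_nf⟩
  · rintro ⟨a, b⟩ _ ⟨a', b'⟩ _ hab
    have := h (b - b') (a - a') (by
      have : b • u + a • v = b' • u + a' • v := hab
      rw [sub_smul, sub_smul, sub_add_sub_comm, this, sub_self])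
    rw [sub_eq_zero, sub_eq_zero] at this
    rw [this.1, this.2]
  · intro w hw
    simp only [Finset.mem_filter, Finset.mem_univ, true_and] at hw
    obtain ⟨a, b, rfl⟩ := Submodule.mem_span_pair.mp hw.1
    refine ⟨⟨b, a⟩, ?_, rfl⟩
    simp only [Finset.mem_sigma, Finset.mem_univ, Finset.mem_filter, true_and]
    convert hw.2 using 2
    abel_nf

/-- Every support point lies on a line of the plane spanned by it and two further points which
has at least four support points. -/
theorem exists_long (h8 : 8 ≤ 𝔮) (hf : f ∈ lcode F p V) {P a b : V} (hfP : f P ≠ 0)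
    (h : Ind F P a) (hb : b ∉ Submodule.span F {P, a}) :
    ∃ c d : F, (c ≠ 0 ∨ d ≠ 0) ∧ Ind F P (c • a + d • b) ∧ 4 ≤ tot F f P (c • a + d • b) := by
  have hlin : ∀ x y z : F, x • P + y • a + z • b = 0 → x = 0 ∧ y = 0 ∧ z = 0 := by
    intro x y z hxyz
    have hz : z = 0 := by
      by_contra hz
      apply hb
      rw [Submodule.mem_span_pair]
      refine ⟨-(z⁻¹ * x), -(z⁻¹ * y), ?_⟩
      have : b = z⁻¹ • (x • P + y • a + z • b) - z⁻¹ • (x • P + y • a) := by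
        rw [← smul_sub, add_sub_cancel_left, smul_smul, inv_mul_cancel₀ hz, one_smul]
      rw [this, hxyz]
      module
    rw [hz, zero_smul, add_zero] at hxyz
    exact ⟨(h x y hxyz).1, (h x y hxyz).2, hz⟩
  have hind : ∀ c d : F, c ≠ 0 ∨ d ≠ 0 → Ind F P (c • a + d • b) := by
    intro c d hcd x y hxy
    obtain ⟨h1, h2, h3⟩ := hlin x (y * c) (y * d) (by rw [← hxy]; module)
    refine ⟨h1, ?_⟩
    rcases hcd with h | h
    · exact (mul_eq_zero.mp h2).resolve_right h
    · exact (mul_eq_zero.mp h3).resolve_right h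
  by_contra! hc
  obtain ⟨⟨c, d⟩, hcd, hmax⟩ := Finset.exists_max_image
    (Finset.univ.filter fun x : F × F => x.1 ≠ 0 ∨ x.2 ≠ 0)
    (fun x => tot F f P (x.1 • a + x.2 • b)) ⟨(1, 0), by simp⟩
  simp only [Finset.mem_filter, Finset.mem_univ, true_and] at hcd hmax
  have hI := hind c d hcd
  have hs3 : tot F f P (c • a + d • b) ≤ 3 := Nat.lt_succ_iff.mp (hc c d hcd hI)
  obtain ⟨u', v', hI', hspan, hu'⟩ := exists_zero_on_line hI (hs3.trans (by omega))
  have ht' : cnt F f u' v' = tot F f P (c • a + d • b) := by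
    rw [tot_congr hf hI hI' (by rw [hspan])]
    unfold tot
    simp [hu']
  obtain ⟨κ, hκ⟩ : ∃ κ : V, ∀ e : F, ∃ c' d' : F, (c' ≠ 0 ∨ d' ≠ 0) ∧
      κ + e • (c • a + d • b) = c' • a + d' • b := by
    by_cases h0 : c = 0
    · refine ⟨a, fun e => ⟨1, e * d, Or.inl one_ne_zero, ?_⟩⟩
      rw [h0]
      module
    · refine ⟨b, fun e => ?_⟩
      by_cases he : e = 0
      · exact ⟨0, 1, Or.inr one_ne_zero, by simp [he]⟩
      · exact ⟨e * c, 1 + e * d, Or.inl (mul_ne_zero he h0), by module⟩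
  have hle : ∑ e : F, cnt F f P (κ + e • (c • a + d • b)) ≤
      𝔮 * (tot F f P (c • a + d • b) - 1) := by
    rw [← smul_eq_mul, ← Finset.card_univ, ← Finset.sum_const]
    refine Finset.sum_le_sum fun e _ => ?_
    obtain ⟨c', d', hcd', he⟩ := hκ e
    have := hmax (c', d') hcd'
    simp only [tot_eq_cnt_add_one hfP] at this ⊢
    rw [he]
    omega
  have hli := line_inequality hf u' v' κ
  have hsum : ∑ e : F, cnt F f u' (κ + e • v') =
      ∑ e : F, cnt F f P (κ + e • (c • a + d • b)) := by
    rw [sum_cnt_span f hI', sum_cnt_span f hI, hspan]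
  rw [hsum, ht'] at hli
  have hs1 : 1 ≤ tot F f P (c • a + d • b) := by
    rw [tot_eq_cnt_add_one hfP]; omega
  generalize tot F f P (c • a + d • b) = s at *
  have h2 := hli.trans (Nat.mul_le_mul_left _ hle)
  generalize 𝔮 = k at *
  obtain ⟨k, rfl⟩ := Nat.exists_eq_add_of_le h8
  interval_cases s
  · simp at h2
  · have e1 : 8 + k - 2 = 6 + k := by omega
    have e2 : 8 + k - 1 = 7 + k := by omega
    rw [e1, e2] at h2
    nlinarith
  · have e1 : 8 + k - 3 = 5 + k := by omega
    have e2 : 8 + k - 1 = 7 + k := by omega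
    rw [e1, e2] at h2
    nlinarith

end ThreeCover

section PlaneThree

variable {V : Type} [AddCommGroup V] [Module F V] {p : ℕ} [Fintype F] [Fact p.Prime]
  [Algebra (ZMod p) F] {f : V → ZMod p} [Fintype V]

theorem card_ker_dual {φ : Module.Dual F V} (hφ : φ ≠ 0) :
    𝔮 * (Finset.univ.filter fun v : V => φ v = 0).card = Fintype.card V := by
  obtain ⟨w, hw⟩ : ∃ w, φ w ≠ 0 := by
    by_contra! h
    exact hφ (LinearMap.ext h)
  rw [← sum_card_line (F := F) (fun v => φ v = 0) w, ← Finset.card_univ, Finset.card_eq_sum_ones]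
  refine Finset.sum_congr rfl fun v _ => ?_
  rw [Finset.card_eq_one]
  exact ⟨-φ v / φ w, by ext x; simp [exists_unique_zero _ hw, -map_add, -map_smul]⟩

theorem LineGap.cnt_ge_of_three (h : LineGap F f 3 4) {R v : V} (hR : R ≠ 0) (hfR : f R ≠ 0)
    (hv : v ∉ Submodule.span F {R}) (hc : 3 ≤ cnt F f R v) : 𝔮 - 4 ≤ cnt F f R v := by
  have := h R v (ind_of_notMem hR hv)
  rw [tot_eq_cnt_add_one hfR] at this
  omega

/-- In a plane, a line almost filled by the support is the kernel of a functional with few zeros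
of the word. -/
theorem exists_dual_of_long (hf : f ∈ lcode F p V) (hV : Fintype.card V = 𝔮 ^ 3)
    (hgap : LineGap F f 3 4) {u v : V} (h : Ind F u v) (ht : 4 ≤ tot F f u v) (h4 : 4 ≤ 𝔮) :
    ∃ φ : Module.Dual F V, φ ≠ 0 ∧ φ u = 0 ∧ φ v = 0 ∧
      (Finset.univ.filter fun w => φ w = 0 ∧ f w = 0).card ≤ 4 * 𝔮 - 3 := by
  have hcS := card_span_pair h
  have hlt : Submodule.span F {u, v} < ⊤ := by
    rw [lt_top_iff_ne_top]
    intro htop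
    rw [htop] at hcS
    simp only [Submodule.mem_top, Finset.filter_true, Finset.card_univ, hV] at hcS
    have := Nat.pow_right_injective (show 2 ≤ 𝔮 by omega) hcS
    omega
  obtain ⟨φ, hφ, hker⟩ := Submodule.exists_le_ker_of_lt_top _ hlt
  refine ⟨φ, hφ, hker (Submodule.subset_span (by simp)), hker (Submodule.subset_span (by simp)), ?_⟩
  have hk : (Finset.univ.filter fun w : V => φ w = 0).card = 𝔮 ^ 2 := by
    have := card_ker_dual hφ
    rw [hV, pow_succ, mul_comm (𝔮 ^ 2)] at this
    exact Nat.eq_of_mul_eq_mul_left (by omega) this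
  have heq : (Finset.univ.filter fun w : V => w ∈ Submodule.span F {u, v}) =
      Finset.univ.filter fun w : V => φ w = 0 :=
    Finset.eq_of_subset_of_card_le (fun w hw => by
      simp only [Finset.mem_filter, Finset.mem_univ, true_and] at hw ⊢
      exact hker hw) (by rw [hk, hcS])
  have hl := card_line hf h
  have hsplit := Finset.card_filter_add_card_filter_not
    (s := Finset.univ.filter fun w : V => φ w = 0) (fun w => f w = 0)
  rw [hk, Finset.filter_filter, ← heq, Finset.filter_filter] at hsplit
  have hl' : (Finset.univ.filter fun w : V => w ∈ Submodule.span F {u, v} ∧ ¬f w = 0).card =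
      (𝔮 - 1) * tot F f u v + if f 0 ≠ 0 then 1 else 0 := by convert hl
  rw [hl'] at hsplit
  have hg := hgap u v h
  have hX : (𝔮 - 1) * (𝔮 - 3) ≤ (𝔮 - 1) * tot F f u v := Nat.mul_le_mul_left _ (by omega)
  obtain ⟨k, hk'⟩ := Nat.exists_eq_add_of_le h4
  rw [hk'] at hX hsplit ⊢
  have e1 : 4 + k - 1 = 3 + k := by omega
  have e2 : 4 + k - 3 = 1 + k := by omega
  have e3 : 4 * (4 + k) - 3 = 13 + 4 * k := by omega
  rw [e1] at hsplit
  rw [e1, e2] at hX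
  rw [e3]
  have : (Finset.univ.filter fun w : V => φ w = 0 ∧ f w = 0).card + (3 + k) * (1 + k) ≤
      (4 + k) ^ 2 := by
    rw [← hsplit]
    refine Nat.add_le_add_left (hX.trans (Nat.le_add_right _ _)) _
  nlinarith

theorem covered_three_plane (h37 : 37 ≤ 𝔮) (hf : f ∈ lcode F p V)
    (hV : Fintype.card V = 𝔮 ^ 3) (hgap : LineGap F f 3 4)
    (hw : wtv f ≤ (𝔮 - 1) * (9 * 𝔮 + 1)) : Covered F 3 f := by
  refine (covered_of_greedy (f := f) (P := fun v φ =>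
    (Finset.univ.filter fun w => φ w = 0 ∧ f w = 0).card ≤ 4 * 𝔮 - 3)
    (exists_ne_zero_of_card hV) fun v hv hfv => ?_).resolve_right ?_
  · obtain ⟨a, ha⟩ := exists_notMem_span_of_card hV hv
    obtain ⟨b, hb⟩ : ∃ b, b ∉ Submodule.span F {v, a} := by
      by_contra! h
      have hc := card_span_pair (ind_of_notMem hv ha)
      simp only [h, Finset.filter_true, Finset.card_univ, hV] at hc
      have := Nat.pow_right_injective (show 2 ≤ 𝔮 by omega) hc
      omega
    obtain ⟨c, d, -, hI, ht⟩ := exists_long (by omega) hf hfv (ind_of_notMem hv ha) hb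
    obtain ⟨φ, h1, h2, -, h3⟩ := exists_dual_of_long hf hV hgap hI ht (by omega)
    exact ⟨φ, h1, h2, h3⟩
  rintro ⟨v₁, v₂, v₃, P, φ₁, φ₂, φ₃, ⟨f1, f2, f3, fP⟩, ⟨a1, a2, a3⟩, ⟨b1, b2, b3⟩,
    ⟨c12, c13, c1⟩, ⟨c23, c2⟩, c3⟩
  have hP : P ≠ 0 := by rintro rfl; simp at c1
  have hbadA : ∀ φ : Module.Dual F V, φ P ≠ 0 →
      (Finset.univ.filter fun w => φ w = 0 ∧ f w = 0).card ≤ 4 * 𝔮 - 3 →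
      (Finset.univ.filter fun v => f ((-φ v / φ P) • P + v) = 0).card ≤ 𝔮 * (4 * 𝔮 - 3) := by
    intro φ hφ hb
    refine le_trans ?_ (Nat.mul_le_mul_left _ hb)
    rw [← Finset.card_univ, ← Finset.card_product]
    refine Finset.card_le_card_of_injOn (fun v => (φ v, (-φ v / φ P) • P + v)) ?_ ?_
    · intro v hv
      simp only [Finset.coe_filter, Finset.mem_univ, true_and, Set.mem_ofPred_eq] at hv
      simp only [Finset.coe_product, Set.mem_prod, Finset.mem_coe, Finset.mem_univ, true_and,
        Finset.mem_filter]
      refine ⟨?_, hv⟩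
      rw [map_add, map_smul, smul_eq_mul]
      field_simp
      ring
    · rintro v - w - hvw
      simp only [Prod.mk.injEq] at hvw
      rw [hvw.1] at hvw
      exact add_left_cancel hvw.2
  have hbadB : ∀ φ ψ : Module.Dual F V, φ P ≠ 0 → ψ P ≠ 0 → (∃ w, ψ w = 0 ∧ φ w ≠ 0) →
      (Finset.univ.filter fun v => -φ v / φ P = -ψ v / ψ P).card = 𝔮 ^ 2 := by
    rintro φ ψ hφ hψ ⟨w, hw1, hw2⟩
    have h0 : ψ P • φ - φ P • ψ ≠ 0 := fun h => by
      have := LinearMap.congr_fun h w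
      simp [hw1, hw2, hψ] at this
    have := card_ker_dual h0
    rw [hV, pow_succ, mul_comm (𝔮 ^ 2)] at this
    rw [← Nat.eq_of_mul_eq_mul_left (by omega) this]
    congr 1
    ext v
    simp only [Finset.mem_filter, Finset.mem_univ, true_and, LinearMap.sub_apply,
      LinearMap.smul_apply, smul_eq_mul]
    rw [div_eq_div_iff hφ hψ, sub_eq_zero, neg_mul, neg_mul, neg_inj, mul_comm, mul_comm (ψ v)]
  have hA1 := hbadA φ₁ c1 b1
  have hA2 := hbadA φ₂ c2 b2
  have hA3 := hbadA φ₃ c3 b3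
  have hB1 := hbadB φ₁ φ₂ c1 c2 ⟨v₂, a2, c12⟩
  have hB2 := hbadB φ₁ φ₃ c1 c3 ⟨v₃, a3, c13⟩
  have hB3 := hbadB φ₂ φ₃ c2 c3 ⟨v₃, a3, c23⟩
  set A := fun φ : Module.Dual F V =>
    Finset.univ.filter fun v => f ((-φ v / φ P) • P + v) = 0 with hA
  set B := fun φ ψ : Module.Dual F V =>
    Finset.univ.filter fun v : V => -φ v / φ P = -ψ v / ψ P with hB
  set bad := (A φ₁ ∪ A φ₂ ∪ A φ₃) ∪ (B φ₁ φ₂ ∪ B φ₁ φ₃ ∪ B φ₂ φ₃) with hbad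
  have hbc : bad.card ≤ 3 * (𝔮 * (4 * 𝔮 - 3)) + 3 * 𝔮 ^ 2 := by
    have h1 := Finset.card_union_le (A φ₁ ∪ A φ₂ ∪ A φ₃) (B φ₁ φ₂ ∪ B φ₁ φ₃ ∪ B φ₂ φ₃)
    have h2 := Finset.card_union_le (A φ₁ ∪ A φ₂) (A φ₃)
    have h3 := Finset.card_union_le (A φ₁) (A φ₂)
    have h4 := Finset.card_union_le (B φ₁ φ₂ ∪ B φ₁ φ₃) (B φ₂ φ₃)
    have h5 := Finset.card_union_le (B φ₁ φ₂) (B φ₁ φ₃)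
    have : (A φ₁).card ≤ 𝔮 * (4 * 𝔮 - 3) := hA1
    have : (A φ₂).card ≤ 𝔮 * (4 * 𝔮 - 3) := hA2
    have : (A φ₃).card ≤ 𝔮 * (4 * 𝔮 - 3) := hA3
    have : (B φ₁ φ₂).card = 𝔮 ^ 2 := hB1
    have : (B φ₁ φ₃).card = 𝔮 ^ 2 := hB2
    have : (B φ₂ φ₃).card = 𝔮 ^ 2 := hB3
    rw [← hbad] at h1
    omega
  have hgood : ∀ v ∈ badᶜ, 𝔮 - 4 ≤ cnt F f P v := by
    intro v hv
    simp only [hbad, hA, hB, Finset.mem_compl, Finset.mem_union, Finset.mem_filter,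
      Finset.mem_univ, true_and, not_or] at hv
    obtain ⟨⟨⟨g1, g2⟩, g3⟩, ⟨⟨g4, g5⟩, g6⟩⟩ := hv
    refine hgap.cnt_ge_of_three hP fP (fun hv => ?_) ?_
    · obtain ⟨y, rfl⟩ := Submodule.mem_span_singleton.mp hv
      exact g4 (by rw [map_smul, map_smul, smul_eq_mul, smul_eq_mul]; field_simp)
    · unfold cnt
      have : ({-φ₁ v / φ₁ P, -φ₂ v / φ₂ P, -φ₃ v / φ₃ P} : Finset F).card = 3 :=
        Finset.card_eq_three.mpr ⟨_, _, _, g4, g5, g6, rfl⟩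
      rw [← this]
      refine Finset.card_le_card fun x hx => ?_
      simp only [Finset.mem_insert, Finset.mem_singleton] at hx
      simp only [Finset.mem_filter, Finset.mem_univ, true_and]
      rcases hx with rfl | rfl | rfl
      exacts [g1, g2, g3]
  have hsum := sum_cnt (F := F) f P
  have hlow : (badᶜ).card * (𝔮 - 4) ≤ 𝔮 * nz f := by
    rw [← hsum, ← smul_eq_mul, ← Finset.sum_const]
    exact (Finset.sum_le_sum hgood).trans
      (Finset.sum_le_sum_of_subset (Finset.subset_univ _))
  rw [Finset.card_compl, hV] at hlow
  have hnz : nz f ≤ (𝔮 - 1) * (9 * 𝔮 + 1) + 1 := by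
    rw [nz_eq]
    split_ifs <;> omega
  have h3 := hlow.trans (Nat.mul_le_mul_left _ hnz)
  have h4 : (𝔮 ^ 3 - (3 * (𝔮 * (4 * 𝔮 - 3)) + 3 * 𝔮 ^ 2)) * (𝔮 - 4) ≤
      𝔮 * ((𝔮 - 1) * (9 * 𝔮 + 1) + 1) :=
    (Nat.mul_le_mul_right _ (Nat.sub_le_sub_left hbc _)).trans h3
  clear * - h4 h37
  generalize 𝔮 = k at *
  obtain ⟨k, rfl⟩ := Nat.exists_eq_add_of_le h37
  have e1 : 37 + k - 1 = 36 + k := by omega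
  have e2 : 4 * (37 + k) - 3 = 145 + 4 * k := by omega
  have e3 : 37 + k - 4 = 33 + k := by omega
  rw [e1, e2, e3] at h4
  have e4 : (37 + k) ^ 3 - (3 * ((37 + k) * (145 + 4 * k)) + 3 * (37 + k) ^ 2) =
      k ^ 3 + 96 * k ^ 2 + 3006 * k + 30451 := by
    rw [Nat.sub_eq_iff_eq_add (by nlinarith [sq_nonneg k])]
    ring
  rw [e4] at h4
  nlinarith [sq_nonneg k, Nat.zero_le (k ^ 3), Nat.zero_le (k ^ 2), Nat.zero_le (k ^ 4)]

end PlaneThree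

section Thin

variable {V : Type} [AddCommGroup V] [Module F V] {p : ℕ} [Fintype F] [Fact p.Prime]
  [Algebra (ZMod p) F] {f : V → ZMod p} [Fintype V] {n : ℕ}

/-- A word of small weight over a large field, in vector space dimension at least four. -/
structure Sparse (F : Type) [Field F] [Fintype F] {V : Type} [AddCommGroup V] [Module F V]
    [Fintype V] {p : ℕ} [Fact p.Prime] [Algebra (ZMod p) F] (n : ℕ) (f : V → ZMod p) : Prop where
  le_card : 37 ≤ Fintype.card F
  mem : f ∈ lcode F p V
  card_space : Fintype.card V = Fintype.card F ^ (n + 4)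
  wtv_le : wtv f ≤ (Fintype.card F - 1) * (4 * Fintype.card F - 33) * Fintype.card F ^ (n + 1)

theorem Sparse.gap (S : Sparse F n f) : LineGap F f 3 4 := by
  have h37 := S.le_card
  refine lineGap_of_wtv S.mem (n := n + 2) S.card_space (M := 4 * (𝔮 - 4)) (by norm_num)
    (by omega) (fun s h3 h4 => ?_) (S.wtv_le.trans_lt ?_)
  · generalize 𝔮 = k at *
    obtain ⟨j, rfl⟩ := Nat.exists_eq_add_of_le (show 4 ≤ s by omega)
    obtain ⟨i, rfl⟩ := Nat.exists_eq_add_of_le h4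
    have e1 : 4 + j + 4 + i - 1 = 7 + j + i := by omega
    have e2 : 4 * (4 + j + 4 + i - 4) - 1 = 15 + 4 * j + 4 * i := by omega
    have e3 : 4 + j + 4 + i - (4 + j) = 4 + i := by omega
    rw [e1, e2, e3]
    refine lt_of_lt_of_le (Nat.mul_lt_mul_of_lt_of_le (show 7 + j + i < 8 + j + i by omega)
      (show 15 + 4 * j + 4 * i ≤ (4 + j) * (4 + i) by nlinarith) (by positivity)) ?_
    exact le_of_eq (by ring)
  · rw [pow_succ 𝔮 (n + 1), mul_comm (𝔮 ^ (n + 1)), ← mul_assoc]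
    refine Nat.mul_lt_mul_of_pos_right ?_ (pow_pos (by omega) _)
    generalize 𝔮 = k at *
    obtain ⟨k, rfl⟩ := Nat.exists_eq_add_of_le h37
    have e1 : 37 + k - 1 = 36 + k := by omega
    have e2 : 4 * (37 + k) - 33 = 115 + 4 * k := by omega
    have e3 : 37 + k - 4 = 33 + k := by omega
    rw [e1, e2, e3]
    nlinarith

/-- The linear map parametrizing the span of three vectors. -/
def pl (u v κ : V) : (F × F × F) →ₗ[F] V where
  toFun w := w.1 • u + w.2.1 • v + w.2.2 • κ
  map_add' a b := by simp only [Prod.fst_add, Prod.snd_add]; module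
  map_smul' a b := by
    simp only [Prod.smul_fst, Prod.smul_snd, RingHom.id_apply, smul_eq_mul]; module

theorem pl_apply (u v κ : V) (x y z : F) : pl u v κ (x, y, z) = x • u + y • v + z • κ := rfl

theorem pl_injective {u v κ : V} (h : Ind F u v) (hκ : κ ∉ Submodule.span F {u, v}) :
    Function.Injective (pl (F := F) u v κ) := by
  rw [injective_iff_map_eq_zero]
  rintro ⟨x, y, z⟩ hxyz
  rw [pl_apply] at hxyz
  have hz : z = 0 := by
    by_contra hz
    apply hκ
    rw [Submodule.mem_span_pair]
    refine ⟨-(z⁻¹ * x), -(z⁻¹ * y), ?_⟩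
    have : κ = z⁻¹ • (x • u + y • v + z • κ) - z⁻¹ • (x • u + y • v) := by
      rw [← smul_sub, add_sub_cancel_left, smul_smul, inv_mul_cancel₀ hz, one_smul]
    rw [this, hxyz]
    module
  rw [hz, zero_smul, add_zero] at hxyz
  rw [(h x y hxyz).1, (h x y hxyz).2, hz]
  rfl

theorem cnt_pl (u v κ : V) (y z : F) :
    cnt F (fun w => f (pl u v κ w)) ((1, 0, 0) : F × F × F) (0, y, z) =
      cnt F f u (y • v + z • κ) := by
  unfold cnt
  simp [pl_apply, add_assoc]

theorem tot_pl (u v κ : V) (y z : F) :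
    tot F (fun w => f (pl u v κ w)) ((1, 0, 0) : F × F × F) (0, y, z) =
      tot F f u (y • v + z • κ) := by
  unfold tot
  rw [cnt_pl]
  simp [pl_apply]

theorem wtv_pl (hf : f ∈ lcode F p V) (u v κ : V) :
    wtv (fun w : F × F × F => f (pl u v κ w)) =
      (𝔮 - 1) * (tot F f u v + ∑ c : F, cnt F f u (κ + c • v)) := by
  have hnz : nz (fun w : F × F × F => f (pl u v κ w)) =
      ∑ z : F, ∑ y : F, cnt F f u (y • v + z • κ) := by
    unfold nz cnt
    simp only [Finset.card_filter]
    rw [Fintype.sum_prod_type, Finset.sum_comm, Fintype.sum_prod_type, Finset.sum_comm]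
    simp only [pl_apply, add_assoc]
  have hz : ∀ z : F, z ≠ 0 → ∑ y : F, cnt F f u (y • v + z • κ) =
      ∑ c : F, cnt F f u (κ + c • v) := by
    intro z hz
    refine Fintype.sum_equiv (Equiv.mulLeft₀ z⁻¹ (inv_ne_zero hz)) _ _ fun y => ?_
    rw [← cnt_smul hf u (κ + _) hz]
    congr 1
    change _ = z • (κ + (z⁻¹ * y) • v)
    rw [smul_add, smul_smul, mul_inv_cancel_left₀ hz, add_comm]
  have h1 := nz_eq (fun w : F × F × F => f (pl u v κ w))
  rw [hnz, ← Finset.add_sum_erase _ _ (Finset.mem_univ (0 : F)),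
    Finset.sum_congr rfl fun z hz' => hz z (Finset.ne_of_mem_erase hz'), Finset.sum_const,
    Finset.card_erase_of_mem (Finset.mem_univ _), Finset.card_univ] at h1
  simp only [zero_smul, add_zero, map_zero, sum_cnt_line hf, smul_eq_mul] at h1
  rw [mul_add]
  omega

/-- The plane spanned by `u`, `v` and `κ` meets the support in few points outside the line. -/
def Thin (F : Type) [Field F] [Fintype F] {V : Type} [AddCommGroup V] [Module F V] {p : ℕ}
    (f : V → ZMod p) (u v κ : V) : Prop :=
  κ ∉ Submodule.span F {u, v} ∧ ∑ c : F, cnt F f u (κ + c • v) ≤ 8 * Fintype.card F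

theorem Thin.congr {u v u' v' κ : V} (h : Ind F u v) (h' : Ind F u' v')
    (hs : Submodule.span F {u, v} = Submodule.span F {u', v'}) (ht : Thin F f u v κ) :
    Thin F f u' v' κ := by
  unfold Thin at *
  rwa [sum_cnt_span f h', ← hs, ← sum_cnt_span f h]

theorem Thin.add_mem {u v κ w : V} (h : Ind F u v) (hw : w ∈ Submodule.span F {u, v})
    (ht : Thin F f u v κ) : Thin F f u v (κ + w) := by
  refine ⟨fun hm => ht.1 ((Submodule.add_mem_iff_left _ hw).mp hm), le_trans (le_of_eq ?_) ht.2⟩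
  rw [sum_cnt_span f h, sum_cnt_span f h]
  refine Finset.card_bij (fun x _ => x + w) ?_ ?_ ?_
  · intro x hx
    simp only [Finset.mem_filter, Finset.mem_univ, true_and] at hx ⊢
    refine ⟨Submodule.add_mem _ hx.1 hw, ?_⟩
    convert hx.2 using 2
    abel_nf
  · intro x _ y _ hxy
    exact add_right_cancel hxy
  · intro x hx
    simp only [Finset.mem_filter, Finset.mem_univ, true_and] at hx
    refine ⟨x - w, ?_, sub_add_cancel x w⟩
    simp only [Finset.mem_filter, Finset.mem_univ, true_and]
    refine ⟨Submodule.sub_mem _ hx.1 hw, ?_⟩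
    convert hx.2 using 2
    abel_nf

theorem Sparse.covered_thin (S : Sparse F n f) {u v κ : V} (h : Ind F u v)
    (hκ : Thin F f u v κ) : Covered F 3 (fun w : F × F × F => f (pl u v κ w)) := by
  have h37 := S.le_card
  refine covered_three_plane h37 (lcode_comp _ S.mem) (by simp; ring)
    (S.gap.comp _ (pl_injective h hκ.1)) ?_
  rw [wtv_pl S.mem]
  refine Nat.mul_le_mul_left _ ?_
  have h1 : tot F f u v ≤ 𝔮 + 1 := by
    unfold tot
    have := cnt_le (F := F) f u v
    split_ifs <;> omega
  have := hκ.2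
  omega

theorem Sparse.card_thin (S : Sparse F n f) {u v : V} (h : Ind F u v) :
    𝔮 ^ (n + 4) ≤ 2 * (Finset.univ.filter fun κ => Thin F f u v κ).card + 2 * 𝔮 ^ 2 := by
  have h37 := S.le_card
  have hsum : ∑ κ : V, ∑ c : F, cnt F f u (κ + c • v) = 𝔮 * (𝔮 * nz f) := by
    rw [Finset.sum_comm, ← smul_eq_mul 𝔮, ← Finset.card_univ, ← Finset.sum_const]
    refine Finset.sum_congr rfl fun c _ => ?_
    rw [Finset.card_univ, ← sum_cnt (F := F) f u]
    exact Fintype.sum_equiv (Equiv.addRight (c • v)) _ _ fun κ => rfl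
  set Fat := Finset.univ.filter fun κ : V => 8 * 𝔮 < ∑ c : F, cnt F f u (κ + c • v) with hFat
  have hfat : Fat.card * (8 * 𝔮 + 1) ≤ 𝔮 * (𝔮 * nz f) := by
    rw [← hsum, ← smul_eq_mul, ← Finset.sum_const]
    refine (Finset.sum_le_sum fun κ hκ => ?_).trans
      (Finset.sum_le_sum_of_subset (Finset.subset_univ Fat))
    simp only [hFat, Finset.mem_filter] at hκ
    exact hκ.2
  have hcov : Fintype.card V ≤ (Finset.univ.filter fun κ => Thin F f u v κ).card + Fat.card +
      𝔮 ^ 2 := by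
    rw [← card_span_pair h, ← Finset.card_univ]
    refine (Finset.card_le_card fun κ _ => ?_).trans ((Finset.card_union_le _ _).trans
      (Nat.add_le_add_right (Finset.card_union_le _ _) _))
    by_cases h1 : κ ∈ Submodule.span F {u, v}
    · exact Finset.mem_union_right _ (Finset.mem_filter.mpr ⟨Finset.mem_univ _, h1⟩)
    · refine Finset.mem_union_left _ (Finset.mem_union.mpr ((le_or_gt (∑ c : F, cnt F f u (κ + c • v)) (8 * 𝔮)).imp
        (fun h2 => ?_) fun h2 => ?_))
      · exact Finset.mem_filter.mpr ⟨Finset.mem_univ _, h1, h2⟩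
      · exact Finset.mem_filter.mpr ⟨Finset.mem_univ _, h2⟩
  rw [S.card_space] at hcov
  have hnz : nz f ≤ (𝔮 - 1) * (4 * 𝔮 - 33) * 𝔮 ^ (n + 1) + 1 := by
    have := S.wtv_le
    rw [nz_eq]
    split_ifs <;> omega
  have h3 := hfat.trans (Nat.mul_le_mul_left _ (Nat.mul_le_mul_left _ hnz))
  have h4 : 2 * (𝔮 * (𝔮 * ((𝔮 - 1) * (4 * 𝔮 - 33) * 𝔮 ^ (n + 1) + 1))) ≤
      𝔮 ^ (n + 4) * (8 * 𝔮 + 1) := by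
    have e : 𝔮 ^ (n + 4) = 𝔮 ^ (n + 1) * 𝔮 ^ 3 := by ring
    rw [e]
    have hp : 1 ≤ 𝔮 ^ (n + 1) := Nat.one_le_pow _ _ (by omega)
    generalize 𝔮 ^ (n + 1) = m at *
    clear * - h37 hp
    generalize 𝔮 = k at *
    obtain ⟨k, rfl⟩ := Nat.exists_eq_add_of_le h37
    obtain ⟨m, rfl⟩ := Nat.exists_eq_add_of_le hp
    have e1 : 37 + k - 1 = 36 + k := by omega
    have e2 : 4 * (37 + k) - 33 = 115 + 4 * k := by omega
    rw [e1, e2]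
    ring_nf
    nlinarith [Nat.zero_le (m * k), Nat.zero_le (m * k ^ 2), Nat.zero_le (m * k ^ 3),
      Nat.zero_le (m * k ^ 4), Nat.zero_le (k ^ 2), Nat.zero_le (k ^ 3), Nat.zero_le (k ^ 4)]
  have h5 : 2 * Fat.card ≤ 𝔮 ^ (n + 4) := by
    refine Nat.le_of_mul_le_mul_right (c := 8 * 𝔮 + 1) ?_ (by omega)
    rw [mul_assoc]
    exact (Nat.mul_le_mul_left 2 h3).trans h4
  omega

theorem Sparse.exists_thin (S : Sparse F n f) {u v : V} (h : Ind F u v) :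
    ∃ κ, Thin F f u v κ := by
  have h37 := S.le_card
  have h1 := S.card_thin h
  by_contra! hn
  simp only [hn, Finset.filter_false, Finset.card_empty, mul_zero, zero_add] at h1
  have : 𝔮 ^ (n + 4) = 𝔮 ^ n * 𝔮 ^ 2 * 𝔮 ^ 2 := by ring
  have h3 : 1 ≤ 𝔮 ^ n := Nat.one_le_pow _ _ (by omega)
  have h4 : 37 ≤ 𝔮 ^ 2 := by nlinarith
  nlinarith [Nat.mul_le_mul h3 h4]

end Thin

section NoForm

variable {V : Type} [AddCommGroup V] [Module F V] {p : ℕ} [Fintype F] [Fact p.Prime]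
  [Algebra (ZMod p) F] {f : V → ZMod p} [Fintype V] {n : ℕ}

/-- A cover of the plane of a thin vector by three lines, in coordinates. -/
theorem Sparse.exists_cover (S : Sparse F n f) {u v κ : V} (h : Ind F u v)
    (hκ : Thin F f u v κ) : ∃ φ : Fin 3 → Module.Dual F (F × F × F), (∀ i, φ i ≠ 0) ∧
      (∀ x y z : F, (x ≠ 0 ∨ y ≠ 0 ∨ z ≠ 0) → f (x • u + y • v + z • κ) ≠ 0 →
        ∃ i, φ i (x, y, z) = 0) ∧
      ∀ y z : F, (y ≠ 0 ∨ z ≠ 0) → 4 ≤ tot F f u (y • v + z • κ) →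
        ∃ i, φ i (1, 0, 0) = 0 ∧ φ i (0, y, z) = 0 := by
  obtain ⟨φ, h1, h2⟩ := S.covered_thin h hκ
  refine ⟨φ, h1, fun x y z hxyz hf => h2 (x, y, z) ?_ hf, fun y z hyz ht => ?_⟩
  · simp only [ne_eq, Prod.mk_eq_zero]
    tauto
  · refine exists_cover_line h2 (fun a b hab => ?_) (by rwa [tot_pl])
    simp only [Prod.smul_mk, smul_eq_mul, mul_one, mul_zero, Prod.mk_add_mk, add_zero, zero_add,
      Prod.mk_eq_zero, mul_eq_zero] at hab
    tauto

/-- A form whose nonvanishing forces long lines through `R` is zero. -/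
theorem Sparse.form_eq_zero (S : Sparse F n f) {R : V} {g : V → F} {m : ℕ} (hg : IsForm m g)
    (hlong : ∀ v, g v ≠ 0 → Ind F R v ∧ 4 ≤ tot F f R v)
    (hm : m + 3 ≤ 𝔮 ∨ m + 2 ≤ 𝔮 ∧ ∀ v, 1 ≤ cnt F f R v) (v : V) : g v = 0 := by
  by_contra hv
  obtain ⟨hI, ht⟩ := hlong v hv
  obtain ⟨κ, hκ⟩ := S.exists_thin hI
  obtain ⟨φ, h1, h2, h3⟩ := S.exists_cover hI hκ
  have hext : ∀ i, ∀ t s : F, t ≠ s → φ i (1, 0, 0) = 0 → φ i (0, t, 1) = 0 →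
      φ i (0, s, 1) = 0 → False := by
    intro i t s hts e1 e2 e3
    apply h1 i
    have e4 : φ i (0, 1, 0) = 0 := by
      have : ((0, 1, 0) : F × F × F) = (t - s)⁻¹ • ((0, t, 1) - (0, s, 1)) := by
        simp [sub_ne_zero.mpr hts]
      rw [this, map_smul, map_sub, e2, e3]; simp
    ext
    · exact e1
    · exact e4
    · have : ((0, 0, 1) : F × F × F) = (0, t, 1) - t • (0, 1, 0) := by simp
      simp only [LinearMap.comp_apply, LinearMap.inr_apply, LinearMap.zero_apply]
      rw [this, map_sub, map_smul, e2, e4]; simp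
  have hext' : ∀ i, ∀ t : F, φ i (1, 0, 0) = 0 → φ i (0, 1, 0) = 0 → φ i (0, t, 1) = 0 →
      False := by
    intro i t e1 e2 e3
    refine hext i t (t + 1) (by simp) e1 e3 ?_
    have : ((0, t + 1, 1) : F × F × F) = (0, t, 1) + (0, 1, 0) := by simp
    rw [this, map_add, e2, e3, add_zero]
  obtain ⟨i₀, hi1, hi2⟩ := h3 1 0 (Or.inl one_ne_zero) (by simpa using ht)
  set T' := Finset.univ.filter fun t : F => ∃ i, φ i (1, 0, 0) = 0 ∧ φ i (0, t, 1) = 0 with hT'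
  have hex : ∀ t : F, ∃ i, t ∈ T' → φ i (1, 0, 0) = 0 ∧ φ i (0, t, 1) = 0 := by
    intro t
    by_cases ht : t ∈ T'
    · obtain ⟨i, hi⟩ := (Finset.mem_filter.mp ht).2
      exact ⟨i, fun _ => hi⟩
    · exact ⟨i₀, fun h => absurd h ht⟩
  choose idx hidx using hex
  have hmaps : ∀ t ∈ T', idx t ∈ Finset.univ.erase i₀ := fun t ht =>
    Finset.mem_erase.mpr ⟨fun h => hext' i₀ t hi1 hi2 (h ▸ (hidx t ht).2), Finset.mem_univ _⟩
  have hinj : Set.InjOn idx T' := fun t ht s hs hts => by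
    by_contra hne
    exact hext (idx t) t s hne (hidx t ht).1 (hidx t ht).2 (hts ▸ (hidx s hs).2)
  have hcard2 : (Finset.univ.erase i₀ : Finset (Fin 3)).card = 2 := by
    rw [Finset.card_erase_of_mem (Finset.mem_univ _)]
    simp
  have hT2 : T'.card ≤ 2 := hcard2 ▸ Finset.card_le_card_of_injOn idx hmaps hinj
  have hT : 𝔮 - m ≤ T'.card := by
    refine (hg.line_nonzeros hv κ).trans (Finset.card_le_card fun t ht' => ?_)
    simp only [Finset.mem_filter, Finset.mem_univ, true_and] at ht'
    refine Finset.mem_filter.mpr ⟨Finset.mem_univ _, h3 t 1 (Or.inr one_ne_zero) ?_⟩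
    have := (hlong _ ht').2
    rwa [one_smul, add_comm]
  rcases hm with hm | ⟨hm, hc⟩
  · omega
  · have himg : T'.image idx = Finset.univ.erase i₀ :=
      Finset.eq_of_subset_of_card_le (Finset.image_subset_iff.mpr hmaps)
        (by rw [Finset.card_image_of_injOn hinj]; omega)
    have hall : ∀ i, φ i (1, 0, 0) = 0 := by
      intro i
      by_cases hi : i = i₀
      · rw [hi, hi1]
      · obtain ⟨t, ht, rfl⟩ := Finset.mem_image.mp
          (himg ▸ Finset.mem_erase.mpr ⟨hi, Finset.mem_univ i⟩)
        exact (hidx t ht).1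
    have huniv : T' = Finset.univ := by
      ext t
      simp only [Finset.mem_univ, iff_true, hT', Finset.mem_filter, true_and]
      have h0 := hc (κ + t • v)
      unfold cnt at h0
      obtain ⟨x, hx⟩ := Finset.card_pos.mp h0
      simp only [Finset.mem_filter, Finset.mem_univ, true_and] at hx
      obtain ⟨i, hi⟩ := h2 x t 1 (Or.inr (Or.inr one_ne_zero))
        (by rwa [one_smul, add_assoc, add_comm (t • v)])
      refine ⟨i, hall i, ?_⟩
      have : ((0, t, 1) : F × F × F) = (x, t, 1) - x • (1, 0, 0) := by simp
      rw [this, map_sub, map_smul, hi, hall i]; simp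
    rw [huniv, Finset.card_univ] at hT2
    have := S.le_card
    omega

end NoForm

section Centers

variable {V : Type} [AddCommGroup V] [Module F V] {p : ℕ} [Fintype F] [Fact p.Prime]
  [Algebra (ZMod p) F] {f : V → ZMod p}

/-- A center of a word: the moments in this direction vanish except possibly the last two, i.e.
the word is affine along each affine line in this direction. -/
def Ctr (F : Type) [Field F] [Fintype F] {V : Type} [AddCommGroup V] [Module F V] {p : ℕ}
    [Fact p.Prime] [Algebra (ZMod p) F] (f : V → ZMod p) (R : V) : Prop :=
  ∀ m, m + 2 < Fintype.card F → ∀ v, mom (F := F) f R m v = 0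

theorem Ctr.affine {R : V} (h : Ctr F f R) (h3 : 3 ≤ 𝔮) (v : V) :
    ∃ a b : F, ∀ x : F, algebraMap (ZMod p) F (f (x • R + v)) = a + b * x :=
  ⟨-mom f R (𝔮 - 1) v, -mom f R (𝔮 - 2) v, fun x => by
    rw [affine_of_mom h3 (fun j hj => h j (by omega) v)]; ring⟩

theorem Ctr.apply_eq {R : V} (h : Ctr F f R) (h3 : 3 ≤ 𝔮) (hf : f ∈ lcode F p V) :
    f 0 = f R := by
  have := h 0 (by omega) 0
  rw [mom_zero hf, map_eq_zero_iff _ (algebraMap (ZMod p) F).injective, sub_eq_zero] at this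
  exact this

theorem mom_of_quadratic {R v : V} {a b c : F}
    (h : ∀ x : F, algebraMap (ZMod p) F (f (x • R + v)) = a + b * x + c * x ^ 2) {m : ℕ}
    (hm : m + 3 < 𝔮) : mom (F := F) f R m v = 0 := by
  unfold mom
  have : ∀ x : F, algebraMap (ZMod p) F (f (x • R + v)) * x ^ m =
      a * x ^ m + b * x ^ (m + 1) + c * x ^ (m + 2) := fun x => by rw [h]; ring
  simp only [this, Finset.sum_add_distrib, ← Finset.mul_sum]
  rw [FiniteField.sum_pow_lt_card_sub_one, FiniteField.sum_pow_lt_card_sub_one,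
    FiniteField.sum_pow_lt_card_sub_one]
  · ring
  all_goals omega

theorem mom_of_affine {R v : V} {a b : F}
    (h : ∀ x : F, algebraMap (ZMod p) F (f (x • R + v)) = a + b * x) {m : ℕ}
    (hm : m + 2 < 𝔮) : mom (F := F) f R m v = 0 := by
  unfold mom
  have : ∀ x : F, algebraMap (ZMod p) F (f (x • R + v)) * x ^ m =
      a * x ^ m + b * x ^ (m + 1) := fun x => by rw [h]; ring
  simp only [this, Finset.sum_add_distrib, ← Finset.mul_sum]
  rw [FiniteField.sum_pow_lt_card_sub_one, FiniteField.sum_pow_lt_card_sub_one]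
  · ring
  all_goals omega

theorem ctr_zero : Ctr F f 0 := fun m hm v =>
  mom_of_affine (a := algebraMap (ZMod p) F (f v)) (b := 0) (fun x => by simp) hm

theorem Ctr.smul {R : V} (h : Ctr F f R) (h3 : 3 ≤ 𝔮) (μ : F) : Ctr F f (μ • R) := fun m hm v => by
  obtain ⟨a, b, hab⟩ := h.affine h3 v
  exact mom_of_affine (a := a) (b := b * μ) (fun x => by rw [smul_smul, hab]; ring) hm

variable [Fintype V] {n : ℕ}

theorem Sparse.ctr_of_low (S : Sparse F n f) {R : V}
    (h : ∀ m < 3, ∀ v, mom (F := F) f R m v = 0) : Ctr F f R := by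
  have h37 := S.le_card
  rcases eq_or_ne R 0 with rfl | hR
  · exact ctr_zero
  have hS : f 0 = f R := by
    have := h 0 (by norm_num) 0
    rwa [mom_zero S.mem, map_eq_zero_iff _ (algebraMap (ZMod p) F).injective, sub_eq_zero] at this
  intro m
  induction m using Nat.strong_induction_on with
  | h m ih =>
    intro hm
    rcases lt_or_ge m 3 with h3 | h3
    · exact h m h3
    refine S.form_eq_zero (mom_isForm S.mem R (by omega)) (fun v hv => ?_) (Or.inl (by omega))
      (R := R)
    refine ⟨ind_of_notMem hR fun hmem => hv (mom_span S.mem hS (by omega) hmem), ?_⟩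
    have := cnt_ge_of_mom (fun j hj => ih j hj (by omega) v) hv
    unfold tot
    omega

theorem Sparse.ctr_add (S : Sparse F n f) {R R' : V} (h : Ctr F f R) (h' : Ctr F f R') :
    Ctr F f (R + R') := by
  have h37 := S.le_card
  refine S.ctr_of_low fun m hm v => ?_
  obtain ⟨a, b, hab⟩ := h.affine (by omega) v
  obtain ⟨a₀, b₀, h0⟩ := h'.affine (by omega) v
  obtain ⟨a₁, b₁, h1⟩ := h'.affine (by omega) (R + v)
  refine mom_of_quadratic (a := a₀) (b := b₀ + (a₁ - a₀)) (c := b₁ - b₀) (fun t => ?_) (by omega)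
  obtain ⟨a₂, b₂, h2⟩ := h.affine (by omega) (t • R' + v)
  have e0 := h2 0
  have e1 := h2 1
  have e2 := h2 t
  rw [zero_smul, zero_add, h0] at e0
  rw [one_smul, ← add_assoc, add_comm R, add_assoc, h1] at e1
  rw [smul_add, add_assoc, e2]
  linear_combination t * e0 - t * e1 - e0

/-- The subspace of centers. -/
def Sparse.centers (S : Sparse F n f) : Submodule F V where
  carrier := {R | Ctr F f R}
  zero_mem' := ctr_zero
  add_mem' := S.ctr_add
  smul_mem' μ _ h := h.smul (by have := S.le_card; omega) μ

theorem Sparse.mem_centers (S : Sparse F n f) {R : V} : R ∈ S.centers ↔ Ctr F f R := Iff.rfl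

end Centers

section PlaneStructure

variable {V : Type} [AddCommGroup V] [Module F V] {p : ℕ} [Fintype F] [Fact p.Prime]
  [Algebra (ZMod p) F] {f : V → ZMod p} [Fintype V]

theorem exists_off_cover {t : ℕ} (ht : t < 𝔮) {φ : Fin t → Module.Dual F V} (hφ : ∀ i, φ i ≠ 0) :
    ∃ y, ∀ i, φ i y ≠ 0 := by
  by_contra! h
  have h1 : Fintype.card V ≤ ∑ i, (Finset.univ.filter fun v : V => φ i v = 0).card := by
    rw [← Finset.card_univ]
    refine (Finset.card_le_card fun v _ => ?_).trans Finset.card_biUnion_le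
    obtain ⟨i, hi⟩ := h v
    exact Finset.mem_biUnion.mpr ⟨i, Finset.mem_univ _, Finset.mem_filter.mpr ⟨Finset.mem_univ _, hi⟩⟩
  have h2 := Nat.mul_le_mul_left 𝔮 h1
  rw [Finset.mul_sum, Finset.sum_congr rfl fun i _ => card_ker_dual (hφ i)] at h2
  simp only [Finset.sum_const, Finset.card_univ, Fintype.card_fin, smul_eq_mul] at h2
  have : 0 < Fintype.card V := Fintype.card_pos_iff.mpr ⟨0⟩
  have := Nat.le_of_mul_le_mul_right h2 this
  omega

/-- A common point of three covering hyperplanes is a center. -/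
theorem ctr_of_concurrent (h4 : 4 ≤ 𝔮) (hf : f ∈ lcode F p V) {φ : Fin 3 → Module.Dual F V}
    (hφ : ∀ i, φ i ≠ 0) (hcov : ∀ v, v ≠ 0 → f v ≠ 0 → ∃ i, φ i v = 0) {O : V}
    (hO : ∀ i, φ i O = 0) : Ctr F f O := by
  intro m hm v
  by_contra hv
  have hg : ∀ w, mom (F := F) f O m w ≠ 0 → ∃ i, φ i w = 0 := by
    intro w hw
    by_contra! hc
    refine hw (Finset.sum_eq_zero fun x _ => ?_)
    have : f (x • O + w) = 0 := by
      by_contra hne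
      obtain ⟨i, hi⟩ := hcov (x • O + w) (fun h0 => hc 0 (by
        have := congrArg (φ 0) h0
        simpa [hO] using this)) hne
      exact hc i (by simpa [hO] using hi)
    simp [this]
  obtain ⟨y, hy⟩ := exists_off_cover (t := 3) (by omega) hφ
  obtain ⟨j, hj⟩ := hg v hv
  have hlow := (mom_isForm hf O (show m + 1 < 𝔮 by omega)).line_nonzeros hv y
  have hup : (Finset.univ.filter fun t : F => mom (F := F) f O m (y + t • v) ≠ 0).card ≤ 2 := by
    calc _ ≤ ((Finset.univ.erase j).biUnion fun i =>
          Finset.univ.filter fun t : F => φ i (y + t • v) = 0).card := by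
          refine Finset.card_le_card fun t ht => ?_
          obtain ⟨i, hi⟩ := hg _ (Finset.mem_filter.mp ht).2
          refine Finset.mem_biUnion.mpr ⟨i, Finset.mem_erase.mpr ⟨?_, Finset.mem_univ _⟩,
            Finset.mem_filter.mpr ⟨Finset.mem_univ _, hi⟩⟩
          rintro rfl
          exact hy i (by simpa [hj] using hi)
      _ ≤ ∑ i ∈ Finset.univ.erase j, 1 := Finset.card_biUnion_le.trans <|
          Finset.sum_le_sum fun i _ => Finset.card_le_one.mpr fun a ha b hb => by
            simp only [Finset.mem_filter, Finset.mem_univ, true_and, map_add, map_smul,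
              smul_eq_mul] at ha hb
            have hne : φ i v ≠ 0 := fun h => hy i (by simpa [h] using ha)
            exact mul_right_cancel₀ hne (by linear_combination ha - hb)
      _ = 2 := by
          rw [Finset.sum_const, Finset.card_erase_of_mem (Finset.mem_univ _)]
          simp
  omega

/-- If the support on a pencil of lines is covered by two linear equations, one of which does not
involve the line parameter, then at most two lines contain more than one support point. -/
theorem card_heavy_le {a₁ b₁ c₁ a₂ b₂ c₂ : F} {g : F → F → Prop} (ha : a₁ = 0 ∨ a₂ = 0)
    (h1 : a₁ ≠ 0 ∨ b₁ ≠ 0 ∨ c₁ ≠ 0) (h2 : a₂ ≠ 0 ∨ b₂ ≠ 0 ∨ c₂ ≠ 0)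
    (hg : ∀ c x, g c x → a₁ * x + b₁ * c + c₁ = 0 ∨ a₂ * x + b₂ * c + c₂ = 0) :
    (Finset.univ.filter fun c => 2 ≤ (Finset.univ.filter fun x => g c x).card).card ≤ 2 := by
  have hone : ∀ a b c : F, (a ≠ 0 ∨ b ≠ 0 ∨ c ≠ 0) →
      (Finset.univ.filter fun x : F => a = 0 ∧ b * x + c = 0).card ≤ 1 := by
    intro a b c h
    refine Finset.card_le_one.mpr fun x hx y hy => ?_
    simp only [Finset.mem_filter, Finset.mem_univ, true_and] at hx hy
    have hb : b ≠ 0 := by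
      rintro rfl
      simp only [zero_mul, zero_add] at hx
      tauto
    exact mul_left_cancel₀ hb (by linear_combination hx.2 - hy.2)
  have hsub : (Finset.univ.filter fun c => 2 ≤ (Finset.univ.filter fun x => g c x).card) ⊆
      (Finset.univ.filter fun x : F => a₁ = 0 ∧ b₁ * x + c₁ = 0) ∪
      (Finset.univ.filter fun x : F => a₂ = 0 ∧ b₂ * x + c₂ = 0) := by
    intro c hc
    simp only [Finset.mem_filter, Finset.mem_univ, true_and, Finset.mem_union] at hc ⊢
    by_contra! hn
    have : (Finset.univ.filter fun x => g c x).card ≤ 1 := by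
      refine Finset.card_le_one.mpr fun x hx y hy => ?_
      simp only [Finset.mem_filter, Finset.mem_univ, true_and] at hx hy
      have hx := hg c x hx
      have hy := hg c y hy
      by_cases h1 : a₁ = 0
      · have hn1 := hn.1 h1
        simp only [h1, zero_mul, zero_add, hn1, false_or] at hx hy
        by_cases h2 : a₂ = 0
        · simp only [h2, zero_mul, zero_add, hn.2 h2] at hx
        · exact mul_left_cancel₀ h2 (by linear_combination hx - hy)
      · have h2 : a₂ = 0 := ha.resolve_left h1
        simp only [h2, zero_mul, zero_add, hn.2 h2, or_false] at hx hy
        exact mul_left_cancel₀ h1 (by linear_combination hx - hy)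
    omega
  have := (Finset.card_le_card hsub).trans (Finset.card_union_le _ _)
  have := hone a₁ b₁ c₁ h1
  have := hone a₂ b₂ c₂ h2
  omega

theorem Ind.det_ne_zero {u v : V} {r₁ r₂ s₁ s₂ : F}
    (h : Ind F (r₁ • u + r₂ • v) (s₁ • u + s₂ • v)) : r₁ * s₂ - r₂ * s₁ ≠ 0 := by
  intro hD
  have h1 := h s₂ (-r₂) (by
    have : s₂ • (r₁ • u + r₂ • v) + -r₂ • (s₁ • u + s₂ • v) = (r₁ * s₂ - r₂ * s₁) • u := by module
    rw [this, hD, zero_smul])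
  have h2 := h s₁ (-r₁) (by
    have : s₁ • (r₁ • u + r₂ • v) + -r₁ • (s₁ • u + s₂ • v) = -(r₁ * s₂ - r₂ * s₁) • v := by module
    rw [this, hD, neg_zero, zero_smul])
  refine h.left_ne ?_
  rw [neg_eq_zero.mp h1.2, neg_eq_zero.mp h2.2]
  simp

end PlaneStructure

section ThinPlanes

variable {V : Type} [AddCommGroup V] [Module F V] {p : ℕ} [Fintype F] [Fact p.Prime]
  [Algebra (ZMod p) F] {f : V → ZMod p} [Fintype V] {n : ℕ}

/-- At most two lines through `R` in the plane spanned by `R`, `s`, `κ`, other than the line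
spanned by `R` and `s`, contain more than one point of the support. -/
def Focus (F : Type) [Field F] [Fintype F] {V : Type} [AddCommGroup V] [Module F V] {p : ℕ}
    (f : V → ZMod p) (R s κ : V) : Prop :=
  (Finset.univ.filter fun c : F => 2 ≤ cnt F f R (κ + c • s)).card ≤ 2

theorem dual_triple (ψ : Module.Dual F (F × F × F)) (x y z : F) :
    ψ (x, y, z) = x * ψ (1, 0, 0) + y * ψ (0, 1, 0) + z * ψ (0, 0, 1) := by
  have : ((x, y, z) : F × F × F) = x • (1, 0, 0) + y • (0, 1, 0) + z • (0, 0, 1) := by simp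
  conv_lhs => rw [this]
  simp only [map_add, map_smul, smul_eq_mul]

theorem dual_triple_ne_zero {ψ : Module.Dual F (F × F × F)} (hψ : ψ ≠ 0) {r₁ r₂ s₁ s₂ : F}
    (hD : r₁ * s₂ - r₂ * s₁ ≠ 0) :
    ψ (r₁, r₂, 0) ≠ 0 ∨ ψ (s₁, s₂, 0) ≠ 0 ∨ ψ (0, 0, 1) ≠ 0 := by
  by_contra! h
  obtain ⟨h1, h2, h3⟩ := h
  rw [dual_triple] at h1 h2
  have e1 : ψ (1, 0, 0) = 0 := by
    refine (mul_eq_zero.mp (?_ : (r₁ * s₂ - r₂ * s₁) * _ = 0)).resolve_left hD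
    linear_combination s₂ * h1 - r₂ * h2
  have e2 : ψ (0, 1, 0) = 0 := by
    refine (mul_eq_zero.mp (?_ : (r₁ * s₂ - r₂ * s₁) * _ = 0)).resolve_left hD
    linear_combination r₁ * h2 - s₁ * h1
  refine hψ (LinearMap.ext fun ⟨x, y, z⟩ => ?_)
  rw [dual_triple, e1, e2, h3]
  simp

theorem focus_of_cover {u v κ : V} {ψ₁ ψ₂ : Module.Dual F (F × F × F)} (h1 : ψ₁ ≠ 0) (h2 : ψ₂ ≠ 0)
    (hcov : ∀ x y : F, f (x • u + y • v + κ) ≠ 0 → ψ₁ (x, y, 1) = 0 ∨ ψ₂ (x, y, 1) = 0)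
    {r₁ r₂ s₁ s₂ : F} (h : Ind F (r₁ • u + r₂ • v) (s₁ • u + s₂ • v))
    (hr : ψ₁ (r₁, r₂, 0) = 0 ∨ ψ₂ (r₁, r₂, 0) = 0) :
    Focus F f (r₁ • u + r₂ • v) (s₁ • u + s₂ • v) κ := by
  have key := card_heavy_le
    (g := fun c x => f (x • (r₁ • u + r₂ • v) + (κ + c • (s₁ • u + s₂ • v))) ≠ 0) hr
    (dual_triple_ne_zero h1 h.det_ne_zero) (dual_triple_ne_zero h2 h.det_ne_zero)
  unfold Focus cnt
  convert key fun c x hcx => ?_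
  have := hcov (x * r₁ + c * s₁) (x * r₂ + c * s₂) (by
    convert hcx using 2
    module)
  rw [dual_triple ψ₁, dual_triple ψ₂] at this
  rw [dual_triple ψ₁ r₁, dual_triple ψ₂ r₁, dual_triple ψ₁ s₁, dual_triple ψ₂ s₁]
  refine this.imp (fun h => ?_) fun h => ?_ <;> linear_combination h

theorem Sparse.thin_cases (S : Sparse F n f) {u v κ : V} (h : Ind F u v) (ht : 4 ≤ tot F f u v)
    (hκ : Thin F f u v κ) :
    (∃ lam : ZMod p, ∀ r₁ r₂ s₁ s₂ : F, Ind F (r₁ • u + r₂ • v) (s₁ • u + s₂ • v) →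
      (Finset.univ.filter fun x : F =>
        f (x • (r₁ • u + r₂ • v) + (s₁ • u + s₂ • v)) ≠ lam).card ≤ 2 ∧
      (f (r₁ • u + r₂ • v) ≠ lam → Focus F f (r₁ • u + r₂ • v) (s₁ • u + s₂ • v) κ)) ∨
    ∃ o₁ o₂ : F, (o₁ ≠ 0 ∨ o₂ ≠ 0) ∧
      (∀ w₁ w₂ : F, ∃ a b : F, ∀ x : F,
        algebraMap (ZMod p) F (f (x • (o₁ • u + o₂ • v) + (w₁ • u + w₂ • v))) = a + b * x) ∧
      ∀ s₁ s₂ : F, Ind F (o₁ • u + o₂ • v) (s₁ • u + s₂ • v) →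
        Focus F f (o₁ • u + o₂ • v) (s₁ • u + s₂ • v) κ := by
  have h37 := S.le_card
  obtain ⟨φ, hφ, hcov, hlong⟩ := S.exists_cover h hκ
  obtain ⟨i₀, hi1, hi2⟩ := hlong 1 0 (Or.inl one_ne_zero) (by simpa using ht)
  obtain ⟨i₁, i₂, hi, hne1, hne2⟩ : ∃ i₁ i₂ : Fin 3, (∀ i, i = i₀ ∨ i = i₁ ∨ i = i₂) ∧ i₁ ≠ i₀ ∧
      i₂ ≠ i₀ := by
    clear hi1 hi2; revert i₀; decide
  obtain ⟨ψ₁, hψ₁⟩ : ∃ ψ, ψ = φ i₁ := ⟨_, rfl⟩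
  obtain ⟨ψ₂, hψ₂⟩ : ∃ ψ, ψ = φ i₂ := ⟨_, rfl⟩
  have hn1 : ψ₁ ≠ 0 := hψ₁ ▸ hφ i₁
  have hn2 : ψ₂ ≠ 0 := hψ₂ ▸ hφ i₂
  have hz : ∀ x y z : F, φ i₀ (x, y, z) = z * φ i₀ (0, 0, 1) := fun x y z => by
    rw [dual_triple, hi1, hi2]; ring
  have hd : φ i₀ (0, 0, 1) ≠ 0 := fun h0 => hφ i₀ (LinearMap.ext fun ⟨x, y, z⟩ => by
    rw [hz, h0]; simp)
  have hcov' : ∀ x y : F, f (x • u + y • v + κ) ≠ 0 → ψ₁ (x, y, 1) = 0 ∨ ψ₂ (x, y, 1) = 0 := by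
    intro x y hxy
    obtain ⟨i, hi0⟩ := hcov x y 1 (Or.inr (Or.inr one_ne_zero)) (by rwa [one_smul])
    rcases hi i with rfl | rfl | rfl
    · rw [hz, one_mul] at hi0
      exact absurd hi0 hd
    · exact Or.inl (hψ₁ ▸ hi0)
    · exact Or.inr (hψ₂ ▸ hi0)
  have hmem : (fun w : F × F × F => f (pl u v κ w)) ∈ lcode F p (F × F × F) := lcode_comp _ S.mem
  have hcovpl : ∀ w : F × F × F, w ≠ 0 → f (pl u v κ w) ≠ 0 → ∃ i, φ i w = 0 := by
    rintro ⟨x, y, z⟩ hw hf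
    refine hcov x y z ?_ hf
    by_contra! hc
    exact hw (by rw [hc.1, hc.2.1, hc.2.2]; rfl)
  by_cases hK : ∃ o₁ o₂ : F, (o₁ ≠ 0 ∨ o₂ ≠ 0) ∧ ψ₁ (o₁, o₂, 0) = 0 ∧ ψ₂ (o₁, o₂, 0) = 0
  · right
    obtain ⟨o₁, o₂, ho, ho1, ho2⟩ := hK
    refine ⟨o₁, o₂, ho, fun w₁ w₂ => ?_, fun s₁ s₂ hs => focus_of_cover hn1 hn2 hcov' hs (Or.inl ho1)⟩
    have hctr := ctr_of_concurrent (O := ((o₁, o₂, 0) : F × F × F)) (by omega) hmem hφ hcovpl (by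
      intro i
      rcases hi i with rfl | rfl | rfl
      · rw [hz, zero_mul]
      · exact hψ₁ ▸ ho1
      · exact hψ₂ ▸ ho2)
    obtain ⟨a, b, hab⟩ := hctr.affine (by omega) (w₁, w₂, 0)
    refine ⟨a, b, fun x => ?_⟩
    rw [← hab x]
    simp only [Prod.smul_mk, Prod.mk_add_mk, pl_apply, smul_eq_mul]
    congr 2
    module
  · left
    push Not at hK
    obtain ⟨A₁, hA₁⟩ : ∃ A, A = ψ₁ (1, 0, 0) := ⟨_, rfl⟩
    obtain ⟨B₁, hB₁⟩ : ∃ A, A = ψ₁ (0, 1, 0) := ⟨_, rfl⟩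
    obtain ⟨C₁, hC₁⟩ : ∃ A, A = ψ₁ (0, 0, 1) := ⟨_, rfl⟩
    obtain ⟨A₂, hA₂⟩ : ∃ A, A = ψ₂ (1, 0, 0) := ⟨_, rfl⟩
    obtain ⟨B₂, hB₂⟩ : ∃ A, A = ψ₂ (0, 1, 0) := ⟨_, rfl⟩
    obtain ⟨C₂, hC₂⟩ : ∃ A, A = ψ₂ (0, 0, 1) := ⟨_, rfl⟩
    obtain ⟨d, hd'⟩ : ∃ A, A = φ i₀ (0, 0, 1) := ⟨_, rfl⟩
    rw [← hd'] at hd hz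
    have e1 : ∀ x y z, ψ₁ (x, y, z) = x * A₁ + y * B₁ + z * C₁ := fun x y z => by
      rw [dual_triple, hA₁, hB₁, hC₁]
    have e2 : ∀ x y z, ψ₂ (x, y, z) = x * A₂ + y * B₂ + z * C₂ := fun x y z => by
      rw [dual_triple, hA₂, hB₂, hC₂]
    have hdet : A₁ * B₂ - B₁ * A₂ ≠ 0 := by
      intro hdet
      have k1 := hK B₁ (-A₁)
      have k2 := hK B₂ (-A₂)
      simp only [e1, e2] at k1 k2
      have z1 : B₁ = 0 ∧ A₁ = 0 := by
        by_contra hc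
        exact k1 (by by_contra! h; exact hc ⟨h.1, by simpa using h.2⟩) (by ring)
          (by linear_combination -hdet)
      have z2 : B₂ = 0 ∧ A₂ = 0 := by
        by_contra hc
        exact k2 (by by_contra! h; exact hc ⟨h.1, by simpa using h.2⟩)
          (by linear_combination hdet) (by ring)
      have k3 := hK 1 0 (Or.inl one_ne_zero)
      simp only [e1, e2, z1.1, z1.2, z2.1, z2.2] at k3
      simp at k3
    set D := A₁ * B₂ - B₁ * A₂ with hD
    obtain ⟨μ₁, μ₂, μ₀, hμ⟩ := eq_of_independent_cover (by omega) hmem (φ₁ := ψ₁) (φ₂ := ψ₂)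
      (φ₃ := φ i₀) (e₁ := (B₂ / D, -A₂ / D, 0)) (e₂ := (-B₁ / D, A₁ / D, 0))
      (e₃ := ((B₁ * C₂ - B₂ * C₁) / D / d, (A₂ * C₁ - A₁ * C₂) / D / d, 1 / d))
      (by rw [e1]; field_simp; rw [hD]; ring) (by rw [e1]; field_simp; ring)
      (by rw [e1]; field_simp; rw [hD]; ring) (by rw [e2]; field_simp; ring)
      (by rw [e2]; field_simp; rw [hD]; ring) (by rw [e2]; field_simp; rw [hD]; ring)
      (by rw [hz, zero_mul]) (by rw [hz, zero_mul]) (by rw [hz]; field_simp)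
      (fun w hw hf => by
        obtain ⟨i, hi0⟩ := hcovpl w hw hf
        rcases hi i with rfl | rfl | rfl
        · exact Or.inr (Or.inr hi0)
        · exact Or.inl (hψ₁ ▸ hi0)
        · exact Or.inr (Or.inl (hψ₂ ▸ hi0)))
    have hval : ∀ x y : F, f (x • u + y • v) ≠ μ₀ → ψ₁ (x, y, 0) = 0 ∨ ψ₂ (x, y, 0) = 0 := by
      intro x y hxy
      by_contra! hc
      apply hxy
      have := hμ (x, y, 0)
      rw [pl_apply, zero_smul, add_zero] at this
      rw [this]
      simp [hyp, hc.1, hc.2, hz]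
    refine ⟨μ₀, fun r₁ r₂ s₁ s₂ hrs => ⟨?_, fun hr => focus_of_cover hn1 hn2 hcov' hrs (hval _ _ hr)⟩⟩
    have hdet2 := hrs.det_ne_zero
    have hsub : ∀ (a b a' b' : F), a * b' - b * a' ≠ 0 → ∀ P Q : F, (P ≠ 0 ∨ Q ≠ 0) →
        (Finset.univ.filter fun x : F => (x * a + a') * P + (x * b + b') * Q = 0).card ≤ 1 := by
      intro a b a' b' hdet P Q hPQ
      refine Finset.card_le_one.mpr fun x hx y hy => ?_
      simp only [Finset.mem_filter, Finset.mem_univ, true_and] at hx hy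
      have hne : a * P + b * Q ≠ 0 := by
        intro h0
        have h0' : a' * P + b' * Q = 0 := by linear_combination hx - x * h0
        have hP : (a * b' - b * a') * P = 0 := by linear_combination b' * h0 - b * h0'
        have hQ : (a * b' - b * a') * Q = 0 := by linear_combination a * h0' - a' * h0
        rcases hPQ with h | h
        · exact h ((mul_eq_zero.mp hP).resolve_left hdet)
        · exact h ((mul_eq_zero.mp hQ).resolve_left hdet)
      exact mul_right_cancel₀ hne (by linear_combination hx - hy)
    calc _ ≤ ((Finset.univ.filter fun x : F => (x * r₁ + s₁) * A₁ + (x * r₂ + s₂) * B₁ = 0) ∪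
          Finset.univ.filter fun x : F => (x * r₁ + s₁) * A₂ + (x * r₂ + s₂) * B₂ = 0).card := by
          refine Finset.card_le_card fun x hx => ?_
          simp only [Finset.mem_filter, Finset.mem_univ, true_and, Finset.mem_union] at hx ⊢
          have := hval (x * r₁ + s₁) (x * r₂ + s₂) (by
            convert hx using 2
            module)
          rw [e1, e2] at this
          simpa using this
      _ ≤ _ := by
          refine (Finset.card_union_le _ _).trans (Nat.add_le_add (hsub _ _ _ _ hdet2 _ _ ?_)
            (hsub _ _ _ _ hdet2 _ _ ?_))
          all_goals
            by_contra! hc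
            apply hdet
            rw [hD, hc.1, hc.2]
            ring

end ThinPlanes

section FocusPoint

variable {V : Type} [AddCommGroup V] [Module F V] {p : ℕ} [Fintype F] [Fact p.Prime]
  [Algebra (ZMod p) F] {f : V → ZMod p} [Fintype V] {n : ℕ}

theorem Ind.of_det {u v : V} (h : Ind F u v) {r₁ r₂ s₁ s₂ : F} (hD : r₁ * s₂ - r₂ * s₁ ≠ 0) :
    Ind F (r₁ • u + r₂ • v) (s₁ • u + s₂ • v) := by
  intro a b hab
  obtain ⟨h1, h2⟩ := h (a * r₁ + b * s₁) (a * r₂ + b * s₂) (by rw [← hab]; module)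
  constructor
  · refine (mul_eq_zero.mp (?_ : (r₁ * s₂ - r₂ * s₁) * a = 0)).resolve_left hD
    linear_combination s₂ * h1 - s₁ * h2
  · refine (mul_eq_zero.mp (?_ : (r₁ * s₂ - r₂ * s₁) * b = 0)).resolve_left hD
    linear_combination r₁ * h2 - r₂ * h1

theorem span_pair_of_det (u v : V) {r₁ r₂ s₁ s₂ : F} (hD : r₁ * s₂ - r₂ * s₁ ≠ 0) :
    Submodule.span F {r₁ • u + r₂ • v, s₁ • u + s₂ • v} = Submodule.span F {u, v} := by
  apply le_antisymm
  · rw [Submodule.span_le, Set.insert_subset_iff, Set.singleton_subset_iff]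
    exact ⟨Submodule.mem_span_pair.mpr ⟨r₁, r₂, rfl⟩, Submodule.mem_span_pair.mpr ⟨s₁, s₂, rfl⟩⟩
  · rw [Submodule.span_le, Set.insert_subset_iff, Set.singleton_subset_iff]
    refine ⟨Submodule.mem_span_pair.mpr ⟨s₂ / (r₁ * s₂ - r₂ * s₁), -r₂ / (r₁ * s₂ - r₂ * s₁), ?_⟩,
      Submodule.mem_span_pair.mpr ⟨-s₁ / (r₁ * s₂ - r₂ * s₁), r₁ / (r₁ * s₂ - r₂ * s₁), ?_⟩⟩
    all_goals
      match_scalars <;> field_simp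
      all_goals first | ring1 | (rw [div_eq_one_iff_eq (by convert hD using 1; ring)]; ring)

theorem exists_det_ne_zero {r₁ r₂ : F} (h : r₁ ≠ 0 ∨ r₂ ≠ 0) :
    ∃ s₁ s₂ : F, r₁ * s₂ - r₂ * s₁ ≠ 0 := by
  rcases h with h | h
  · exact ⟨0, 1, by simpa using h⟩
  · exact ⟨-1, 0, by simpa using h⟩

theorem exists_smul_of_det_eq_zero {r₁ r₂ s₁ s₂ : F} (hr : r₁ ≠ 0 ∨ r₂ ≠ 0) (hs : s₁ ≠ 0 ∨ s₂ ≠ 0)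
    (hD : r₁ * s₂ - r₂ * s₁ = 0) : ∃ μ : F, μ ≠ 0 ∧ s₁ = μ * r₁ ∧ s₂ = μ * r₂ := by
  rcases hr with h | h
  · refine ⟨s₁ / r₁, ?_, by field_simp, by field_simp; linear_combination hD⟩
    intro h0
    have h1 : s₁ = 0 := by simpa [h] using h0
    have h2 : s₂ = 0 := by simpa [h, h1] using hD
    tauto
  · refine ⟨s₂ / r₂, ?_, by field_simp; linear_combination -hD, by field_simp⟩
    intro h0
    have h1 : s₂ = 0 := by simpa [h] using h0
    have h2 : s₁ = 0 := by simpa [h, h1] using hD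
    tauto

theorem Focus.of_smul {R s κ : V} {μ : F} (hμ : μ ≠ 0) (h : Focus F f (μ • R) s κ) :
    Focus F f R s κ := by
  unfold Focus at *
  simpa only [cnt_smul_dir f R _ hμ] using h

theorem exists_sq_ne_one (h : 4 ≤ 𝔮) : ∃ μ : F, μ ≠ 0 ∧ μ ≠ μ⁻¹ := by
  by_contra! hc
  have : (Finset.univ : Finset F) ⊆ {0, 1, -1} := by
    intro x _
    by_cases hx : x = 0
    · simp [hx]
    · have h1 := hc x hx
      have h2 : (x - 1) * (x + 1) = 0 := by
        have : x * x = 1 := by nth_rewrite 2 [h1]; exact mul_inv_cancel₀ hx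
        linear_combination this
      rcases mul_eq_zero.mp h2 with h3 | h3
      · simp [sub_eq_zero.mp h3]
      · simp [eq_neg_of_add_eq_zero_left h3]
  have := Finset.card_le_card this
  have h3 : ({0, 1, -1} : Finset F).card ≤ 3 := Finset.card_le_three
  rw [Finset.card_univ] at this
  omega

theorem eq_of_affine_of_smul (h3 : 3 ≤ 𝔮) (hf : f ∈ lcode F p V) {O : V} {a b : F}
    (h : ∀ x : F, algebraMap (ZMod p) F (f (x • O)) = a + b * x) : f O = f 0 := by
  obtain ⟨μ, hμ0, hμ1⟩ := exists_ne_three h3 (0 : F) 1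
  have h1 := h 1
  have h2 := h μ
  have h0 := h 0
  rw [lcode_smul hf hμ0] at h2
  rw [one_smul] at h1
  have hb : b = 0 := by
    refine (mul_eq_zero.mp (?_ : (μ - 1) * b = 0)).resolve_left (sub_ne_zero.mpr hμ1)
    linear_combination h1 - h2
  rw [zero_smul] at h0
  apply (algebraMap (ZMod p) F).injective
  rw [h0, h1, hb]; ring

/-- A word with two centers on a line is constant on that line. -/
theorem const_of_two_centers (h4 : 4 ≤ 𝔮) (hf : f ∈ lcode F p V) {O O' : V}
    (hO : ∀ w ∈ Submodule.span F {O, O'}, ∃ a b : F, ∀ x : F,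
      algebraMap (ZMod p) F (f (x • O + w)) = a + b * x)
    (hO' : ∀ w ∈ Submodule.span F {O, O'}, ∃ a b : F, ∀ x : F,
      algebraMap (ZMod p) F (f (x • O' + w)) = a + b * x) :
    ∀ w ∈ Submodule.span F {O, O'}, w ≠ 0 → f w = f 0 := by
  have hfO : f O = f 0 := by
    obtain ⟨a, b, hab⟩ := hO 0 (Submodule.zero_mem _)
    exact eq_of_affine_of_smul (by omega) hf (a := a) (b := b) (by simpa using hab)
  have hfO' : f O' = f 0 := by
    obtain ⟨a, b, hab⟩ := hO' 0 (Submodule.zero_mem _)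
    exact eq_of_affine_of_smul (by omega) hf (a := a) (b := b) (by simpa using hab)
  obtain ⟨a, b, hab⟩ := hO O' (Submodule.subset_span (by simp))
  obtain ⟨a', b', hab'⟩ := hO' O (Submodule.subset_span (by simp))
  have ha : algebraMap (ZMod p) F (f 0) = a := by simpa [hfO'] using hab 0
  have ha' : algebraMap (ZMod p) F (f 0) = a' := by simpa [hfO] using hab' 0
  have hbb : b = b' := by
    have h1 := hab 1
    have h2 := hab' 1
    rw [one_smul] at h1 h2
    rw [add_comm, h2, ← ha, ← ha'] at h1
    linear_combination -h1
  have hb : b = 0 := by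
    obtain ⟨μ, hμ0, hμ⟩ := exists_sq_ne_one (F := F) h4
    have h1 := hab μ
    have h2 := hab' μ⁻¹
    have : μ⁻¹ • O' + O = μ⁻¹ • (μ • O + O') := by
      rw [smul_add, smul_smul, inv_mul_cancel₀ hμ0, one_smul, add_comm]
    rw [this, lcode_smul hf (inv_ne_zero hμ0), h1, ← ha, ← ha', ← hbb] at h2
    refine (mul_eq_zero.mp (?_ : (μ - μ⁻¹) * b = 0)).resolve_left (sub_ne_zero.mpr hμ)
    linear_combination h2
  intro w hw hw0
  obtain ⟨x, y, rfl⟩ := Submodule.mem_span_pair.mp hw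
  by_cases hy : y = 0
  · subst hy
    have hx : x ≠ 0 := by rintro rfl; simp at hw0
    rw [zero_smul, add_zero, lcode_smul hf hx, hfO]
  · have : x • O + y • O' = y • ((y⁻¹ * x) • O + O') := by
      rw [smul_add, smul_smul, mul_inv_cancel_left₀ hy]
    rw [this, lcode_smul hf hy]
    apply (algebraMap (ZMod p) F).injective
    rw [hab, hb, ha]; ring

theorem exists_eq_of_card_ne_le {g : F → ZMod p} {lam lam' : ZMod p}
    (h5 : 5 ≤ 𝔮) (h : (Finset.univ.filter fun x => g x ≠ lam).card ≤ 2)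
    (h' : (Finset.univ.filter fun x => g x ≠ lam').card ≤ 2) : lam = lam' := by
  by_contra hne
  have : (Finset.univ : Finset F) ⊆ (Finset.univ.filter fun x => g x ≠ lam) ∪
      Finset.univ.filter fun x => g x ≠ lam' := by
    intro x _
    simp only [Finset.mem_union, Finset.mem_filter, Finset.mem_univ, true_and]
    by_contra! hc
    exact hne (hc.1.symm.trans hc.2)
  have := (Finset.card_le_card this).trans (Finset.card_union_le _ _)
  rw [Finset.card_univ] at this
  omega

theorem Sparse.exists_focus (S : Sparse F n f) {u v : V} (h : Ind F u v) (ht : 4 ≤ tot F f u v)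
    (hnc : ∀ lam, ∃ w ∈ Submodule.span F {u, v}, w ≠ 0 ∧ f w ≠ lam) :
    ∃ R s, Ind F R s ∧ Submodule.span F {R, s} = Submodule.span F {u, v} ∧
      ∀ κ, Thin F f R s κ → Focus F f R s κ := by
  have h37 := S.le_card
  have hthin : ∀ {R s κ : V}, Ind F R s → Submodule.span F {R, s} = Submodule.span F {u, v} →
      Thin F f R s κ → Thin F f u v κ := fun hRs hs ht => ht.congr hRs h hs
  by_cases hT : ∃ κ, Thin F f u v κ ∧ ∃ lam : ZMod p, ∀ r₁ r₂ s₁ s₂ : F,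
      Ind F (r₁ • u + r₂ • v) (s₁ • u + s₂ • v) →
      (Finset.univ.filter fun x : F =>
        f (x • (r₁ • u + r₂ • v) + (s₁ • u + s₂ • v)) ≠ lam).card ≤ 2 ∧
      (f (r₁ • u + r₂ • v) ≠ lam → Focus F f (r₁ • u + r₂ • v) (s₁ • u + s₂ • v) κ)
  · obtain ⟨κ₁, -, lam, hlam⟩ := hT
    obtain ⟨R, hR, hR0, hfR⟩ := hnc lam
    obtain ⟨r₁, r₂, rfl⟩ := Submodule.mem_span_pair.mp hR
    have hr : r₁ ≠ 0 ∨ r₂ ≠ 0 := by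
      by_contra! hc
      rw [hc.1, hc.2] at hR0
      simp at hR0
    obtain ⟨s₁, s₂, hD⟩ := exists_det_ne_zero hr
    have hInd := h.of_det hD
    refine ⟨_, _, hInd, span_pair_of_det u v hD, fun κ hκ => ?_⟩
    rcases S.thin_cases h ht (hthin hInd (span_pair_of_det u v hD) hκ) with
      ⟨lam', hlam'⟩ | ⟨o₁, o₂, ho, haff, hfoc⟩
    · have : lam = lam' := exists_eq_of_card_ne_le (by omega) (hlam _ _ _ _ hInd).1
        (hlam' _ _ _ _ hInd).1
      exact (hlam' _ _ _ _ hInd).2 (this ▸ hfR)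
    · by_cases hD' : o₁ * r₂ - o₂ * r₁ = 0
      · obtain ⟨μ, hμ, rfl, rfl⟩ := exists_smul_of_det_eq_zero (s₁ := o₁) (s₂ := o₂) hr ho
          (by linear_combination -hD')
        have e : (μ * r₁) • u + (μ * r₂) • v = μ • (r₁ • u + r₂ • v) := by module
        rw [e] at hfoc
        refine (hfoc s₁ s₂ ?_).of_smul hμ
        rw [← e]
        exact h.of_det (by
          have : μ * r₁ * s₂ - μ * r₂ * s₁ = μ * (r₁ * s₂ - r₂ * s₁) := by ring
          rw [this]
          exact mul_ne_zero hμ hD)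
      · exfalso
        have h1 := (hlam _ _ _ _ (h.of_det hD')).1
        obtain ⟨a, b, hab⟩ := haff r₁ r₂
        obtain ⟨x, hx, y, hy, hxy⟩ := Finset.one_lt_card.mp (show 1 < (Finset.univ.filter fun x : F =>
            f (x • (o₁ • u + o₂ • v) + (r₁ • u + r₂ • v)) = lam).card by
          have := Finset.card_filter_add_card_filter_not (s := (Finset.univ : Finset F)) fun x : F =>
            f (x • (o₁ • u + o₂ • v) + (r₁ • u + r₂ • v)) = lam
          rw [Finset.card_univ] at this
          simp only [ne_eq] at h1
          omega)
        simp only [Finset.mem_filter, Finset.mem_univ, true_and] at hx hy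
        have hx' := hab x
        have hy' := hab y
        have h0' := hab 0
        rw [hx] at hx'
        rw [hy] at hy'
        have hb : b = 0 := by
          refine (mul_eq_zero.mp (?_ : (x - y) * b = 0)).resolve_left (sub_ne_zero.mpr hxy)
          linear_combination hy' - hx'
        apply hfR
        apply (algebraMap (ZMod p) F).injective
        rw [zero_smul, zero_add] at h0'
        rw [h0', hx', hb]; ring
  · have hK : ∀ κ, Thin F f u v κ → ∃ o₁ o₂ : F, (o₁ ≠ 0 ∨ o₂ ≠ 0) ∧
        (∀ w₁ w₂ : F, ∃ a b : F, ∀ x : F,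
          algebraMap (ZMod p) F (f (x • (o₁ • u + o₂ • v) + (w₁ • u + w₂ • v))) = a + b * x) ∧
        ∀ s₁ s₂ : F, Ind F (o₁ • u + o₂ • v) (s₁ • u + s₂ • v) →
          Focus F f (o₁ • u + o₂ • v) (s₁ • u + s₂ • v) κ := fun κ hκ =>
      (S.thin_cases h ht hκ).resolve_left fun hc => hT ⟨κ, hκ, hc⟩
    obtain ⟨κ₀, hκ₀⟩ := S.exists_thin h
    obtain ⟨r₁, r₂, hr, haff₀, -⟩ := hK κ₀ hκ₀
    obtain ⟨s₁, s₂, hD⟩ := exists_det_ne_zero hr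
    have hInd := h.of_det hD
    refine ⟨_, _, hInd, span_pair_of_det u v hD, fun κ hκ => ?_⟩
    obtain ⟨o₁, o₂, ho, haff, hfoc⟩ := hK κ (hthin hInd (span_pair_of_det u v hD) hκ)
    by_cases hD' : r₁ * o₂ - r₂ * o₁ = 0
    · obtain ⟨μ, hμ, rfl, rfl⟩ := exists_smul_of_det_eq_zero hr ho hD'
      have e : (μ * r₁) • u + (μ * r₂) • v = μ • (r₁ • u + r₂ • v) := by module
      rw [e] at hfoc
      refine (hfoc s₁ s₂ ?_).of_smul hμ
      rw [← e]
      exact h.of_det (by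
        have : μ * r₁ * s₂ - μ * r₂ * s₁ = μ * (r₁ * s₂ - r₂ * s₁) := by ring
        rw [this]
        exact mul_ne_zero hμ hD)
    · exfalso
      obtain ⟨w, hw, hw0, hfw⟩ := hnc (f 0)
      rw [← span_pair_of_det u v hD'] at hw
      refine hfw (const_of_two_centers (by omega) S.mem ?_ ?_ w hw hw0) <;>
      · intro w hw
        rw [span_pair_of_det u v hD'] at hw
        obtain ⟨w₁, w₂, rfl⟩ := Submodule.mem_span_pair.mp hw
        first | exact haff₀ w₁ w₂ | exact haff w₁ w₂

end FocusPoint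

section FocusMoments

variable {V : Type} [AddCommGroup V] [Module F V] {p : ℕ} [Fintype F] [Fact p.Prime]
  [Algebra (ZMod p) F] {f : V → ZMod p} [Fintype V] {n : ℕ}

theorem covered_two_of_lt (h8 : 8 ≤ 𝔮) (hf : f ∈ lcode F p V)
    (hV : Fintype.card V = 𝔮 ^ (n + 2)) (hw : wtv f < 3 * (𝔮 - 2) * 𝔮 ^ n) : Covered F 2 f := by
  refine covered_two (by omega) (n + 1) V f hf hV
    (lineGap_of_wtv hf hV (M := 3 * (𝔮 - 2)) (by norm_num) (by omega) (fun s h2 h3 => ?_) hw) ?_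
  · generalize 𝔮 = k at *
    obtain ⟨a, rfl⟩ := Nat.exists_eq_add_of_le (show 3 ≤ s by omega)
    obtain ⟨b, rfl⟩ := Nat.exists_eq_add_of_le h3
    obtain ⟨c, hc⟩ := Nat.exists_eq_add_of_le (show 2 ≤ a + b by omega)
    have e1 : 3 + a + 3 + b - 1 = 5 + (a + b) := by omega
    have e2 : 3 * (3 + a + 3 + b - 2) - 1 = 11 + 3 * (a + b) := by omega
    have e3 : 3 + a + 3 + b - (3 + a) = 3 + b := by omega
    have e4 : 3 + a + 3 + b = 6 + (a + b) := by omega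
    have e5 : (3 + a) * (3 + b) = 9 + 3 * (a + b) + a * b := by ring
    rw [e1, e2, e3, e5, e4, hc]
    nlinarith [Nat.zero_le (a * b)]
  · rw [pow_succ' 𝔮 n, mul_left_comm]
    exact Nat.mul_lt_mul_of_pos_left hw (by omega)

theorem Covered.of_sub_hyp {t : ℕ} {a : ZMod p} {φ : Module.Dual F V} (hφ : φ ≠ 0)
    (h : Covered F t (f - a • hyp p φ)) : Covered F (t + 1) f := by
  obtain ⟨ψ, h1, h2⟩ := h
  refine ⟨Fin.cons φ ψ, fun i => Fin.cases hφ h1 i, fun v hv hfv => ?_⟩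
  by_cases hφv : φ v = 0
  · exact ⟨0, hφv⟩
  · obtain ⟨i, hi⟩ := h2 v hv (by simpa [hyp, hφv] using hfv)
    exact ⟨i.succ, hi⟩

theorem Sparse.form_eq_zero_of_focus (S : Sparse F n f) {R s : V} (h : Ind F R s)
    (hfoc : ∀ κ, Thin F f R s κ → Focus F f R s κ) {g : V → F} {d : ℕ} (hd : d ≤ 3)
    (hg : IsForm d g) (hgood : ∀ v, Ind F R v → cnt F f R v ≤ 1 → g v = 0) (v : V) : g v = 0 := by
  have h37 := S.le_card
  by_contra hv
  have hnz := hg.nonzeros hv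
  set G := Finset.univ.filter fun κ : V => Thin F f R s κ ∧ cnt F f R κ ≤ 1 with hG
  set T := Finset.univ.filter fun κ : V => Thin F f R s κ with hT
  have h1 : (Finset.univ.filter fun v : V => g v ≠ 0).card + G.card ≤ Fintype.card V := by
    rw [← Finset.card_union_of_disjoint, ← Finset.card_univ]
    · exact Finset.card_le_card (Finset.subset_univ _)
    · rw [Finset.disjoint_left]
      intro κ hκ hκ'
      obtain ⟨h1, h2⟩ := (Finset.mem_filter.mp hκ').2
      refine (Finset.mem_filter.mp hκ).2 (hgood κ (ind_of_notMem h.left_ne fun hm => h1.1 ?_) h2)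
      exact Submodule.span_mono (by simp) hm
  have h2 : (𝔮 - 2) * T.card ≤ 𝔮 * G.card := by
    rw [hG, ← sum_card_line (F := F) _ s, mul_comm, ← smul_eq_mul, ← Finset.sum_const]
    refine (Finset.sum_le_sum fun κ hκ => ?_).trans
      (Finset.sum_le_sum_of_subset (Finset.subset_univ T))
    have hκ' : Thin F f R s κ := (Finset.mem_filter.mp hκ).2
    have hf := hfoc κ hκ'
    unfold Focus at hf
    have := Finset.card_filter_add_card_filter_not (s := (Finset.univ : Finset F)) fun c : F =>
      2 ≤ cnt F f R (κ + c • s)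
    rw [Finset.card_univ] at this
    refine (show 𝔮 - 2 ≤ (Finset.univ.filter fun c : F => ¬ 2 ≤ cnt F f R (κ + c • s)).card by
      omega).trans (Finset.card_le_card fun c hc => ?_)
    have hc := (Finset.mem_filter.mp hc).2
    refine Finset.mem_filter.mpr ⟨Finset.mem_univ _, ?_, ?_⟩
    · rw [add_comm]
      exact hκ'.add_mem h (Submodule.smul_mem _ _ (Submodule.subset_span (by simp)))
    · rw [add_comm]
      omega
  have h3 := S.card_thin h
  rw [S.card_space] at h1 hnz
  have h4 : 𝔮 ^ 4 ≤ 𝔮 ^ (n + 4) := Nat.pow_le_pow_right (by omega) (by omega)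
  generalize T.card = t at *
  generalize G.card = γ at *
  generalize (Finset.univ.filter fun v : V => g v ≠ 0).card = z at *
  generalize 𝔮 ^ (n + 4) = Q at *
  have h5 : (𝔮 - 3) * Q ≤ 𝔮 * z := (Nat.mul_le_mul_right _ (by omega)).trans hnz
  generalize 𝔮 = k at *
  obtain ⟨k, rfl⟩ := Nat.exists_eq_add_of_le h37
  rw [show 37 + k - 3 = 34 + k by omega] at h5
  rw [show 37 + k - 2 = 35 + k by omega] at h2
  have h6 : (37 + k) * γ ≤ 3 * Q := by nlinarith
  have h7 : (35 + k) * Q ≤ 6 * Q + (35 + k) * (2 * (37 + k) ^ 2) := by nlinarith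
  have h8 : (29 + k) * (37 + k) ^ 4 ≤ (35 + k) * (2 * (37 + k) ^ 2) := by nlinarith
  have h9 : (37 + k) ^ 4 = (37 + k) ^ 2 * (37 + k) ^ 2 := by ring
  have h10 : 1 ≤ (37 + k) ^ 2 := Nat.one_le_pow _ _ (by omega)
  have h11 : (29 + k) * (37 + k) ^ 2 ≤ (35 + k) * 2 := by
    refine Nat.le_of_mul_le_mul_left (?_ : (37 + k) ^ 2 * _ ≤ _) h10
    rw [h9] at h8
    linarith
  nlinarith

theorem Sparse.ctr_or_covered (S : Sparse F n f) {R s : V} (h : Ind F R s)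
    (hfoc : ∀ κ, Thin F f R s κ → Focus F f R s κ) : Ctr F f R ∨ Covered F 3 f := by
  have h37 := S.le_card
  by_cases hS : f 0 = f R
  · left
    have m0 : ∀ v, mom (F := F) f R 0 v = 0 := fun v => by rw [mom_zero S.mem, hS, sub_self, map_zero]
    have m1 : ∀ v, mom (F := F) f R 1 v = 0 := by
      refine S.form_eq_zero_of_focus h hfoc (by norm_num) (mom_isForm S.mem R (by omega)) ?_
      intro v _ hv
      by_contra hm
      have := cnt_ge_of_mom (fun j hj => by interval_cases j; exact m0 v) hm
      omega
    have m2 : ∀ v, mom (F := F) f R 2 v = 0 := by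
      refine S.form_eq_zero_of_focus h hfoc (by norm_num) (mom_isForm S.mem R (by omega)) ?_
      intro v _ hv
      by_contra hm
      have := cnt_ge_of_mom (fun j hj => by interval_cases j; exacts [m0 v, m1 v]) hm
      omega
    refine S.ctr_of_low fun m hm v => ?_
    interval_cases m
    exacts [m0 v, m1 v, m2 v]
  · right
    obtain ⟨φ, hφR, hc, hc0, hc1⟩ := exists_dual_moment S.mem (by omega) hS
    set a := f 0 - f R with ha
    set c := f - a • hyp p φ with hcdef
    rcases cone_or_moment hc (by omega) hc0 with hcone | ⟨m, hm1, hmq, hlow, v₀, hv₀⟩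
    · refine Covered.of_sub_hyp (a := a) (φ := φ) (fun h0 => hφR (by rw [h0]; rfl)) ?_
      refine covered_two_of_lt (n := n + 2) (by omega) hc S.card_space ?_
      have h1 : (𝔮 - 2) * nz c + Fintype.card V ≤ 𝔮 * nz f := by
        rw [← sum_cnt (F := F) f R]
        have : nz c = ∑ v : V, if c v ≠ 0 then 1 else 0 := by
          unfold nz
          rw [Finset.card_filter]
        rw [this, Finset.mul_sum, ← Finset.card_univ (α := V), Finset.card_eq_sum_ones,
          ← Finset.sum_add_distrib]
        refine Finset.sum_le_sum fun v _ => ?_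
        have k1 := one_le_cnt S.mem hS v
        split_ifs with hv
        · have k2 := cnt_of_const hcone hv
          have k3 := cnt_sub_hyp_le f a hφR v
          rw [← hcdef, k2] at k3
          omega
        · omega
      have h2 : wtv c ≤ nz c := by rw [nz_eq]; omega
      have h3 : nz f ≤ wtv f + 1 := by rw [nz_eq]; split_ifs <;> omega
      have h4 := S.wtv_le
      rw [S.card_space] at h1
      have e2 : 𝔮 ^ (n + 2) = 𝔮 * 𝔮 ^ (n + 1) := by ring
      have e4 : 𝔮 ^ (n + 4) = 𝔮 * (𝔮 * (𝔮 * 𝔮 ^ (n + 1))) := by ring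
      rw [e2]
      rw [e4] at h1
      have h5 : 1 ≤ 𝔮 ^ (n + 1) := Nat.one_le_pow _ _ (by omega)
      generalize 𝔮 ^ (n + 1) = Q at *
      generalize nz c = x at *
      generalize wtv c = x' at *
      generalize nz f = y at *
      generalize wtv f = y' at *
      clear_value c
      generalize 𝔮 = k at *
      obtain ⟨k, rfl⟩ := Nat.exists_eq_add_of_le h37
      rw [show 37 + k - 2 = 35 + k by omega] at h1 ⊢
      rw [show 37 + k - 1 = 36 + k by omega, show 4 * (37 + k) - 33 = 115 + 4 * k by omega] at h4
      refine lt_of_le_of_lt h2 ?_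
      by_contra! hcon
      have h6 : (37 + k) * y ≤ (37 + k) * ((36 + k) * (115 + 4 * k) * Q + 1) :=
        Nat.mul_le_mul_left _ (by omega)
      have h7 := Nat.mul_le_mul_left (35 + k) hcon
      have h8 : (35 + k) * (3 * (35 + k) * ((37 + k) * Q)) + (37 + k) * ((37 + k) * ((37 + k) * Q)) ≤
          (37 + k) * ((36 + k) * (115 + 4 * k) * Q + 1) := by omega
      have h9 : (37 + k) * ((35 + k) * 3 * (35 + k) * Q + (37 + k) * (37 + k) * Q) ≤
          (37 + k) * ((36 + k) * (115 + 4 * k) * Q + 1) := by linarith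
      have h10 := Nat.le_of_mul_le_mul_left h9 (by omega)
      nlinarith
    · exfalso
      have hlow' : ∀ v, mom (F := F) c R m v ≠ 0 → m + 1 ≤ cnt F f R v + 1 := fun v hv =>
        (cnt_ge_of_mom (fun j hj => hlow j hj v) hv).trans (cnt_sub_hyp_le f a hφR v)
      have hform := mom_isForm hc R (m := m) (by omega)
      have hm2 : 2 ≤ m := by
        by_contra! hlt
        have : m = 1 := by omega
        subst this
        exact hv₀ (hc1 v₀)
      by_cases hm3 : m ≤ 3
      · refine hv₀ (S.form_eq_zero_of_focus h hfoc hm3 hform (fun v _ hv => ?_) v₀)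
        by_contra hm
        have := hlow' v hm
        omega
      · refine hv₀ (S.form_eq_zero hform (R := R) (fun v hv => ⟨?_, ?_⟩)
          (Or.inr ⟨hmq, one_le_cnt S.mem hS⟩) v₀)
        · refine ind_of_notMem h.left_ne fun hm => hv ?_
          exact mom_span hc hc0 (by omega) hm
        · have := hlow' v hv
          unfold tot
          omega

end FocusMoments

section Submodules

variable {V : Type} [AddCommGroup V] [Module F V] [Fintype F] [Fintype V]

theorem card_mul_le_of_ne_top {M : Submodule F V} (hM : M ≠ ⊤) :
    𝔮 * (Finset.univ.filter fun v : V => v ∈ M).card ≤ Fintype.card V := by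
  obtain ⟨x, hx⟩ := SetLike.exists_not_mem_of_ne_top M hM rfl
  obtain ⟨φ, h1, h2⟩ := Submodule.exists_le_ker_of_notMem hx
  have hφ : φ ≠ 0 := by rintro rfl; exact h1 rfl
  rw [← card_ker_dual hφ]
  refine Nat.mul_le_mul_left _ (Finset.card_le_card fun v hv => ?_)
  exact Finset.mem_filter.mpr ⟨Finset.mem_univ _, h2 (Finset.mem_filter.mp hv).2⟩

theorem smul_eq_zero_of_add_mem {N : Submodule F V} {a w : V} {y : F} (ha : a ∉ N) (hw : w ∈ N)
    (h : y • a + w ∈ N) : y = 0 := by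
  by_contra hy
  refine ha ?_
  have := N.smul_mem y⁻¹ ((N.add_mem_iff_left hw).mp h)
  rwa [smul_smul, inv_mul_cancel₀ hy, one_smul] at this

theorem card_mul_le_sup {M : Submodule F V} {y : V} (hy : y ∉ M) :
    𝔮 * (Finset.univ.filter fun v : V => v ∈ M).card ≤
      (Finset.univ.filter fun v : V => v ∈ M ⊔ Submodule.span F {y}).card := by
  rw [← Finset.card_univ (α := F), ← Finset.card_product]
  refine Finset.card_le_card_of_injOn (fun t => t.1 • y + t.2) (fun t ht => ?_) ?_
  · have := (Finset.mem_filter.mp (Finset.mem_product.mp ht).2).2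
    refine Finset.mem_coe.mpr (Finset.mem_filter.mpr ⟨Finset.mem_univ _, add_mem ?_ ?_⟩)
    · exact Submodule.mem_sup_right (Submodule.smul_mem _ _ (Submodule.mem_span_singleton_self y))
    · exact Submodule.mem_sup_left this
  · rintro ⟨t, m⟩ ht ⟨t', m'⟩ ht' h
    have hm := (Finset.mem_filter.mp (Finset.mem_product.mp ht).2).2
    have hm' := (Finset.mem_filter.mp (Finset.mem_product.mp ht').2).2
    simp only at h hm hm'
    have h0 : t - t' = 0 := by
      refine smul_eq_zero_of_add_mem hy (M.sub_mem hm hm' : m - m' ∈ M) ?_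
      have : (t - t') • y + (m - m') = 0 := by
        rw [sub_smul, sub_add_sub_comm, h, sub_self]
      rw [this]; exact M.zero_mem
    obtain rfl := sub_eq_zero.mp h0
    simpa using h

/-- The vectors `u, v, w` are linearly independent modulo the subspace `M`. -/
def IndMod (M : Submodule F V) (u v w : V) : Prop :=
  ∀ x y z : F, x • u + y • v + z • w ∈ M → x = 0 ∧ y = 0 ∧ z = 0

theorem indMod_of_notMem {M : Submodule F V} {u v w : V} (hu : u ∉ M)
    (hv : v ∉ M ⊔ Submodule.span F {u}) (hw : w ∉ M ⊔ Submodule.span F {u, v}) :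
    IndMod M u v w := by
  intro x y z h
  have hu' : x • u ∈ M ⊔ Submodule.span F {u} :=
    Submodule.mem_sup_right (Submodule.smul_mem _ _ (Submodule.mem_span_singleton_self u))
  have hz : z = 0 := by
    refine smul_eq_zero_of_add_mem hw (w := x • u + y • v) ?_ ?_
    · exact Submodule.mem_sup_right (Submodule.mem_span_pair.mpr ⟨x, y, rfl⟩)
    · rw [add_comm]; exact Submodule.mem_sup_left h
  subst hz
  rw [zero_smul, add_zero] at h
  have hy : y = 0 := by
    refine smul_eq_zero_of_add_mem hv hu' ?_
    rw [add_comm]; exact Submodule.mem_sup_left h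
  subst hy
  refine ⟨smul_eq_zero_of_add_mem hu M.zero_mem ?_, rfl, rfl⟩
  simpa using h

theorem IndMod.ind {M : Submodule F V} {u v w : V} (h : IndMod M u v w) : Ind F u v := by
  intro a b hab
  obtain ⟨h1, h2, -⟩ := h a b 0 (by rw [hab]; simp)
  exact ⟨h1, h2⟩

theorem IndMod.notMem {M : Submodule F V} {u v w : V} (h : IndMod M u v w) :
    w ∉ Submodule.span F {u, v} := by
  intro hw
  obtain ⟨a, b, hab⟩ := Submodule.mem_span_pair.mp hw
  have := (h a b (-1) (by rw [hab]; simp)).2.2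
  simp at this

end Submodules

section Transversal

variable {V : Type} [AddCommGroup V] [Module F V] {p : ℕ} [Fintype F] [Fact p.Prime]
  [Algebra (ZMod p) F] {f : V → ZMod p} [Fintype V] {n : ℕ}

theorem Sparse.const_of_long (S : Sparse F n f) (hnc : ¬ Covered F 3 f) {u v : V}
    (h : Ind F u v) (ht : 4 ≤ tot F f u v)
    (hS : ∀ w ∈ Submodule.span F {u, v}, w ∈ S.centers → w = 0) :
    ∃ lam, ∀ w ∈ Submodule.span F {u, v}, w ≠ 0 → f w = lam := by
  by_contra hcon
  push Not at hcon
  obtain ⟨R, s, h1, h2, h3⟩ := S.exists_focus h ht hcon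
  rcases S.ctr_or_covered h1 h3 with h4 | h4
  · refine h1.left_ne (hS R ?_ (S.mem_centers.mpr h4))
    rw [← h2]; exact Submodule.subset_span (by simp)
  · exact hnc h4

theorem Sparse.exists_const (S : Sparse F n f) (hnc : ¬ Covered F 3 f) {P a b : V}
    (h : IndMod S.centers P a b) (hP : f P ≠ 0) :
    ∃ c d : F, (c ≠ 0 ∨ d ≠ 0) ∧ Ind F P (c • a + d • b) ∧ 4 ≤ tot F f P (c • a + d • b) ∧
      ∀ w ∈ Submodule.span F {P, c • a + d • b}, w ≠ 0 → f w = f P := by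
  obtain ⟨c, d, h1, h2, h3⟩ := exists_long (by have := S.le_card; omega) S.mem hP h.ind h.notMem
  refine ⟨c, d, h1, h2, h3, ?_⟩
  obtain ⟨lam, hlam⟩ := S.const_of_long hnc h2 h3 fun w hw hwc => by
    obtain ⟨x, y, rfl⟩ := Submodule.mem_span_pair.mp hw
    obtain ⟨e1, e2, e3⟩ := h x (y * c) (y * d) (by
      convert hwc using 1; module)
    rcases h1 with h1 | h1
    · simp [e1, (mul_eq_zero.mp e2).resolve_right h1]
    · simp [e1, (mul_eq_zero.mp e3).resolve_right h1]
  have := hlam P (Submodule.subset_span (by simp)) h2.left_ne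
  intro w hw hw0
  rw [hlam w hw hw0, this]

theorem Sparse.ctr_of_vanish (S : Sparse F n f) {P w : V} (h : Ind F P w)
    {M : Submodule F V} (hM : M ≠ ⊤) (hPM : P ∈ M)
    (hvan : ∀ κ, Thin F f P w κ → κ ∉ M → f κ = 0) : Ctr F f P := by
  have h37 := S.le_card
  refine S.ctr_of_low fun m hm v => ?_
  by_contra hv
  have hnz := (mom_isForm S.mem P (show m + 1 < 𝔮 by omega)).nonzeros hv
  set g := mom (F := F) f P m with hg
  have h1 := card_mul_le_of_ne_top hM
  have h3 := S.card_thin h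
  set G := Finset.univ.filter fun κ : V => Thin F f P w κ ∧ κ ∉ M with hG
  set T := Finset.univ.filter fun κ : V => Thin F f P w κ with hT
  have h2 : T.card ≤ G.card + (Finset.univ.filter fun v : V => v ∈ M).card := by
    refine (Finset.card_le_card fun κ hκ => ?_).trans (Finset.card_union_le _ _)
    have hκ' := (Finset.mem_filter.mp hκ).2
    by_cases hκM : κ ∈ M
    · exact Finset.mem_union_right _ (Finset.mem_filter.mpr ⟨Finset.mem_univ _, hκM⟩)
    · exact Finset.mem_union_left _ (Finset.mem_filter.mpr ⟨Finset.mem_univ _, hκ', hκM⟩)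
  have h4 : (Finset.univ.filter fun v : V => g v ≠ 0).card + G.card ≤ Fintype.card V := by
    rw [← Finset.card_union_of_disjoint, ← Finset.card_univ]
    · exact Finset.card_le_card (Finset.subset_univ _)
    · rw [Finset.disjoint_left]
      intro κ hκ hκ'
      obtain ⟨h1, h2⟩ := (Finset.mem_filter.mp hκ').2
      refine (Finset.mem_filter.mp hκ).2 (Finset.sum_eq_zero fun x _ => ?_)
      rw [add_comm, hvan, map_zero, zero_mul]
      · exact h1.add_mem h (Submodule.smul_mem _ _ (Submodule.subset_span (by simp)))
      · rwa [M.add_mem_iff_left (M.smul_mem _ hPM)]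
  rw [S.card_space] at h1 h4 hnz
  have h5 : 𝔮 ^ 4 ≤ 𝔮 ^ (n + 4) := Nat.pow_le_pow_right (by omega) (by omega)
  generalize T.card = t at *
  generalize G.card = γ at *
  generalize (Finset.univ.filter fun v : V => g v ≠ 0).card = z at *
  generalize (Finset.univ.filter fun v : V => v ∈ M).card = μ at *
  generalize 𝔮 ^ (n + 4) = Q at *
  have h6 : (𝔮 - 3) * Q ≤ 𝔮 * z := (Nat.mul_le_mul_right _ (by omega)).trans hnz
  generalize 𝔮 = k at *
  obtain ⟨k, rfl⟩ := Nat.exists_eq_add_of_le h37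
  rw [show 37 + k - 3 = 34 + k by omega] at h6
  have h7 := Nat.mul_le_mul_left (37 + k) h4
  have h8 := Nat.mul_le_mul_left (37 + k) h2
  have h9 := Nat.mul_le_mul_left (37 + k) h3
  have h10 : 37 * (37 + k) ^ 3 ≤ Q := by
    refine le_trans ?_ h5
    rw [pow_succ' (37 + k) 3]
    exact Nat.mul_le_mul_right _ (by omega)
  nlinarith [Nat.zero_le (k * Q)]

/-- Off the space of centers, a nonzero value forces characteristic two. -/
theorem Sparse.char_two (S : Sparse F n f) (hnc : ¬ Covered F 3 f)
    (hcod : ∀ x y, S.centers ⊔ Submodule.span F {x, y} ≠ ⊤) {P : V} (hP : f P ≠ 0)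
    (hPc : P ∉ S.centers) : f 0 = f P ∧ p = 2 := by
  have h37 := S.le_card
  obtain ⟨a, ha⟩ := SetLike.exists_not_mem_of_ne_top (S.centers ⊔ Submodule.span F {P})
    (by simpa using hcod P P) rfl
  obtain ⟨b, hb⟩ := SetLike.exists_not_mem_of_ne_top _ (hcod P a) rfl
  have hI := indMod_of_notMem hPc ha hb
  obtain ⟨c, d, hcd, hPw, hlong, hconst⟩ := S.exists_const hnc hI hP
  set w := c • a + d • b with hw
  have hPwc : ∀ x y : F, x • P + y • w ∈ S.centers → x = 0 ∧ y = 0 := by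
    intro x y hxy
    obtain ⟨e1, e2, e3⟩ := hI x (y * c) (y * d) (by convert hxy using 1; rw [hw]; module)
    refine ⟨e1, ?_⟩
    rcases hcd with h1 | h1
    · exact (mul_eq_zero.mp e2).resolve_right h1
    · exact (mul_eq_zero.mp e3).resolve_right h1
  obtain ⟨κ, hκ, hκM, hfκ⟩ : ∃ κ, Thin F f P w κ ∧ κ ∉ S.centers ⊔ Submodule.span F {P, w} ∧
      f κ ≠ 0 := by
    by_contra hcon
    push Not at hcon
    exact hPc (S.mem_centers.mpr (S.ctr_of_vanish hPw (hcod P w)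
      (Submodule.mem_sup_right (Submodule.subset_span (by simp))) hcon))
  have hI' : IndMod S.centers P w κ := by
    intro x y z h
    have hz : z = 0 := by
      refine smul_eq_zero_of_add_mem hκM (w := x • P + y • w) ?_ ?_
      · exact Submodule.mem_sup_right (Submodule.mem_span_pair.mpr ⟨x, y, rfl⟩)
      · rw [add_comm]; exact Submodule.mem_sup_left h
    subst hz
    rw [zero_smul, add_zero] at h
    exact ⟨(hPwc x y h).1, (hPwc x y h).2, rfl⟩
  have hQ : ∀ x y : F, f (x • P + y • w + κ) ≠ 0 → ∃ c d : F, (c ≠ 0 ∨ d ≠ 0) ∧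
      ∀ r ∈ Submodule.span F {x • P + y • w + κ, c • P + d • w}, r ≠ 0 → f r = f P := by
    intro x y hxy
    have hI2 : IndMod S.centers (x • P + y • w + κ) P w := by
      intro α β γ h
      obtain ⟨e1, e2, e3⟩ := hI' (α * x + β) (α * y + γ) α (by convert h using 1; module)
      subst e3
      exact ⟨rfl, by simpa using e1, by simpa using e2⟩
    obtain ⟨c, d, h1, h2, -, h3⟩ := S.exists_const hnc hI2 hxy
    refine ⟨c, d, h1, fun r hr hr0 => ?_⟩
    rw [h3 r hr hr0, ← h3 (c • P + d • w) (Submodule.subset_span (by simp)) h2.right_ne]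
    exact hconst _ (Submodule.mem_span_pair.mpr ⟨c, d, rfl⟩) h2.right_ne
  have hval : ∀ x y : F, f (x • P + y • w + κ) ≠ 0 → f (x • P + y • w + κ) = f P := by
    intro x y hxy
    obtain ⟨c, d, -, h3⟩ := hQ x y hxy
    refine h3 _ (Submodule.subset_span (by simp)) fun h0 => ?_
    have := (hI' x y 1 (by rw [one_smul, h0]; exact S.centers.zero_mem)).2.2
    exact one_ne_zero this
  have h0 : f 0 = f P := by
    obtain ⟨c, d, h1, h3⟩ := hQ 0 0 (by simpa using hfκ)
    simp only [zero_smul, zero_add] at h3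
    have hO : c • P + d • w ≠ 0 := fun h0 => by
      obtain ⟨e1, e2⟩ := hPw c d h0
      tauto
    have hs := line_sum (F := F) S.mem (c • P + d • w) κ
    rw [Finset.sum_congr rfl fun x _ => h3 (x • (c • P + d • w) + κ)
        (Submodule.mem_span_pair.mpr ⟨1, x, by rw [one_smul, add_comm]⟩) fun h0 => ?_,
      Finset.sum_const, Finset.card_univ, nsmul_eq_mul, card_cast_zmod, zero_mul,
      h3 _ (Submodule.subset_span (by simp)) hO] at hs
    · exact (sub_eq_zero.mp hs.symm)
    · have := (hI' (x * c) (x * d) 1 (by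
        convert S.centers.zero_mem using 1; rw [← h0]; module)).2.2
      exact one_ne_zero this
  refine ⟨h0, ?_⟩
  obtain ⟨φ, hφ, hcov, hl⟩ := S.exists_cover hPw hκ
  obtain ⟨i₀, hi1, hi2⟩ := hl 1 0 (Or.inl one_ne_zero) (by simpa using hlong)
  have hi3 : φ i₀ (0, 0, 1) ≠ 0 := fun h => hφ i₀ (LinearMap.ext fun ⟨x, y, z⟩ => by
    rw [dual_triple, hi1, hi2, h]; simp)
  obtain ⟨t, ht⟩ : ∃ t : F, ∀ i, i ≠ i₀ → φ i (1, t, 0) = 0 →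
      φ i (1, 0, 0) = 0 ∧ φ i (0, 1, 0) = 0 := by
    obtain ⟨i₁, i₂, hi⟩ : ∃ i₁ i₂ : Fin 3, ∀ i, i = i₀ ∨ i = i₁ ∨ i = i₂ := by
      clear hi1 hi2 hi3; revert i₀; decide
    obtain ⟨t, ht1, ht2⟩ := exists_ne_three (show 3 ≤ 𝔮 by omega)
      (-(φ i₁ (1, 0, 0) / φ i₁ (0, 1, 0))) (-(φ i₂ (1, 0, 0) / φ i₂ (0, 1, 0)))
    have key : ∀ i, t ≠ -(φ i (1, 0, 0) / φ i (0, 1, 0)) → φ i (1, t, 0) = 0 →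
        φ i (1, 0, 0) = 0 ∧ φ i (0, 1, 0) = 0 := by
      intro i h1 h2
      rw [dual_triple] at h2
      by_cases h3 : φ i (0, 1, 0) = 0
      · refine ⟨?_, h3⟩
        simpa [h3] using h2
      · refine absurd ?_ h1
        field_simp
        linear_combination h2
    refine ⟨t, fun i hi0 => ?_⟩
    rcases hi i with h | rfl | rfl
    · exact absurd h hi0
    · exact key _ ht1
    · exact key _ ht2
  set R := P + t • w with hR
  have hRP : f R = f P := hconst R (Submodule.mem_span_pair.mpr ⟨1, t, by rw [one_smul]⟩)
    fun h0 => by simpa using (hPw 1 t (by rw [one_smul]; exact h0)).1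
  have hRx : ∀ x : F, x • R + κ = x • P + (x * t) • w + κ := fun x => by rw [hR]; module
  have hle : cnt F f R κ ≤ 2 := by
    have hsub : (Finset.univ.filter fun x : F => f (x • R + κ) ≠ 0).card ≤
        ((Finset.univ.erase i₀).image fun i => -(φ i (0, 0, 1) / φ i (1, t, 0))).card := by
      refine Finset.card_le_card fun x hx => ?_
      have hx := (Finset.mem_filter.mp hx).2
      rw [hRx] at hx
      obtain ⟨i, hi⟩ := hcov x (x * t) 1 (by simp) (by simpa using hx)
      rw [dual_triple] at hi
      have hii : i ≠ i₀ := by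
        rintro rfl
        rw [hi1, hi2] at hi
        simp [hi3] at hi
      refine Finset.mem_image.mpr ⟨i, by simp [hii], ?_⟩
      have hne : φ i (1, t, 0) ≠ 0 := fun h => by
        obtain ⟨h1, h2⟩ := ht i hii h
        rw [h1, h2] at hi
        refine hφ i (LinearMap.ext fun ⟨x, y, z⟩ => ?_)
        rw [dual_triple, h1, h2]
        simp at hi
        simp [hi]
      rw [neg_eq_iff_eq_neg, div_eq_iff hne, dual_triple (φ i) 1 t 0]
      linear_combination hi
    refine hsub.trans (Finset.card_image_le.trans ?_)
    rw [Finset.card_erase_of_mem (Finset.mem_univ _)]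
    simp
  have hge : 0 < cnt F f R κ := Finset.card_pos.mpr
    ⟨0, Finset.mem_filter.mpr ⟨Finset.mem_univ _, by simpa using hfκ⟩⟩
  have hs := line_sum (F := F) S.mem R κ
  rw [h0, hRP, sub_self, ← Finset.sum_filter_ne_zero, Finset.sum_congr rfl (g := fun _ => f P)
    fun x hx => ?_, Finset.sum_const, nsmul_eq_mul] at hs
  · have h5 : ((cnt F f R κ : ℕ) : ZMod p) = 0 := by
      refine (mul_eq_zero.mp ?_).resolve_right hP
      rw [← hs]; unfold cnt; congr
    have h6 := (ZMod.natCast_eq_zero_iff _ _).mp h5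
    have := (Fact.out : p.Prime).two_le
    have := Nat.le_of_dvd hge h6
    omega
  · have hx := (Finset.mem_filter.mp hx).2
    rw [hRx] at hx ⊢
    exact hval _ _ hx

end Transversal

theorem zmod_two_eq_one {a : ZMod 2} (ha : a ≠ 0) : a = 1 := by
  fin_cases a
  · exact absurd rfl ha
  · rfl

section Codimension

variable {V : Type} [AddCommGroup V] [Module F V] {p : ℕ} [Fintype F] [Fact p.Prime]
  [Algebra (ZMod p) F] {f : V → ZMod p} [Fintype V] {n : ℕ}

theorem IsForm.exists_dual {g : V → F} (h : IsForm 1 g) :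
    ∃ X : Module.Dual F V, ∀ v, X v = g v := by
  have hlin : ∀ u w (t : F), g (u + t • w) = g u + t * g w := by
    intro u w t
    obtain ⟨P, h1, h2, hP3⟩ := h u w
    have h4 := Polynomial.eq_X_add_C_of_natDegree_le_one h1
    have h5 := hP3 0
    have h6 := hP3 t
    rw [zero_smul, add_zero] at h5
    rw [← h6, ← h5, ← h2, h4]
    simp
    ring
  have hz : g 0 = 0 := by simpa using hlin 0 0 1
  exact ⟨{  toFun := g
            map_add' := fun u w => by simpa using hlin u w 1
            map_smul' := fun t w => by simpa [hz] using hlin 0 w t }, fun _ => rfl⟩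

/-- Binary words: a point off the center space with vanishing first moment is a center. -/
theorem Sparse.ctr_of_even (S : Sparse F n f) {R : V} (hR0 : R ≠ 0) (hR : f R ≠ 0)
    (h0 : f 0 = f R) (heven : ∀ v, Even (cnt F f R v))
    (h1 : ∀ v, mom (F := F) f R 1 v = 0) : Ctr F f R := by
  have h37 := S.le_card
  rcases cone_or_moment S.mem (by omega) h0 with hc | ⟨m, hm1, hm2, hm3, v, hv⟩
  · exact fun m hm v => mom_of_affine (a := algebraMap (ZMod p) F (f v)) (b := 0)
      (fun x => by rw [hc]; simp) hm
  · rcases Nat.lt_or_ge (m + 2) 𝔮 with hlt | hge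
    · refine absurd (S.form_eq_zero (R := R) (mom_isForm S.mem R (by omega)) (fun w hw => ?_)
        (Or.inl hlt) v) hv
      have hm : 2 ≤ m := by
        rcases hm1.lt_or_eq with h | rfl
        · exact h
        · exact absurd (h1 w) hw
      have h2 := cnt_ge_of_mom (fun j hj => hm3 j hj w) hw
      refine ⟨ind_of_notMem hR0 fun hmem => hw (mom_span S.mem h0 (by omega) hmem), ?_⟩
      obtain ⟨k, hk⟩ := heven w
      rw [tot_eq_cnt_add_one hR]
      omega
    · exact fun j hj v => hm3 j (by omega) v

theorem Sparse.covered_of_codim (S : Sparse F n f)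
    (hcod : ∀ x y, S.centers ⊔ Submodule.span F {x, y} ≠ ⊤) {P : V} (hP : f P ≠ 0)
    (hPc : P ∉ S.centers) : Covered F 3 f := by
  by_contra hnc
  have h37 := S.le_card
  obtain ⟨h0, rfl⟩ := S.char_two hnc hcod hP hPc
  have hP0 : P ≠ 0 := fun h => hPc (by rw [h]; exact S.centers.zero_mem)
  have heven : ∀ v, Even (cnt F f P v) := by
    intro v
    have hs := line_sum (F := F) S.mem P v
    rw [h0, sub_self, ← Finset.sum_filter_ne_zero, Finset.sum_congr rfl (g := fun _ => 1)
      fun x hx => zmod_two_eq_one (Finset.mem_filter.mp hx).2, Finset.sum_const, nsmul_one] at hs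
    rw [even_iff_two_dvd, ← ZMod.natCast_eq_zero_iff, ← hs]
    unfold cnt
    congr
  obtain ⟨X, hX⟩ := (mom_isForm S.mem P (m := 1) (by omega)).exists_dual
  have hX0 : X ≠ 0 := by
    rintro rfl
    exact hPc (S.mem_centers.mpr (S.ctr_of_even hP0 hP h0 heven fun v => by rw [← hX]; simp))
  set M := S.centers ⊔ Submodule.span F {P} with hM
  have hker : ∀ y, X y = 0 → y ∉ M → f y = f P := by
    intro y hXy hy
    obtain ⟨z, hXz, hz⟩ : ∃ z, X z ≠ 0 ∧ z ∉ S.centers ⊔ Submodule.span F {P, y} := by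
      obtain ⟨z₀, hz0⟩ := SetLike.exists_not_mem_of_ne_top _ (hcod P y) rfl
      obtain ⟨z₁, hz1⟩ : ∃ z, X z ≠ 0 := by
        by_contra hcon
        push Not at hcon
        exact hX0 (LinearMap.ext hcon)
      by_cases h1 : X z₀ = 0
      · by_cases h2 : z₁ ∈ S.centers ⊔ Submodule.span F {P, y}
        · refine ⟨z₀ + z₁, by rw [map_add, h1, zero_add]; exact hz1, ?_⟩
          rwa [Submodule.add_mem_iff_left _ h2]
        · exact ⟨z₁, hz1, h2⟩
      · exact ⟨z₀, h1, hz0⟩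
    obtain ⟨c, d, hcd, -, -, hconst⟩ := S.exists_const hnc (indMod_of_notMem hPc hy hz) hP
    have hy0 : y ≠ 0 := fun h => hy (by rw [h]; exact M.zero_mem)
    have hne : ∀ x : F, x • P + (c • y + d • z) ≠ 0 := by
      intro x h
      obtain ⟨-, h2, h3⟩ := indMod_of_notMem hPc hy hz x c d (by
        rw [add_assoc, h]; exact Submodule.zero_mem _)
      rw [h2, h3] at hcd
      simp at hcd
    have hm : mom (F := F) f P 1 (c • y + d • z) = 0 :=
      mom_of_affine (a := algebraMap (ZMod 2) F (f P)) (b := 0) (fun x => by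
        rw [hconst _ (Submodule.mem_span_pair.mpr ⟨x, 1, by rw [one_smul]⟩) (hne x)]
        simp) (by omega)
    rw [← hX, map_add, map_smul, map_smul, hXy, smul_zero, zero_add, smul_eq_mul] at hm
    have hd := (mul_eq_zero.mp hm).resolve_right hXz
    subst hd
    have hc : c ≠ 0 := by simpa using hcd
    refine hconst y (Submodule.mem_span_pair.mpr ⟨0, c⁻¹, ?_⟩) hy0
    rw [zero_smul, zero_add, zero_smul, add_zero, smul_smul, inv_mul_cancel₀ hc, one_smul]
  refine hnc (Covered.of_sub_hyp (a := f P) hX0 (covered_two_of_lt (n := n + 2) (by omega)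
    (sub_mem S.mem (Submodule.smul_mem _ _ (hyp_mem X))) S.card_space ?_))
  have h1 : wtv (f - f P • hyp 2 X) + (Finset.univ.filter fun v : V => X v = 0).card ≤
      wtv f + 2 * (Finset.univ.filter fun v : V => v ∈ M).card := by
    unfold wtv
    have e1 : (Finset.univ.filter fun v : V => v ≠ 0 ∧ (f - f P • hyp 2 X) v ≠ 0).card ≤
        ((Finset.univ.filter fun v : V => v ≠ 0 ∧ f v ≠ 0) \
          (Finset.univ.filter fun v : V => X v = 0 ∧ v ∉ M)).card +
        (Finset.univ.filter fun v : V => v ∈ M).card := by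
      refine (Finset.card_le_card fun v hv => ?_).trans (Finset.card_union_le _ _)
      obtain ⟨hv0, hv⟩ := (Finset.mem_filter.mp hv).2
      by_cases hvM : v ∈ M
      · exact Finset.mem_union_right _ (Finset.mem_filter.mpr ⟨Finset.mem_univ _, hvM⟩)
      · refine Finset.mem_union_left _ (Finset.mem_sdiff.mpr ⟨Finset.mem_filter.mpr
          ⟨Finset.mem_univ _, hv0, fun h => hv ?_⟩, fun h => hv ?_⟩)
        · have hXv : X v ≠ 0 := fun h' => hP (by rw [← hker v h' hvM, h])
          simp [hyp, hXv, h]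
        · have hXv := (Finset.mem_filter.mp h).2.1
          simp [hyp, hXv, hker v hXv hvM]
    have e2 : (Finset.univ.filter fun v : V => X v = 0).card ≤
        (Finset.univ.filter fun v : V => X v = 0 ∧ v ∉ M).card +
        (Finset.univ.filter fun v : V => v ∈ M).card := by
      refine (Finset.card_le_card fun v hv => ?_).trans (Finset.card_union_le _ _)
      have hv := (Finset.mem_filter.mp hv).2
      by_cases hvM : v ∈ M
      · exact Finset.mem_union_right _ (Finset.mem_filter.mpr ⟨Finset.mem_univ _, hvM⟩)
      · exact Finset.mem_union_left _ (Finset.mem_filter.mpr ⟨Finset.mem_univ _, hv, hvM⟩)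
    have e3 := Finset.card_sdiff_add_card_eq_card (s := Finset.univ.filter fun v : V =>
      X v = 0 ∧ v ∉ M) (t := Finset.univ.filter fun v : V => v ≠ 0 ∧ f v ≠ 0) (by
        intro v hv
        obtain ⟨h1, h2⟩ := (Finset.mem_filter.mp hv).2
        refine Finset.mem_filter.mpr ⟨Finset.mem_univ _, fun h => h2 ?_, ?_⟩
        · rw [h]; exact M.zero_mem
        · rw [hker v h1 h2]; exact hP)
    omega
  have h2 : 𝔮 * (𝔮 * (Finset.univ.filter fun v : V => v ∈ M).card) ≤ 𝔮 ^ (n + 4) := by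
    rw [← S.card_space]
    obtain ⟨y, hy⟩ := SetLike.exists_not_mem_of_ne_top M (by simpa [hM] using hcod P P) rfl
    refine (Nat.mul_le_mul_left _ (card_mul_le_sup hy)).trans (card_mul_le_of_ne_top ?_)
    rw [hM, sup_assoc, ← Submodule.span_union]
    exact hcod P y
  have h3 := card_ker_dual hX0
  rw [S.card_space] at h3
  have h4 := S.wtv_le
  have h5 : (Finset.univ.filter fun v : V => X v = 0).card = 𝔮 ^ (n + 3) :=
    Nat.eq_of_mul_eq_mul_left (show 0 < 𝔮 by omega) (by rw [h3]; ring)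
  have h6 : (Finset.univ.filter fun v : V => v ∈ M).card ≤ 𝔮 ^ (n + 2) :=
    Nat.le_of_mul_le_mul_left (c := 𝔮 * 𝔮) (by
      rw [mul_assoc]; refine h2.trans (le_of_eq ?_); ring) (by positivity)
  rw [h5] at h1
  have h7 : 𝔮 ^ (n + 3) = 𝔮 * 𝔮 * 𝔮 ^ (n + 1) := by ring
  have h8 : 𝔮 ^ (n + 2) = 𝔮 * 𝔮 ^ (n + 1) := by ring
  have h9 : 0 < 𝔮 ^ (n + 1) := by positivity
  rw [h7] at h1
  rw [h8] at h6 ⊢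
  generalize wtv (f - f P • hyp 2 X) = a at *
  generalize wtv f = b at *
  generalize (Finset.univ.filter fun v : V => v ∈ M).card = μ at *
  clear h2 h3 h5 h7 h8
  generalize 𝔮 ^ (n + 1) = Q at *
  generalize 𝔮 = k at *
  obtain ⟨k, rfl⟩ := Nat.exists_eq_add_of_le h37
  rw [show 37 + k - 1 = 36 + k by omega, show 4 * (37 + k) - 33 = 115 + 4 * k by omega] at h4
  rw [show 37 + k - 2 = 35 + k by omega]
  nlinarith [Nat.zero_le (k * Q), Nat.zero_le (k * k * Q)]

end Codimension

section LargeCenter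

variable {V : Type} [AddCommGroup V] [Module F V] {p : ℕ} [Fintype F] [Fact p.Prime]
  [Algebra (ZMod p) F] {f : V → ZMod p} [Fintype V] {n : ℕ}

theorem card_sup_le (M : Submodule F V) (y : V) :
    (Finset.univ.filter fun v : V => v ∈ M ⊔ Submodule.span F {y}).card ≤
      𝔮 * (Finset.univ.filter fun v : V => v ∈ M).card := by
  rw [← Finset.card_univ (α := F), ← Finset.card_product]
  refine Finset.card_le_card_of_surjOn (fun t => t.1 • y + t.2) fun v hv => ?_
  obtain ⟨m, hm, w, hw, rfl⟩ := Submodule.mem_sup.mp (Finset.mem_filter.mp hv).2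
  obtain ⟨t, rfl⟩ := Submodule.mem_span_singleton.mp hw
  exact ⟨(t, m), by simpa using hm, by simp [add_comm]⟩

theorem Ctr.cnt_ge {R v : V} (h : Ctr F f R) (h3 : 3 ≤ 𝔮) (hv : f v ≠ 0) :
    𝔮 ≤ cnt F f R v + 1 := by
  obtain ⟨a, b, hab⟩ := h.affine h3 v
  have ha : a ≠ 0 := by
    have := hab 0
    rw [zero_smul, zero_add, mul_zero, add_zero] at this
    rw [← this]
    exact (algebraMap_ne_zero_iff _).mpr hv
  have h1 : (Finset.univ.filter fun x : F => ¬ f (x • R + v) ≠ 0) ⊆ {-(a / b)} := by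
    intro x hx
    have hx := (Finset.mem_filter.mp hx).2
    have h2 := hab x
    rw [not_not.mp hx, map_zero] at h2
    have hb : b ≠ 0 := by rintro rfl; exact ha (by simpa using h2.symm)
    rw [Finset.mem_singleton]
    field_simp
    linear_combination -h2
  have h2 := Finset.card_filter_add_card_filter_not (s := (Finset.univ : Finset F))
    (fun x : F => f (x • R + v) ≠ 0)
  have h4 := Finset.card_le_card h1
  rw [Finset.card_univ] at h2
  rw [Finset.card_singleton] at h4
  unfold cnt
  convert (show 𝔮 ≤ (Finset.univ.filter fun x : F => f (x • R + v) ≠ 0).card + 1 by omega)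

theorem card_coset_ge {M : Submodule F V} (hM : ∀ R ∈ M, Ctr F f R) (h3 : 3 ≤ 𝔮) {v : V}
    (hv : f v ≠ 0) : (𝔮 - 2) * (Finset.univ.filter fun w : V => w ∈ M).card ≤
      (𝔮 - 1) * (Finset.univ.filter fun w : V => w ∈ M ∧ f (v + w) ≠ 0).card := by
  set A := Finset.univ.filter fun w : V => w ∈ M with hA
  set N := Finset.univ.filter fun w : V => w ∈ M ∧ f (v + w) ≠ 0 with hN
  have h1 : A.card * (𝔮 - 1) ≤ ∑ R ∈ A, cnt F f R v := by
    rw [← smul_eq_mul, ← Finset.sum_const]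
    refine Finset.sum_le_sum fun R hR => ?_
    have := (hM R (Finset.mem_filter.mp hR).2).cnt_ge h3 hv
    omega
  have h2 : ∑ R ∈ A, cnt F f R v =
      ∑ x : F, (A.filter fun R => f (x • R + v) ≠ 0).card := by
    simp only [cnt, Finset.card_filter]
    rw [Finset.sum_comm]
  have h3' : ∀ x ∈ Finset.univ.erase (0 : F),
      (A.filter fun R => f (x • R + v) ≠ 0).card ≤ N.card := by
    intro x hx
    have hx0 := Finset.ne_of_mem_erase hx
    refine Finset.card_le_card_of_injOn (fun R => x • R) (fun R hR => ?_)
      fun R _ R' _ h => smul_right_injective V hx0 h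
    obtain ⟨h1, h2⟩ := Finset.mem_filter.mp (Finset.mem_coe.mp hR)
    refine Finset.mem_coe.mpr (Finset.mem_filter.mpr ⟨Finset.mem_univ _, M.smul_mem _
      (Finset.mem_filter.mp h1).2, ?_⟩)
    rwa [add_comm]
  rw [h2, ← Finset.add_sum_erase _ _ (Finset.mem_univ (0 : F))] at h1
  have h4 := Finset.sum_le_card_nsmul _ _ _ h3'
  rw [Finset.card_erase_of_mem (Finset.mem_univ _), Finset.card_univ, smul_eq_mul] at h4
  have h5 := Finset.card_filter_le A fun R => f ((0 : F) • R + v) ≠ 0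
  obtain ⟨k, hk⟩ := Nat.exists_eq_add_of_le h3
  rw [hk] at h1 h4 ⊢
  rw [show 3 + k - 1 = 2 + k by omega] at *
  rw [show 3 + k - 2 = 1 + k by omega]
  nlinarith

end LargeCenter

section SparseCovered

variable {V : Type} [AddCommGroup V] [Module F V] {p : ℕ} [Fintype F] [Fact p.Prime]
  [Algebra (ZMod p) F] {f : V → ZMod p} [Fintype V] {n : ℕ}

theorem covered_of_support_le {M : Submodule F V} (hM : M ≠ ⊤) (h : ∀ v, f v ≠ 0 → v ∈ M) (t : ℕ) :
    Covered F (t + 1) f := by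
  obtain ⟨x, hx⟩ := SetLike.exists_not_mem_of_ne_top M hM rfl
  obtain ⟨φ, h1, h2⟩ := Submodule.exists_le_ker_of_notMem hx
  exact ⟨fun _ => φ, fun _ hφ => h1 (DFunLike.congr_fun hφ x), fun v _ hfv => ⟨0, h2 (h v hfv)⟩⟩

/-- The `F`-multiples of a coset of the space of centers contribute to the weight. -/
theorem Sparse.card_scaled_coset (S : Sparse F n f) {v : V} (hv : v ∉ S.centers) (hfv : f v ≠ 0) :
    (𝔮 - 2) * (Finset.univ.filter fun w : V => w ∈ S.centers).card ≤
      (Finset.univ.filter fun u : V => f u ≠ 0 ∧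
        ∃ μ : F, μ ≠ 0 ∧ ∃ w ∈ S.centers, μ • (v + w) = u).card := by
  have h37 := S.le_card
  refine (card_coset_ge (fun R hR => S.mem_centers.mp hR) (by omega) hfv).trans ?_
  have h1 : 𝔮 - 1 = ((Finset.univ : Finset F).erase 0).card := by
    rw [Finset.card_erase_of_mem (Finset.mem_univ _), Finset.card_univ]
  rw [h1, ← Finset.card_product]
  refine Finset.card_le_card_of_injOn (fun t => t.1 • (v + t.2)) (fun t ht => ?_) ?_
  · obtain ⟨h2, h3⟩ := Finset.mem_product.mp (Finset.mem_coe.mp ht)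
    obtain ⟨h4, h5⟩ := (Finset.mem_filter.mp h3).2
    have h6 := Finset.ne_of_mem_erase h2
    exact Finset.mem_coe.mpr (Finset.mem_filter.mpr ⟨Finset.mem_univ _,
      by rwa [lcode_smul S.mem h6], _, h6, _, h4, rfl⟩)
  · rintro ⟨t, m⟩ ht ⟨t', m'⟩ ht' h
    obtain ⟨h2, h3⟩ := Finset.mem_product.mp (Finset.mem_coe.mp ht)
    obtain ⟨h2', h3'⟩ := Finset.mem_product.mp (Finset.mem_coe.mp ht')
    have h4 := (Finset.mem_filter.mp h3).2.1
    have h4' := (Finset.mem_filter.mp h3').2.1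
    have h6 := Finset.ne_of_mem_erase h2
    simp only at h h4 h4' h6
    have h7 : t - t' = 0 := by
      refine smul_eq_zero_of_add_mem hv (sub_mem (S.centers.smul_mem t h4)
        (S.centers.smul_mem t' h4')) ?_
      have : (t - t') • v + (t • m - t' • m') = 0 := by
        rw [smul_add, smul_add] at h
        rw [sub_smul, sub_add_sub_comm, h, sub_self]
      rw [this]; exact S.centers.zero_mem
    obtain rfl := sub_eq_zero.mp h7
    have := smul_right_injective V h6 h
    simpa using this

theorem Sparse.wtv_ge (S : Sparse F n f) {k : ℕ} (v : Fin k → V)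
    (hv : ∀ i, v i ∉ S.centers ∧ f (v i) ≠ 0) (φ : Fin k → Module.Dual F V)
    (hφ : ∀ i, (∀ w ∈ S.centers, φ i w = 0) ∧ φ i (v i) = 0)
    (hij : ∀ i j, i < j → φ i (v j) ≠ 0) :
    k * ((𝔮 - 2) * (Finset.univ.filter fun w : V => w ∈ S.centers).card) ≤ wtv f := by
  have key : ∀ i j (μ μ' : F) w w', i < j → μ' ≠ 0 → w ∈ S.centers → w' ∈ S.centers →
      μ • (v i + w) ≠ μ' • (v j + w') := by
    intro i j μ μ' w w' hlt hμ' hw hw' h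
    have := congrArg (φ i) h
    rw [map_smul, map_smul, map_add, map_add, (hφ i).2, (hφ i).1 _ hw, (hφ i).1 _ hw', add_zero,
      add_zero, smul_zero, smul_eq_mul] at this
    exact mul_ne_zero hμ' (hij i j hlt) this.symm
  calc k * ((𝔮 - 2) * (Finset.univ.filter fun w : V => w ∈ S.centers).card)
      ≤ ∑ i : Fin k, (Finset.univ.filter fun u : V => f u ≠ 0 ∧
        ∃ μ : F, μ ≠ 0 ∧ ∃ w ∈ S.centers, μ • (v i + w) = u).card := by
        have := Finset.card_nsmul_le_sum (Finset.univ : Finset (Fin k)) _ _ fun i _ =>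
          S.card_scaled_coset (hv i).1 (hv i).2
        simpa using this
    _ ≤ wtv f := by
        rw [← Finset.card_biUnion]
        · refine Finset.card_le_card fun u hu => ?_
          obtain ⟨i, -, hi⟩ := Finset.mem_biUnion.mp hu
          obtain ⟨h1, μ, h2, w, h3, h4⟩ := (Finset.mem_filter.mp hi).2
          refine Finset.mem_filter.mpr ⟨Finset.mem_univ _, fun h0 => (hv i).1 ?_, h1⟩
          rw [h0, smul_eq_zero] at h4
          rw [eq_neg_of_add_eq_zero_left (h4.resolve_left h2)]
          exact neg_mem h3
        · intro i _ j _ hne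
          rw [Function.onFun, Finset.disjoint_left]
          intro u hu hu'
          obtain ⟨-, μ, h2, w, h3, h4⟩ := (Finset.mem_filter.mp hu).2
          obtain ⟨-, μ', h2', w', h3', h4'⟩ := (Finset.mem_filter.mp hu').2
          rcases lt_or_gt_of_ne hne with h | h
          · exact key i j μ μ' w w' h h2' h3 h3' (h4.trans h4'.symm)
          · exact key j i μ' μ w' w h h2 h3' h3 (h4'.trans h4.symm)

theorem Sparse.covered_of_codim_two (S : Sparse F n f) {x y : V}
    (hxy : S.centers ⊔ Submodule.span F {x, y} = ⊤) (hne : S.centers ≠ ⊤) : Covered F 3 f := by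
  have h37 := S.le_card
  by_cases hout : ∃ v, v ∉ S.centers ∧ f v ≠ 0
  swap
  · push Not at hout
    exact covered_of_support_le hne (fun v hv => by_contra fun h => hv (hout v h)) 2
  set A := (Finset.univ.filter fun w : V => w ∈ S.centers).card with hA
  have htop : ∀ M : Submodule F V, M = ⊤ →
      (Finset.univ.filter fun w : V => w ∈ M).card = 𝔮 ^ (n + 4) := by
    rintro M rfl
    rw [← S.card_space]
    simp
  have h4 := S.wtv_le
  have hk : 0 < 𝔮 ^ (n + 1) := by positivity
  have hsup : ∀ v, v ∉ S.centers → f v ≠ 0 → S.centers ⊔ Submodule.span F {v} ≠ ⊤ := by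
    intro v hv hfv ht
    have h1 := card_sup_le S.centers v
    rw [htop _ ht, ← hA] at h1
    have h2 : 1 * ((𝔮 - 2) * A) ≤ wtv f := S.wtv_ge (fun _ : Fin 1 => v) (fun _ => ⟨hv, hfv⟩)
      (fun _ => 0) (fun _ => ⟨fun _ _ => rfl, rfl⟩) (by intro i j h; omega)
    have h3 : 𝔮 ^ (n + 3) ≤ A := Nat.le_of_mul_le_mul_left (c := 𝔮)
      (by rw [← pow_succ']; exact h1) (by omega)
    rw [show 𝔮 ^ (n + 3) = 𝔮 * 𝔮 * 𝔮 ^ (n + 1) by ring] at h3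
    clear h1
    generalize 𝔮 ^ (n + 1) = Q at *
    generalize wtv f = b at *
    clear_value A
    generalize 𝔮 = k at *
    obtain ⟨k, rfl⟩ := Nat.exists_eq_add_of_le h37
    rw [show 37 + k - 1 = 36 + k by omega, show 4 * (37 + k) - 33 = 115 + 4 * k by omega] at h4
    rw [show 37 + k - 2 = 35 + k by omega] at h2
    have h5 := Nat.mul_le_mul_left (35 + k) h3
    nlinarith [Nat.zero_le (k * Q), Nat.zero_le (k * k * Q), Nat.zero_le (k * k * k * Q)]
  obtain ⟨v₀, hv0, hfv0⟩ := hout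
  have hdual : ∀ v, v ∉ S.centers → f v ≠ 0 → ∃ φ : Module.Dual F V, φ ≠ 0 ∧ φ v = 0 ∧
      ∀ w ∈ S.centers, φ w = 0 := by
    intro v hv hfv
    obtain ⟨z, hz⟩ := SetLike.exists_not_mem_of_ne_top _ (hsup v hv hfv) rfl
    obtain ⟨φ, h1, h2⟩ := Submodule.exists_le_ker_of_notMem hz
    exact ⟨φ, fun h => h1 (by rw [h]; rfl),
      h2 (Submodule.mem_sup_right (Submodule.mem_span_singleton_self v)),
      fun w hw => h2 (Submodule.mem_sup_left hw)⟩
  rcases covered_of_greedy (F := F) (f := f) (P := fun _ φ => (∀ w ∈ S.centers, φ w = 0) ∧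
      ∃ v, v ∉ S.centers ∧ f v ≠ 0 ∧ φ v = 0) ⟨v₀, fun h => hv0 (by
        rw [h]; exact S.centers.zero_mem)⟩ (fun v _ hfv => by
      by_cases hv : v ∈ S.centers
      · obtain ⟨φ, h1, h2, h3⟩ := hdual v₀ hv0 hfv0
        exact ⟨φ, h1, h3 v hv, h3, v₀, hv0, hfv0, h2⟩
      · obtain ⟨φ, h1, h2, h3⟩ := hdual v hv hfv
        exact ⟨φ, h1, h2, h3, v, hv, hfv, h2⟩) with h |
    ⟨v₁, v₂, v₃, v₄, φ₁, φ₂, φ₃, ⟨-, f2, f3, f4⟩, ⟨-, g2, g3⟩, ⟨⟨p1, v, hv, hfv, hφv⟩, ⟨p2, -⟩, ⟨p3, -⟩⟩,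
      ⟨a2, a3, a4⟩, ⟨b3, b4⟩, c4⟩
  · exact h
  exfalso
  obtain ⟨φ₄, -, h42, h43⟩ := hdual v₄ (fun h => a4 (p1 _ h)) f4
  have h2 : 4 * ((𝔮 - 2) * A) ≤ wtv f := by
    refine S.wtv_ge ![v, v₂, v₃, v₄] ?_ ![φ₁, φ₂, φ₃, φ₄] ?_ ?_
    · simp only [Fin.forall_fin_succ]
      exact ⟨⟨hv, hfv⟩, ⟨fun h => a2 (p1 _ h), f2⟩, ⟨fun h => a3 (p1 _ h), f3⟩,
        ⟨fun h => a4 (p1 _ h), f4⟩, fun i => i.elim0⟩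
    · simp only [Fin.forall_fin_succ]
      exact ⟨⟨p1, hφv⟩, ⟨p2, g2⟩, ⟨p3, g3⟩, ⟨h43, h42⟩, fun i => i.elim0⟩
    · intro i j hij
      fin_cases i <;> fin_cases j <;> first | exact absurd hij (by decide) | assumption
  have h1 : 𝔮 ^ (n + 4) ≤ 𝔮 * (𝔮 * A) := by
    rw [← htop _ hxy]
    refine le_trans (le_of_eq ?_) ((card_sup_le (S.centers ⊔ Submodule.span F {x}) y).trans
      (Nat.mul_le_mul_left _ (card_sup_le S.centers x)))
    rw [sup_assoc, ← Submodule.span_union]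
    rfl
  have h3 : 𝔮 ^ (n + 2) ≤ A := Nat.le_of_mul_le_mul_left (c := 𝔮 * 𝔮)
    (by rw [mul_assoc 𝔮 𝔮 A]; refine le_trans (le_of_eq ?_) h1; ring) (by positivity)
  rw [show 𝔮 ^ (n + 2) = 𝔮 * 𝔮 ^ (n + 1) by ring] at h3
  clear h1
  generalize 𝔮 ^ (n + 1) = Q at *
  generalize wtv f = b at *
  clear_value A
  generalize 𝔮 = k at *
  obtain ⟨k, rfl⟩ := Nat.exists_eq_add_of_le h37
  rw [show 37 + k - 1 = 36 + k by omega, show 4 * (37 + k) - 33 = 115 + 4 * k by omega] at h4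
  rw [show 37 + k - 2 = 35 + k by omega] at h2
  have h5 := Nat.mul_le_mul_left (35 + k) h3
  nlinarith [Nat.zero_le (k * Q), Nat.zero_le (k * k * Q)]

theorem Sparse.covered (S : Sparse F n f) : Covered F 3 f := by
  have h37 := S.le_card
  by_cases hcod : ∀ x y, S.centers ⊔ Submodule.span F {x, y} ≠ ⊤
  · by_cases hout : ∃ v, f v ≠ 0 ∧ v ∉ S.centers
    · obtain ⟨P, hP, hPc⟩ := hout
      exact S.covered_of_codim hcod hP hPc
    · push Not at hout
      exact covered_of_support_le (by simpa using hcod 0 0) hout 2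
  · push Not at hcod
    obtain ⟨x, y, hxy⟩ := hcod
    by_cases htop : S.centers = ⊤
    · have hc : ∀ v, f v = f 0 := fun v =>
        ((S.mem_centers.mp (htop ▸ Submodule.mem_top : v ∈ S.centers)).apply_eq (by omega)
          S.mem).symm
      by_cases h0 : f 0 = 0
      · exact covered_of_vanish (f := f) (n := n + 3) S.card_space (fun v _ => by rw [hc, h0]) 3
      · exfalso
        have h1 := nz_eq (f := f)
        have h2 : nz f = 𝔮 ^ (n + 4) := by
          rw [← S.card_space, ← Finset.card_univ]
          unfold nz
          congr 1
          exact Finset.filter_true_of_mem fun v _ => by rw [hc]; exact h0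
        rw [h2, if_pos h0] at h1
        have h4 := S.wtv_le
        have hk : 0 < 𝔮 ^ (n + 1) := by positivity
        rw [show 𝔮 ^ (n + 4) = 𝔮 * 𝔮 * 𝔮 * 𝔮 ^ (n + 1) by ring] at h1
        clear h2
        generalize 𝔮 ^ (n + 1) = Q at *
        generalize wtv f = b at *
        generalize 𝔮 = k at *
        obtain ⟨k, rfl⟩ := Nat.exists_eq_add_of_le h37
        rw [show 37 + k - 1 = 36 + k by omega,
          show 4 * (37 + k) - 33 = 115 + 4 * k by omega] at h4
        nlinarith [Nat.zero_le (k * Q), Nat.zero_le (k * k * Q), Nat.zero_le (k * k * k * Q)]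
    · exact S.covered_of_codim_two hxy htop

end SparseCovered

section Conversion

variable [Fintype F] {p n : ℕ} [Fact p.Prime]

theorem ptIn_mk {W : Submodule F (Fin (n + 1) → F)} {v : Fin (n + 1) → F} (hv : v ≠ 0) :
    ptIn (Projectivization.mk F v hv) W ↔ v ∈ W := by
  simp [ptIn, Projectivization.submodule_mk]

theorem ptsIn_eq_range (W : Submodule F (Fin (n + 1) → F)) :
    ptsIn W = Set.range (Projectivization.map W.subtype W.injective_subtype) := by
  ext P
  induction P using Projectivization.ind with
  | h v hv =>
    constructor
    · intro h
      have hvW : v ∈ W := (ptIn_mk hv).1 h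
      exact ⟨Projectivization.mk F ⟨v, hvW⟩ (by simpa using hv), by simp [Projectivization.map_mk]⟩
    · rintro ⟨Q, hQ⟩
      rw [← hQ]
      induction Q using Projectivization.ind with
      | h w hw =>
        rw [Projectivization.map_mk]
        exact (ptIn_mk _).2 w.2

theorem ncard_ptsIn (W : Submodule F (Fin (n + 1) → F)) :
    (ptsIn W).ncard = ∑ i ∈ Finset.range (Module.finrank F W), 𝔮 ^ i := by
  rw [ptsIn_eq_range, ← Set.image_univ, Set.ncard_image_of_injective _
    (Projectivization.map_injective _ _), Set.ncard_univ,
    Projectivization.card_of_finrank F W rfl]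
  simp

theorem ncard_ptsIn_line {l : Submodule F (Fin (n + 1) → F)} (hl : Module.finrank F l = 2) :
    (ptsIn l).ncard = 𝔮 + 1 := by
  rw [ncard_ptsIn, hl]
  simp [Finset.sum_range_succ]
  ring

theorem finrank_inf_ker (W : Submodule F (Fin (n + 1) → F))
    {φ : Module.Dual F (Fin (n + 1) → F)} {v : Fin (n + 1) → F} (hv : v ∈ W) (h : φ v ≠ 0) :
    Module.finrank F ↥(W ⊓ LinearMap.ker φ) + 1 = Module.finrank F W := by
  have h1 : (φ.domRestrict W : Module.Dual F W) ≠ 0 := fun h0 =>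
    h (by simpa using LinearMap.congr_fun h0 ⟨v, hv⟩)
  rw [← Module.Dual.finrank_ker_add_one_of_ne_zero h1]
  congr 1
  have h2 : W ⊓ LinearMap.ker φ = (LinearMap.ker (φ.domRestrict W)).map W.subtype := by
    ext w
    simp only [Submodule.mem_inf, LinearMap.mem_ker, Submodule.mem_map]
    constructor
    · rintro ⟨hw, h⟩
      exact ⟨⟨w, hw⟩, by simpa using h, rfl⟩
    · rintro ⟨w', h, rfl⟩
      exact ⟨w'.2, by simpa using h⟩
  rw [h2, Submodule.finrank_map_subtype_eq]

theorem incVec_inf_ker {W : Submodule F (Fin (n + 1) → F)}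
    (φ : Module.Dual F (Fin (n + 1) → F)) {v : Fin (n + 1) → F} (hv : v ≠ 0) (hW : v ∈ W) :
    incVec p (W ⊓ LinearMap.ker φ) (Projectivization.mk F v hv) = hyp p φ v := by
  simp [incVec, ptIn_mk, hyp, hW]

theorem planeIsType_of_two_lines {c : Pt F n → ZMod p} {f : (Fin (n + 1) → F) → ZMod p}
    (hc : ∀ v hv, c (Projectivization.mk F v hv) = f v)
    {W : Submodule F (Fin (n + 1) → F)} (hW : IsPlane W)
    {φ ψ : Module.Dual F (Fin (n + 1) → F)} {u w : Fin (n + 1) → F} (hu : u ∈ W) (hw : w ∈ W)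
    (hφu : φ u ≠ 0) (hφw : φ w = 0) (hψw : ψ w ≠ 0) {a b : ZMod p}
    (hf : ∀ v ∈ W, f v = a * hyp p φ v + b * hyp p ψ v) :
    ∃ t, PlaneIsType p 𝔮 c W t := by
  unfold IsPlane at hW
  set l := W ⊓ LinearMap.ker φ with hl
  set m := W ⊓ LinearMap.ker ψ with hm
  have h1 := finrank_inf_ker W hu hφu
  have h2 := finrank_inf_ker W hw hψw
  have hwl : w ∈ l := ⟨hw, hφw⟩
  have h3 := finrank_inf_ker l hwl hψw
  rw [← hl] at h1
  rw [← hm] at h2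
  have hlm : l ⊓ LinearMap.ker ψ = l ⊓ m := by
    rw [hm, ← inf_assoc, inf_eq_left.2 (inf_le_left : l ≤ W)]
  rw [hlm] at h3
  have hl2 : IsLine l := by unfold IsLine; omega
  have hm2 : IsLine m := by unfold IsLine; omega
  have hcomb : ∀ P : Pt F n, ptIn P W → c P = a * incVec p l P + b * incVec p m P := by
    intro P hP
    induction P using Projectivization.ind with
    | h v hv =>
      have hvW := (ptIn_mk hv).1 hP
      rw [hc, hf v hvW, hl, hm, incVec_inf_ker φ hv hvW, incVec_inf_ker ψ hv hvW]
  have hT : TwoLineComb p c W := ⟨l, m, hl2, hm2, inf_le_left, inf_le_left, a, b, hcomb⟩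
  have hlW : ∀ P : Pt F n, ptIn P l → ptIn P W := fun P h => le_trans h inf_le_left
  have hmW : ∀ P : Pt F n, ptIn P m → ptIn P W := fun P h => le_trans h inf_le_left
  have hsupp : ptsIn W ∩ supp c = {P | (ptIn P l ∨ ptIn P m) ∧
      (if ptIn P l then a else 0) + (if ptIn P m then b else 0) ≠ 0} := by
    ext P
    simp only [ptsIn, supp, Set.mem_inter_iff, Set.mem_ofPred_eq]
    constructor
    · rintro ⟨hP, hne⟩
      rw [hcomb P hP] at hne
      simp only [incVec, mul_ite, mul_one, mul_zero] at hne
      refine ⟨?_, hne⟩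
      by_contra! hno
      simp [hno.1, hno.2] at hne
    · rintro ⟨hP, hne⟩
      have hPW : ptIn P W := hP.elim (hlW P) (hmW P)
      refine ⟨hPW, ?_⟩
      rw [hcomb P hPW]
      simpa only [incVec, mul_ite, mul_one, mul_zero] using hne
  have hcl : (ptsIn l).ncard = 𝔮 + 1 := ncard_ptsIn_line hl2
  have hcm : (ptsIn m).ncard = 𝔮 + 1 := ncard_ptsIn_line hm2
  have hci : (ptsIn l ∩ ptsIn m).ncard = 1 := by
    have : ptsIn l ∩ ptsIn m = ptsIn (l ⊓ m) := by
      ext P; simp [ptsIn, ptIn]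
    rw [this, ncard_ptsIn, show Module.finrank F ↥(l ⊓ m) = 1 by omega]
    simp
  have hcu := Set.ncard_union_add_ncard_inter (ptsIn l) (ptsIn m)
  by_cases ha : a = 0
  · by_cases hb : b = 0
    · refine ⟨.T0, hT, ?_⟩
      rw [wtRes, hsupp]
      simp [ha, hb]
    · refine ⟨.Tq1, hT, ?_⟩
      rw [wtRes, hsupp, ← hcm]
      congr 1
      ext P
      simpa [ha, hb, ptsIn] using Or.inr
  · by_cases hb : b = 0
    · refine ⟨.Tq1, hT, ?_⟩
      rw [wtRes, hsupp, ← hcl]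
      congr 1
      ext P
      simpa [ha, hb, ptsIn] using Or.inl
    · by_cases hab : a + b = 0
      · refine ⟨.T2q, hT, ?_⟩
        have : ptsIn W ∩ supp c = (ptsIn l ∪ ptsIn m) \ (ptsIn l ∩ ptsIn m) := by
          rw [hsupp]
          ext P
          simp only [ptsIn, Set.mem_sdiff, Set.mem_union, Set.mem_inter_iff, Set.mem_ofPred_eq]
          by_cases h1 : ptIn P l <;> by_cases h2 : ptIn P m <;> simp [h1, h2, ha, hb, hab]
        rw [wtRes, this, Set.ncard_sdiff (Set.inter_subset_left.trans Set.subset_union_left)]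
        omega
      · refine ⟨.T2q1, hT, ?_⟩
        have : ptsIn W ∩ supp c = ptsIn l ∪ ptsIn m := by
          rw [hsupp]
          ext P
          simp only [ptsIn, Set.mem_union, Set.mem_ofPred_eq]
          by_cases h1 : ptIn P l <;> by_cases h2 : ptIn P m <;> simp [h1, h2, ha, hb, hab]
        rw [wtRes, this]
        omega

theorem dual_frame_sum {φ : Fin 3 → Module.Dual F (Fin (n + 1) → F)}
    {b : Fin 3 → (Fin (n + 1) → F)} (hd : ∀ i j, φ i (b j) = if i = j then 1 else 0)
    (x : Fin 3 → F) (i : Fin 3) : φ i (∑ j, x j • b j) = x i := by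
  simp [hd]

theorem linearIndependent_of_dual_frame {φ : Fin 3 → Module.Dual F (Fin (n + 1) → F)}
    {b : Fin 3 → (Fin (n + 1) → F)} (hd : ∀ i j, φ i (b j) = if i = j then 1 else 0) :
    LinearIndependent F b := by
  rw [Fintype.linearIndependent_iff]
  intro x hx i
  rw [← dual_frame_sum hd x i, hx, map_zero]

theorem isPlane_of_dual_frame {φ : Fin 3 → Module.Dual F (Fin (n + 1) → F)}
    {b : Fin 3 → (Fin (n + 1) → F)} (hd : ∀ i j, φ i (b j) = if i = j then 1 else 0) :
    IsPlane (Submodule.span F (Set.range b)) := by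
  rw [IsPlane, finrank_span_eq_card (linearIndependent_of_dual_frame hd)]
  simp

theorem sum_mem_span (b : Fin 3 → (Fin (n + 1) → F)) (x : Fin 3 → F) :
    ∑ i, x i • b i ∈ Submodule.span F (Set.range b) :=
  Submodule.sum_mem _ fun i _ => Submodule.smul_mem _ _ (Submodule.subset_span ⟨i, rfl⟩)

theorem spaceIsType_of_frame {c : Pt F n → ZMod p} {f : (Fin (n + 1) → F) → ZMod p}
    (hc : ∀ v hv, c (Projectivization.mk F v hv) = f v)
    {φ : Fin 3 → Module.Dual F (Fin (n + 1) → F)}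
    {b : Fin 3 → (Fin (n + 1) → F)} (hd : ∀ i j, φ i (b j) = if i = j then 1 else 0)
    (hcone : ∀ v, f v = f (∑ i, φ i v • b i))
    {t : PlaneT} (ht : PlaneIsType p 𝔮 c (Submodule.span F (Set.range b)) t) :
    SpaceIsType p 𝔮 c (⊤ : Submodule F (Fin (n + 1) → F)) n t := by
  set W := Submodule.span F (Set.range b) with hWdef
  have hW : IsPlane W := isPlane_of_dual_frame hd
  set K : Submodule F (Fin (n + 1) → F) := ⨅ i, LinearMap.ker (φ i) with hK
  have hKmem : ∀ v, v ∈ K ↔ ∀ i, φ i v = 0 := by simp [hK]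
  have hdis : W ⊓ K = ⊥ := by
    rw [eq_bot_iff]
    rintro v ⟨hv, hvK⟩
    obtain ⟨x, rfl⟩ := (Submodule.mem_span_range_iff_exists_fun F).1 hv
    have : x = 0 := funext fun i => by
      rw [← dual_frame_sum hd x i]; exact (hKmem _).1 hvK i
    simp [this]
  have hdecomp : ∀ v, v - ∑ i, φ i v • b i ∈ K := fun v => (hKmem _).2 fun i => by
    rw [map_sub, dual_frame_sum hd (fun i => φ i v), sub_self]
  have hsup : W ⊔ K = ⊤ := by
    rw [eq_top_iff]
    intro v _
    rw [← add_sub_cancel (∑ i, φ i v • b i) v]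
    exact Submodule.add_mem_sup (sum_mem_span b _) (hdecomp v)
  have hfr := Submodule.finrank_add_eq_of_isCompl
    (⟨disjoint_iff.2 hdis, codisjoint_iff.2 hsup⟩ : IsCompl W K)
  unfold IsPlane at hW
  rw [hW, Module.finrank_fin_fun] at hfr
  refine ⟨by simp, K, by omega, le_top, ⟨f 0, ?_⟩, W, hW, le_top, hdis, ht, ?_⟩
  · intro P hP
    induction P using Projectivization.ind with
    | h v hv =>
      have := (hKmem _).1 ((ptIn_mk hv).1 hP)
      rw [hc, hcone]
      simp [this]
  · intro P _ hP
    induction P using Projectivization.ind with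
    | h v hv =>
      have hne : ∑ i, φ i v • b i ≠ 0 := fun h0 => hP ((ptIn_mk hv).2 (by
        have := hdecomp v
        rwa [h0, sub_zero] at this))
      refine ⟨Projectivization.mk F _ hne, (ptIn_mk hne).2 (sum_mem_span b _), ?_, ?_⟩
      · rw [Projectivization.submodule_mk, Projectivization.submodule_mk,
          Submodule.span_singleton_le_iff_mem]
        have : ∑ i, φ i v • b i = -(v - ∑ i, φ i v • b i) + v := by abel
        rw [this]
        exact Submodule.add_mem_sup (K.neg_mem (hdecomp v)) (Submodule.mem_span_singleton_self v)
      · rw [hc, hc]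
        exact hcone v

end Conversion

section PencilNormalForm

variable {V : Type} [AddCommGroup V] [Module F V] {p : ℕ} [Fintype F] [Fact p.Prime]
  [Algebra (ZMod p) F] {f : V → ZMod p} [Fintype V]

/-- Two nonzero functionals are proportional or part of a dual frame. -/
theorem proportional_or_dual_pair {φ ψ : Module.Dual F V} (hφ : φ ≠ 0) :
    (∀ v, φ v = 0 → ψ v = 0) ∨
      ∃ e₁ e₂ : V, φ e₁ = 1 ∧ φ e₂ = 0 ∧ ψ e₁ = 0 ∧ ψ e₂ = 1 := by
  by_cases h : ∀ v, φ v = 0 → ψ v = 0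
  · exact Or.inl h
  · push Not at h
    obtain ⟨w, hw, hw'⟩ := h
    obtain ⟨u, hu⟩ : ∃ u, φ u ≠ 0 := by
      by_contra! h0
      exact hφ (LinearMap.ext h0)
    refine Or.inr ⟨(φ u)⁻¹ • (u - (ψ u / ψ w) • w), (ψ w)⁻¹ • w, ?_, ?_, ?_, ?_⟩ <;>
      simp [hw, hu, hw']

theorem zero_of_zero_of_proportional {φ ψ : Module.Dual F V} (hψ : ψ ≠ 0)
    (h : ∀ v, φ v = 0 → ψ v = 0) (v : V) (hv : ψ v = 0) : φ v = 0 := by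
  by_contra hne
  refine hψ (LinearMap.ext fun w => ?_)
  have h1 := h (w - (φ w / φ v) • v) (by simp [hne])
  simpa [hv] using h1

theorem exists_dual_partner {m : ℕ} (hV : Fintype.card V = 𝔮 ^ (m + 2)) {φ : Module.Dual F V}
    (hφ : φ ≠ 0) : ∃ (ψ : Module.Dual F V) (e₁ e₂ : V), φ e₁ = 1 ∧ φ e₂ = 0 ∧ ψ e₁ = 0 ∧
      ψ e₂ = 1 := by
  obtain ⟨u, hu⟩ : ∃ u, φ u ≠ 0 := by
    by_contra! h0
    exact hφ (LinearMap.ext h0)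
  obtain ⟨w, hw, hw0⟩ : ∃ w, φ w = 0 ∧ w ≠ 0 := by
    by_contra! h
    have hinj : Function.Injective φ := fun a b hab => by
      rw [← sub_eq_zero]
      refine h _ ?_
      rw [map_sub, hab, sub_self]
    have h1 := Fintype.card_le_of_injective _ hinj
    have h2 := two_le_card (F := F)
    rw [hV, pow_add] at h1
    have h3 : 1 ≤ 𝔮 ^ m := Nat.one_le_pow _ _ (by omega)
    nlinarith
  obtain ⟨χ, hχ⟩ := exists_dual_one (F := F) hw0
  exact ⟨χ, (φ u)⁻¹ • (u - χ u • w), w, by simp [hu, hw], hw, by simp [hχ], hχ⟩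

theorem exists_dual_third {m : ℕ} (hV : Fintype.card V = 𝔮 ^ (m + 3))
    {φ₁ φ₂ : Module.Dual F V} {e₁ e₂ : V} (h11 : φ₁ e₁ = 1) (h12 : φ₁ e₂ = 0)
    (h21 : φ₂ e₁ = 0) (h22 : φ₂ e₂ = 1) :
    ∃ (k : V) (χ : Module.Dual F V), φ₁ k = 0 ∧ φ₂ k = 0 ∧ χ k = 1 ∧ χ e₁ = 0 ∧ χ e₂ = 0 := by
  obtain ⟨k, hk1, hk2, hk0⟩ : ∃ k, φ₁ k = 0 ∧ φ₂ k = 0 ∧ k ≠ 0 := by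
    by_contra! h
    have hinj : Function.Injective (fun v => (φ₁ v, φ₂ v)) := fun a b hab => by
      rw [Prod.mk.injEq] at hab
      rw [← sub_eq_zero]
      exact h _ (by rw [map_sub, hab.1, sub_self]) (by rw [map_sub, hab.2, sub_self])
    have h1 := Fintype.card_le_of_injective _ hinj
    have h2 := two_le_card (F := F)
    rw [Fintype.card_prod, hV, ← pow_two] at h1
    have := (Nat.pow_le_pow_iff_right (by omega : 1 < 𝔮)).1 h1
    omega
  obtain ⟨χ, hχ⟩ := exists_dual_one (F := F) hk0
  exact ⟨k, χ - χ e₁ • φ₁ - χ e₂ • φ₂, hk1, hk2, by simp [hχ, hk1, hk2],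
    by simp [h11, h21], by simp [h12, h22]⟩

/-- A word covered by three hyperplanes is covered by three independent hyperplanes or by three
hyperplanes of a pencil. -/
theorem Covered.independent_or_pencil {m : ℕ} (hV : Fintype.card V = 𝔮 ^ (m + 2))
    (hcov : Covered F 3 f) :
    (∃ (φ : Fin 3 → Module.Dual F V) (b : Fin 3 → V),
      (∀ i j, φ i (b j) = if i = j then 1 else 0) ∧
      ∀ v, v ≠ 0 → f v ≠ 0 → φ 0 v = 0 ∨ φ 1 v = 0 ∨ φ 2 v = 0) ∨
    ∃ (φ₁ φ₂ : Module.Dual F V) (e₁ e₂ : V), φ₁ e₁ = 1 ∧ φ₁ e₂ = 0 ∧ φ₂ e₁ = 0 ∧ φ₂ e₂ = 1 ∧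
      ∀ v, v ≠ 0 → f v ≠ 0 → φ₁ v = 0 ∨ φ₂ v = 0 ∨ φ₁ v = φ₂ v := by
  obtain ⟨θ, hθ, hc⟩ := hcov
  have hc' : ∀ v, v ≠ 0 → f v ≠ 0 → θ 0 v = 0 ∨ θ 1 v = 0 ∨ θ 2 v = 0 := by
    intro v hv hfv
    obtain ⟨i, hi⟩ := hc v hv hfv
    fin_cases i
    · exact Or.inl hi
    · exact Or.inr (Or.inl hi)
    · exact Or.inr (Or.inr hi)
  rcases proportional_or_dual_pair (ψ := θ 1) (hθ 0) with h01 | ⟨e₁, e₂, h11, h12, h21, h22⟩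
  · have h10 := zero_of_zero_of_proportional (hθ 1) h01
    rcases proportional_or_dual_pair (ψ := θ 2) (hθ 0) with h02 | ⟨e₁, e₂, h11, h12, h21, h22⟩
    · have h20 := zero_of_zero_of_proportional (hθ 2) h02
      obtain ⟨χ, e₁, e₂, h11, h12, h21, h22⟩ := exists_dual_partner hV (hθ 0)
      refine Or.inr ⟨θ 0, χ, e₁, e₂, h11, h12, h21, h22, fun v hv hfv => Or.inl ?_⟩
      rcases hc' v hv hfv with h | h | h
      exacts [h, h10 v h, h20 v h]
    · refine Or.inr ⟨θ 0, θ 2, e₁, e₂, h11, h12, h21, h22, fun v hv hfv => ?_⟩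
      rcases hc' v hv hfv with h | h | h
      exacts [Or.inl h, Or.inl (h10 v h), Or.inr (Or.inl h)]
  · by_cases hk : ∀ k, θ 0 k = 0 → θ 1 k = 0 → θ 2 k = 0
    · right
      have hexp : ∀ v, θ 2 v = θ 2 e₁ * θ 0 v + θ 2 e₂ * θ 1 v := by
        intro v
        have := hk (v - θ 0 v • e₁ - θ 1 v • e₂) (by simp [h11, h12]) (by simp [h21, h22])
        simp only [map_sub, map_smul, smul_eq_mul] at this
        linear_combination this
      by_cases ha : θ 2 e₁ = 0
      · have hb : θ 2 e₂ ≠ 0 := fun hb => hθ 2 (LinearMap.ext fun v => by simp [hexp v, ha, hb])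
        refine ⟨θ 0, θ 1, e₁, e₂, h11, h12, h21, h22, fun v hv hfv => ?_⟩
        rcases hc' v hv hfv with h | h | h
        · exact Or.inl h
        · exact Or.inr (Or.inl h)
        · refine Or.inr (Or.inl ?_)
          simpa [hexp v, ha, hb] using h
      · by_cases hb : θ 2 e₂ = 0
        · refine ⟨θ 0, θ 1, e₁, e₂, h11, h12, h21, h22, fun v hv hfv => ?_⟩
          rcases hc' v hv hfv with h | h | h
          · exact Or.inl h
          · exact Or.inr (Or.inl h)
          · refine Or.inl ?_
            simpa [hexp v, ha, hb] using h
        · refine ⟨θ 2 e₁ • θ 0, -θ 2 e₂ • θ 1, (θ 2 e₁)⁻¹ • e₁, (-θ 2 e₂)⁻¹ • e₂, ?_, ?_, ?_, ?_,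
            fun v hv hfv => ?_⟩
          · simp [h11, ha]
          · simp [h12]
          · simp [h21]
          · simp [h22, hb]
          · rcases hc' v hv hfv with h | h | h
            · exact Or.inl (by simp [h])
            · exact Or.inr (Or.inl (by simp [h]))
            · refine Or.inr (Or.inr ?_)
              rw [hexp v] at h
              simp only [LinearMap.smul_apply, smul_eq_mul]
              linear_combination h
    · left
      push Not at hk
      obtain ⟨k, hk0, hk1, hk2⟩ := hk
      refine ⟨θ, ![e₁ - (θ 2 e₁ / θ 2 k) • k, e₂ - (θ 2 e₂ / θ 2 k) • k, (θ 2 k)⁻¹ • k], ?_, hc'⟩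
      intro i j
      fin_cases i <;> fin_cases j <;> simp [h11, h12, h21, h22, hk0, hk1, hk2]

/-- The value of a word covered by a pencil of three hyperplanes, at every vector. -/
theorem eq_of_pencil_cover_apply (h3 : 3 ≤ 𝔮) (hf : f ∈ lcode F p V)
    {φ₁ φ₂ : Module.Dual F V} {e₁ e₂ : V} (h11 : φ₁ e₁ = 1) (h12 : φ₁ e₂ = 0)
    (h21 : φ₂ e₁ = 0) (h22 : φ₂ e₂ = 1)
    (hcov : ∀ v, v ≠ 0 → f v ≠ 0 → φ₁ v = 0 ∨ φ₂ v = 0 ∨ φ₁ v = φ₂ v) :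
    ∃ (α₁ α₂ α₃ : ZMod p) (β : V →+ ZMod p), (∀ x : F, β (x • e₁) = 0 ∧ β (x • e₂) = 0) ∧
      (∀ v, f v = if φ₁ v = 0 then if φ₂ v = 0 then α₁ + α₂ + α₃ else α₂ + β ((φ₂ v)⁻¹ • v)
        else if φ₂ v = 0 then α₁ + β ((φ₁ v)⁻¹ • v)
        else if φ₁ v = φ₂ v then α₃ - β ((φ₁ v)⁻¹ • v) else 0) ∧ (β = 0 ∨ 𝔮 = p) := by
  obtain ⟨α₁, α₂, α₃, β, hβ, hp⟩ := eq_of_pencil_cover h3 hf h11 h12 h21 h22 hcov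
  let π : V →ₗ[F] ↥(LinearMap.ker φ₁ ⊓ LinearMap.ker φ₂) :=
    LinearMap.codRestrict _ (LinearMap.id - φ₁.smulRight e₁ - φ₂.smulRight e₂) (fun v => by
      simp [h11, h12, h21, h22])
  have hπ : ∀ v, (π v : V) = v - φ₁ v • e₁ - φ₂ v • e₂ := fun v => rfl
  have hπe : ∀ x : F, π (x • e₁) = 0 ∧ π (x • e₂) = 0 := fun x => by
    constructor <;> ext1 <;> simp [hπ, h11, h12, h21, h22]
  refine ⟨α₁, α₂, α₃, β.comp π.toAddMonoidHom, fun x => ?_, fun v => ?_, ?_⟩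
  · have := hπe x
    constructor
    · change β (π _) = 0
      rw [this.1, map_zero]
    · change β (π _) = 0
      rw [this.2, map_zero]
  · change f v = if φ₁ v = 0 then if φ₂ v = 0 then α₁ + α₂ + α₃ else α₂ + β (π ((φ₂ v)⁻¹ • v))
        else if φ₂ v = 0 then α₁ + β (π ((φ₁ v)⁻¹ • v))
        else if φ₁ v = φ₂ v then α₃ - β (π ((φ₁ v)⁻¹ • v)) else 0
    split_ifs with h1 h2 h2 h12'
    · have := (hβ ⟨v, h1, h2⟩).2.2.2
      exact this
    · rw [← (hβ _).2.1, ← lcode_smul hf (inv_ne_zero h2) v]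
      congr 1
      simp [hπ, h1, smul_sub, smul_smul, h2]
    · rw [← (hβ _).1, ← lcode_smul hf (inv_ne_zero h1) v]
      congr 1
      simp [hπ, h2, smul_sub, smul_smul, h1]
    · rw [← (hβ _).2.2.1, ← lcode_smul hf (inv_ne_zero h1) v]
      congr 1
      simp only [map_smul π, Submodule.coe_smul, hπ, ← h12', smul_sub, smul_smul,
        inv_mul_cancel₀ h1, one_smul]
      abel
    · by_contra hne
      rcases hcov v (by rintro rfl; simp at h1) hne with h | h | h
      exacts [h1 h, h2 h, h12' h]
  · rcases hp with h | h
    · exact Or.inl (by ext v; simp [h])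
    · exact Or.inr h

theorem exists_algebraMap_eq (hp : 𝔮 = p) (x : F) : ∃ m : ℕ, (m : F) = x := by
  have hinj := (algebraMap (ZMod p) F).injective
  have hbij : Function.Bijective (algebraMap (ZMod p) F) :=
    (Fintype.bijective_iff_injective_and_card _).2 ⟨hinj, by rw [ZMod.card, hp]⟩
  obtain ⟨a, rfl⟩ := hbij.2 x
  exact ⟨a.val, by rw [← map_natCast (algebraMap (ZMod p) F), ZMod.natCast_zmod_val]⟩

/-- Over a prime field an additive functional is linear. -/
theorem exists_dual_of_addHom (hp : 𝔮 = p) (β : V →+ ZMod p) :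
    ∃ χ : Module.Dual F V, ∀ v, χ v = algebraMap (ZMod p) F (β v) := by
  refine ⟨{ toFun := fun v => algebraMap (ZMod p) F (β v)
            map_add' := fun u v => by simp
            map_smul' := fun x v => ?_ }, fun _ => rfl⟩
  obtain ⟨m, rfl⟩ := exists_algebraMap_eq hp x
  rw [Nat.cast_smul_eq_nsmul, map_nsmul]
  simp

end PencilNormalForm

section Classification

variable [Fintype F] {p n : ℕ} [Fact p.Prime] [Algebra (ZMod p) F]

theorem mem_span_dual_frame {φ : Fin 3 → Module.Dual F (Fin (n + 1) → F)}
    {b : Fin 3 → (Fin (n + 1) → F)} (hd : ∀ i j, φ i (b j) = if i = j then 1 else 0)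
    {v : Fin (n + 1) → F} (hv : v ∈ Submodule.span F (Set.range b)) (h : ∀ i, φ i v = 0) :
    v = 0 := by
  obtain ⟨x, rfl⟩ := (Submodule.mem_span_range_iff_exists_fun F).1 hv
  have : x = 0 := funext fun i => by
    rw [← dual_frame_sum hd x i]; exact h i
  simp [this]

theorem spaceIsType_of_independent_cover {c : Pt F n → ZMod p} {f : (Fin (n + 1) → F) → ZMod p}
    (hc : ∀ v hv, c (Projectivization.mk F v hv) = f v) (h3 : 3 ≤ 𝔮)
    (hf : f ∈ lcode F p (Fin (n + 1) → F))
    {φ : Fin 3 → Module.Dual F (Fin (n + 1) → F)}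
    {b : Fin 3 → (Fin (n + 1) → F)} (hd : ∀ i j, φ i (b j) = if i = j then 1 else 0)
    (hcov : ∀ v, v ≠ 0 → f v ≠ 0 → φ 0 v = 0 ∨ φ 1 v = 0 ∨ φ 2 v = 0) :
    ∃ t, SpaceIsType p 𝔮 c (⊤ : Submodule F (Fin (n + 1) → F)) n t := by
  obtain ⟨μ₁, μ₂, μ₃, hμ⟩ := eq_of_independent_cover h3 hf (φ₁ := φ 0) (φ₂ := φ 1) (φ₃ := φ 2)
    (e₁ := b 0) (e₂ := b 1) (e₃ := b 2) (by simp [hd]) (by simp [hd]) (by simp [hd])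
    (by simp [hd]) (by simp [hd]) (by simp [hd]) (by simp [hd]) (by simp [hd]) (by simp [hd]) hcov
  have hcone : ∀ v, f v = f (∑ i, φ i v • b i) := by
    intro v
    have h (i) : φ i (∑ i, φ i v • b i) = φ i v := dual_frame_sum hd (fun i => φ i v) i
    simp only [hμ, hyp, h]
  have hW := isPlane_of_dual_frame hd
  have hb : ∀ i, b i ∈ Submodule.span F (Set.range b) := fun i => Submodule.subset_span ⟨i, rfl⟩
  have hnz : ∀ i, φ i (b i) ≠ 0 := by simp [hd]
  have hz : ∀ i j, i ≠ j → φ i (b j) = 0 := fun i j h => by simp [hd, h]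
  suffices ∃ t, PlaneIsType p 𝔮 c (Submodule.span F (Set.range b)) t from
    this.imp fun t ht => spaceIsType_of_frame hc hd hcone ht
  by_cases h1 : μ₁ = 0
  · exact planeIsType_of_two_lines hc hW (hb 1) (hb 2) (hnz 1) (hz 1 2 (by decide)) (hnz 2)
      (a := μ₂) (b := μ₃) fun v _ => by rw [hμ, h1]; ring
  by_cases h2 : μ₂ = 0
  · exact planeIsType_of_two_lines hc hW (hb 0) (hb 2) (hnz 0) (hz 0 2 (by decide)) (hnz 2)
      (a := μ₁) (b := μ₃) fun v _ => by rw [hμ, h2]; ring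
  by_cases h3 : μ₃ = 0
  · exact planeIsType_of_two_lines hc hW (hb 0) (hb 1) (hnz 0) (hz 0 1 (by decide)) (hnz 1)
      (a := μ₁) (b := μ₂) fun v _ => by rw [hμ, h3]; ring
  have hline : ∀ i, IsLine (Submodule.span F (Set.range b) ⊓ LinearMap.ker (φ i)) := by
    intro i
    have := finrank_inf_ker _ (hb i) (hnz i)
    unfold IsPlane at hW
    unfold IsLine
    omega
  have hne : ∀ i j, i ≠ j → Submodule.span F (Set.range b) ⊓ LinearMap.ker (φ i) ≠
      Submodule.span F (Set.range b) ⊓ LinearMap.ker (φ j) := by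
    intro i j hij h
    have : b j ∈ Submodule.span F (Set.range b) ⊓ LinearMap.ker (φ j) := by
      rw [← h]
      exact ⟨hb j, hz i j hij⟩
    exact hnz j this.2
  refine ⟨.Ttri, _, _, _, hline 0, hline 1, hline 2, inf_le_left, inf_le_left, inf_le_left,
    hne 0 1 (by decide), hne 0 2 (by decide), hne 1 2 (by decide), ?_, μ₁, μ₂, μ₃, h1, h2, h3, ?_⟩
  · rintro ⟨P, hP0, hP1, hP2⟩
    induction P using Projectivization.ind with
    | h v hv =>
      rw [ptIn_mk] at hP0 hP1 hP2
      refine hv (mem_span_dual_frame hd hP0.1 fun i => ?_)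
      fin_cases i
      exacts [hP0.2, hP1.2, hP2.2]
  · intro P hP
    induction P using Projectivization.ind with
    | h v hv =>
      have hvW := (ptIn_mk hv).1 hP
      rw [hc, hμ, incVec_inf_ker _ hv hvW, incVec_inf_ker _ hv hvW, incVec_inf_ker _ hv hvW]

theorem planeIsType_of_pencil {c : Pt F n → ZMod p} {f : (Fin (n + 1) → F) → ZMod p}
    (hc : ∀ v hv, c (Projectivization.mk F v hv) = f v)
    {W : Submodule F (Fin (n + 1) → F)} (hW : IsPlane W)
    {φ₁ φ₂ : Module.Dual F (Fin (n + 1) → F)} {e₁ e₂ k : Fin (n + 1) → F}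
    (he₁ : e₁ ∈ W) (he₂ : e₂ ∈ W) (hk : k ∈ W) (hk0 : k ≠ 0)
    (h11 : φ₁ e₁ = 1) (h12 : φ₁ e₂ = 0) (h1k : φ₁ k = 0)
    (h21 : φ₂ e₁ = 0) (h22 : φ₂ e₂ = 1) (h2k : φ₂ k = 0) {α₁ α₂ α₃ : ZMod p}
    (hf : ∀ v, f v = α₂ * hyp p φ₁ v + α₁ * hyp p φ₂ v + α₃ * hyp p (φ₁ - φ₂) v) :
    ∃ t, PlaneIsType p 𝔮 c W t := by
  by_cases ha1 : α₁ = 0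
  · exact planeIsType_of_two_lines hc hW he₁ he₂ (φ := φ₁) (ψ := φ₁ - φ₂) (by simp [h11]) h12
      (by simp [h12, h22]) (a := α₂) (b := α₃) fun v _ => by rw [hf, ha1]; ring
  by_cases ha2 : α₂ = 0
  · exact planeIsType_of_two_lines hc hW he₂ he₁ (φ := φ₂) (ψ := φ₁ - φ₂) (by simp [h22]) h21
      (by simp [h11, h21]) (a := α₁) (b := α₃) fun v _ => by rw [hf, ha2]; ring
  by_cases ha3 : α₃ = 0
  · exact planeIsType_of_two_lines hc hW he₁ he₂ (φ := φ₁) (ψ := φ₂) (by simp [h11]) h12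
      (by simp [h22]) (a := α₂) (b := α₁) fun v _ => by rw [hf, ha3]; ring
  have hline : ∀ (φ : Module.Dual F (Fin (n + 1) → F)) (v), v ∈ W → φ v ≠ 0 →
      IsLine (W ⊓ LinearMap.ker φ) := by
    intro φ v hv hφ
    have := finrank_inf_ker _ hv hφ
    unfold IsPlane at hW
    unfold IsLine
    omega
  have hne : ∀ (φ ψ : Module.Dual F (Fin (n + 1) → F)) (v), v ∈ W → φ v = 0 → ψ v ≠ 0 →
      W ⊓ LinearMap.ker φ ≠ W ⊓ LinearMap.ker ψ := by
    intro φ ψ v hv hφ hψ h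
    have : v ∈ W ⊓ LinearMap.ker ψ := by
      rw [← h]
      exact ⟨hv, hφ⟩
    exact hψ this.2
  refine ⟨.Tstar, _, _, _, hline φ₁ e₁ he₁ (by simp [h11]), hline φ₂ e₂ he₂ (by simp [h22]),
    hline (φ₁ - φ₂) e₁ he₁ (by simp [h11, h21]), inf_le_left, inf_le_left, inf_le_left,
    hne _ _ e₂ he₂ h12 (by simp [h22]), hne _ _ e₂ he₂ h12 (by simp [h12, h22]),
    hne _ _ e₁ he₁ h21 (by simp [h11, h21]), ⟨Projectivization.mk F k hk0, ?_⟩,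
    α₂, α₁, α₃, ha2, ha1, ha3, ?_⟩
  · simp only [ptIn_mk]
    exact ⟨⟨hk, h1k⟩, ⟨hk, h2k⟩, ⟨hk, by simp [h1k, h2k]⟩⟩
  · intro P hP
    induction P using Projectivization.ind with
    | h v hv =>
      have hvW := (ptIn_mk hv).1 hP
      rw [hc, hf, incVec_inf_ker _ hv hvW, incVec_inf_ker _ hv hvW, incVec_inf_ker _ hv hvW]

theorem ptIn_iff_rep_mem {m : ℕ} {W : Submodule F (Fin (m + 1) → F)} (P : Pt F m) :
    ptIn P W ↔ P.rep ∈ W := by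
  rw [ptIn, Projectivization.submodule_eq, Submodule.span_singleton_le_iff_mem]

theorem typeOdd_of_pencil {c : Pt F n → ZMod p} {f : (Fin (n + 1) → F) → ZMod p}
    (hc : ∀ v hv, c (Projectivization.mk F v hv) = f v) (hp : 𝔮 = p)
    {φ : Fin 3 → Module.Dual F (Fin (n + 1) → F)}
    {b : Fin 3 → (Fin (n + 1) → F)} (hd : ∀ i j, φ i (b j) = if i = j then 1 else 0)
    {α₁ α₂ α₃ : ZMod p} {β : (Fin (n + 1) → F) →+ ZMod p}
    (hβ0 : ∀ x : F, β (x • b 0) = 0) (hβ1 : ∀ x : F, β (x • b 1) = 0) (hβ2 : β (b 2) ≠ 0)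
    (hf : ∀ v, f v = if φ 0 v = 0 then if φ 1 v = 0 then α₁ + α₂ + α₃
        else α₂ + β ((φ 1 v)⁻¹ • v)
      else if φ 1 v = 0 then α₁ + β ((φ 0 v)⁻¹ • v)
      else if φ 0 v = φ 1 v then α₃ - β ((φ 0 v)⁻¹ • v) else 0) :
    TypeOdd p c (Submodule.span F (Set.range b)) := by
  refine ⟨hp, algebraMap (ZMod p) F, b, linearIndependent_of_dual_frame hd, rfl,
    LinearEquiv.refl _ _, β (b 2), α₂, α₁, α₃, hβ2, fun Q => ?_⟩
  have hβ : ∀ x : ZMod p, β (algebraMap (ZMod p) F x • b 2) = x * β (b 2) := by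
    intro x
    have : algebraMap (ZMod p) F x = (x.val : F) := by
      rw [← map_natCast (algebraMap (ZMod p) F), ZMod.natCast_zmod_val]
    rw [this, Nat.cast_smul_eq_nsmul, map_nsmul, nsmul_eq_mul, ZMod.natCast_zmod_val]
  have hmap : Projectivization.map (LinearEquiv.refl (ZMod p) (Fin 3 → ZMod p)).toLinearMap
      (LinearEquiv.refl (ZMod p) (Fin 3 → ZMod p)).injective Q = Q := by
    induction Q using Projectivization.ind with
    | h v hv => simp [Projectivization.map_mk]
  set σ := algebraMap (ZMod p) F with hσ
  set r := Q.rep with hr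
  set v := ∑ i, σ (r i) • b i with hv
  have hφ : ∀ i, φ i v = σ (r i) := fun i => dual_frame_sum hd (fun i => σ (r i)) i
  have hβv : ∀ y : ZMod p, β ((σ y)⁻¹ • v) = r 2 / y * β (b 2) := by
    intro y
    rw [hv, Fin.sum_univ_three, smul_add, smul_add, map_add, map_add, smul_smul, smul_smul,
      smul_smul, hβ0, hβ1, zero_add, zero_add, ← map_inv₀, ← map_mul, hβ, div_eq_mul_inv,
      mul_comm (r 2)]
  have hcf : c (planeEmbed σ b (linearIndependent_of_dual_frame hd) Q) = f v := hc _ _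
  unfold oddWord
  rw [hcf, hmap, hf]
  simp only [hφ, hβv, oddBase, incVec, ptIn_iff_rep_mem, lineM1, lineM2, lineM3,
    LinearMap.mem_ker, LinearMap.sub_apply, LinearMap.proj_apply, sub_eq_zero,
    σ.injective.eq_iff, ← hr]
  by_cases h0 : r 0 = 0
  · by_cases h1 : r 1 = 0
    · simp [h0, h1]; ring
    · simp [h0, h1, Ne.symm h1]; ring
  · by_cases h1 : r 1 = 0
    · simp [h0, h1]; ring
    · by_cases h01 : r 0 = r 1
      · simp [← h01, h0]; ring
      · simp [h0, h1, h01]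

theorem spaceIsType_of_pencil_combination (hn : 2 ≤ n)
    {c : Pt F n → ZMod p} {f : (Fin (n + 1) → F) → ZMod p}
    (hc : ∀ v hv, c (Projectivization.mk F v hv) = f v)
    {φ₁ φ₂ : Module.Dual F (Fin (n + 1) → F)} {e₁ e₂ : Fin (n + 1) → F} (h11 : φ₁ e₁ = 1)
    (h12 : φ₁ e₂ = 0) (h21 : φ₂ e₁ = 0) (h22 : φ₂ e₂ = 1) {α₁ α₂ α₃ : ZMod p}
    (hf : ∀ v, f v = α₂ * hyp p φ₁ v + α₁ * hyp p φ₂ v + α₃ * hyp p (φ₁ - φ₂) v) :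
    ∃ t, SpaceIsType p 𝔮 c (⊤ : Submodule F (Fin (n + 1) → F)) n t := by
  obtain ⟨m, rfl⟩ := Nat.exists_eq_add_of_le' hn
  obtain ⟨k, χ, h1k, h2k, hχk, hχ1, hχ2⟩ := exists_dual_third (m := m)
    (by simp) h11 h12 h21 h22
  let φ : Fin 3 → Module.Dual F (Fin (m + 2 + 1) → F) := ![φ₁, φ₂, χ]
  let b : Fin 3 → (Fin (m + 2 + 1) → F) := ![e₁, e₂, k]
  have hd : ∀ i j, φ i (b j) = if i = j then 1 else 0 := by
    intro i j
    fin_cases i <;> fin_cases j <;> simp [φ, b, h11, h12, h21, h22, h1k, h2k, hχk, hχ1, hχ2]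
  have hb : ∀ i, b i ∈ Submodule.span F (Set.range b) := fun i => Submodule.subset_span ⟨i, rfl⟩
  have hcone : ∀ v, f v = f (∑ i, φ i v • b i) := by
    intro v
    have h (i) : φ i (∑ i, φ i v • b i) = φ i v := dual_frame_sum hd (fun i => φ i v) i
    have ha : φ₁ (∑ i, φ i v • b i) = φ₁ v := h 0
    have hb : φ₂ (∑ i, φ i v • b i) = φ₂ v := h 1
    rw [hf, hf (∑ i, φ i v • b i)]
    simp only [hyp, LinearMap.sub_apply, ha, hb]
  obtain ⟨t, ht⟩ := planeIsType_of_pencil hc (isPlane_of_dual_frame hd) (hb 0) (hb 1) (hb 2)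
    (fun h0 => by rw [show b 2 = k from rfl] at h0; simp [h0] at hχk)
    h11 h12 h1k h21 h22 h2k hf
  exact ⟨t, spaceIsType_of_frame hc hd hcone ht⟩

theorem spaceIsType_of_pencil_cover (hn : 2 ≤ n) {c : Pt F n → ZMod p}
    {f : (Fin (n + 1) → F) → ZMod p}
    (hc : ∀ v hv, c (Projectivization.mk F v hv) = f v) (h3 : 3 ≤ 𝔮)
    (hf : f ∈ lcode F p (Fin (n + 1) → F)) {φ₁ φ₂ : Module.Dual F (Fin (n + 1) → F)}
    {e₁ e₂ : Fin (n + 1) → F} (h11 : φ₁ e₁ = 1) (h12 : φ₁ e₂ = 0)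
    (h21 : φ₂ e₁ = 0) (h22 : φ₂ e₂ = 1)
    (hcov : ∀ v, v ≠ 0 → f v ≠ 0 → φ₁ v = 0 ∨ φ₂ v = 0 ∨ φ₁ v = φ₂ v) :
    ∃ t, SpaceIsType p 𝔮 c (⊤ : Submodule F (Fin (n + 1) → F)) n t := by
  obtain ⟨α₁, α₂, α₃, β, hβe, hβ, hp⟩ := eq_of_pencil_cover_apply h3 hf h11 h12 h21 h22 hcov
  by_cases hβ0 : β = 0
  · refine spaceIsType_of_pencil_combination hn hc h11 h12 h21 h22 (α₁ := α₁) (α₂ := α₂)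
      (α₃ := α₃) fun v => ?_
    rw [hβ]
    simp only [hβ0, hyp, LinearMap.sub_apply, sub_eq_zero, AddMonoidHom.zero_apply]
    by_cases h1 : φ₁ v = 0
    · by_cases h2 : φ₂ v = 0
      · simp [h1, h2]; ring
      · simp [h1, h2, Ne.symm h2]
    · by_cases h2 : φ₂ v = 0
      · simp [h1, h2]
      · by_cases h12 : φ₁ v = φ₂ v <;> simp [h1, h2, h12]
  have hp' := hp.resolve_left hβ0
  obtain ⟨k, χ, h1k, h2k, hχk, hχ1, hχ2, hβχ, hβk⟩ : ∃ (k : Fin (n + 1) → F)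
      (χ : Module.Dual F (Fin (n + 1) → F)), φ₁ k = 0 ∧ φ₂ k = 0 ∧ χ k = 1 ∧ χ e₁ = 0 ∧
      χ e₂ = 0 ∧ (∀ v, β v = β (χ v • k)) ∧ β k ≠ 0 := by
    obtain ⟨w, hw⟩ : ∃ w, β w ≠ 0 := by
      by_contra! h
      exact hβ0 (AddMonoidHom.ext h)
    obtain ⟨χ, hχ⟩ := exists_dual_of_addHom hp' β
    have hχ1 (x : F) : χ (x • e₁) = 0 := by rw [hχ, (hβe x).1, map_zero]
    have hχ2 (x : F) : χ (x • e₂) = 0 := by rw [hχ, (hβe x).2, map_zero]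
    have hχw : χ w ≠ 0 := by
      rw [hχ]
      simpa using hw
    have hk : χ ((χ w)⁻¹ • (w - φ₁ w • e₁ - φ₂ w • e₂)) = 1 := by
      rw [map_smul, map_sub, map_sub, hχ1, hχ2]
      simp [hχw]
    refine ⟨(χ w)⁻¹ • (w - φ₁ w • e₁ - φ₂ w • e₂), χ, by simp [h11, h12], by simp [h21, h22],
      hk, by simpa using hχ1 1, by simpa using hχ2 1, fun v => ?_, fun h => ?_⟩
    · apply (algebraMap (ZMod p) F).injective
      rw [← hχ, ← hχ, map_smul, hk]
      simp
    · rw [hχ, h] at hk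
      simp at hk
  let φ : Fin 3 → Module.Dual F (Fin (n + 1) → F) := ![φ₁, φ₂, χ]
  let b : Fin 3 → (Fin (n + 1) → F) := ![e₁, e₂, k]
  have hd : ∀ i j, φ i (b j) = if i = j then 1 else 0 := by
    intro i j
    fin_cases i <;> fin_cases j <;> simp [φ, b, h11, h12, h21, h22, h1k, h2k, hχk, hχ1, hχ2]
  have hcone : ∀ v, f v = f (∑ i, φ i v • b i) := by
    intro v
    have h (i) : φ i (∑ i, φ i v • b i) = φ i v := dual_frame_sum hd (fun i => φ i v) i
    have hβ' (x : F) : β (x • ∑ i, φ i v • b i) = β (x • v) := by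
      have hχv : χ (∑ i, φ i v • b i) = χ v := h 2
      rw [hβχ, hβχ (x • v), map_smul χ, map_smul χ, hχv]
    have ha : φ₁ (∑ i, φ i v • b i) = φ₁ v := h 0
    have hb : φ₂ (∑ i, φ i v • b i) = φ₂ v := h 1
    rw [hβ, hβ (∑ i, φ i v • b i)]
    simp only [ha, hb, hβ']
  exact ⟨.Todd, spaceIsType_of_frame hc hd hcone
    (typeOdd_of_pencil hc hp' hd (fun x => (hβe x).1) (fun x => (hβe x).2) hβk hβ)⟩

theorem spaceIsType_of_covered (hn : 2 ≤ n) {c : Pt F n → ZMod p}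
    {f : (Fin (n + 1) → F) → ZMod p}
    (hc : ∀ v hv, c (Projectivization.mk F v hv) = f v) (h3 : 3 ≤ 𝔮)
    (hf : f ∈ lcode F p (Fin (n + 1) → F)) (hcov : Covered F 3 f) :
    ∃ t, SpaceIsType p 𝔮 c (⊤ : Submodule F (Fin (n + 1) → F)) n t := by
  obtain ⟨m, rfl⟩ : ∃ m, n = m + 1 := ⟨n - 1, by omega⟩
  rcases hcov.independent_or_pencil (m := m) (by simp) with
    ⟨φ, b, hd, h⟩ | ⟨φ₁, φ₂, e₁, e₂, h11, h12, h21, h22, h⟩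
  · exact spaceIsType_of_independent_cover hc h3 hf hd h
  · exact spaceIsType_of_pencil_cover hn hc h3 hf h11 h12 h21 h22 h

end Classification

section Bridge

variable [Fintype F] {p n : ℕ} [Fact p.Prime]

theorem exists_lcode_of_mem_code {c : Pt F n → ZMod p} (hc : c ∈ code F p n) :
    ∃ f ∈ lcode F p (Fin (n + 1) → F), ∀ v hv, c (Projectivization.mk F v hv) = f v := by
  induction hc using Submodule.span_induction with
  | mem c h =>
    obtain ⟨W, hW, rfl⟩ := h
    obtain ⟨φ, hφ0, hφ⟩ := Submodule.exists_le_ker_of_lt_top W (lt_top_iff_ne_top.2 fun h => by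
      rw [h, finrank_top, Module.finrank_fin_fun] at hW
      omega)
    have h1 := Module.Dual.finrank_ker_add_one_of_ne_zero (f := φ) hφ0
    rw [Module.finrank_fin_fun] at h1
    have h2 : W = LinearMap.ker φ := Submodule.eq_of_le_of_finrank_eq hφ (by omega)
    exact ⟨hyp p φ, hyp_mem φ, fun v hv => by simp [incVec, ptIn_mk, h2, hyp]⟩
  | zero => exact ⟨0, Submodule.zero_mem _, fun _ _ => rfl⟩
  | add c d _ _ hc hd =>
    obtain ⟨f, hf, h1⟩ := hc
    obtain ⟨g, hg, h2⟩ := hd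
    exact ⟨f + g, Submodule.add_mem _ hf hg, fun v hv => by simp [h1 v hv, h2 v hv]⟩
  | smul a c _ hc =>
    obtain ⟨f, hf, h1⟩ := hc
    exact ⟨a • f, Submodule.smul_mem _ a hf, fun v hv => by simp [h1 v hv]⟩

theorem wtv_eq_mul_wt {c : Pt F n → ZMod p} {f : (Fin (n + 1) → F) → ZMod p}
    (hc : ∀ v hv, c (Projectivization.mk F v hv) = f v)
    (hf : f ∈ lcode F p (Fin (n + 1) → F)) : wtv f = (𝔮 - 1) * wt c := by
  have hrep (P : Pt F n) : f P.rep = c P := by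
    rw [← hc P.rep P.rep_nonzero, P.mk_rep]
  let g : {P : Pt F n // c P ≠ 0} × Fˣ → {v : Fin (n + 1) → F // v ≠ 0 ∧ f v ≠ 0} := fun x =>
    ⟨(x.2 : F) • x.1.1.rep, smul_ne_zero x.2.ne_zero x.1.1.rep_nonzero, by
      rw [lcode_smul hf x.2.ne_zero, hrep]
      exact x.1.2⟩
  have hg : Function.Bijective g := by
    constructor
    · rintro ⟨⟨P, hP⟩, u⟩ ⟨⟨Q, hQ⟩, w⟩ h
      have h1 : (u : F) • P.rep = (w : F) • Q.rep := congrArg Subtype.val h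
      have hPQ : P = Q := by
        rw [← P.mk_rep, ← Q.mk_rep, Projectivization.mk_eq_mk_iff]
        refine ⟨u⁻¹ * w, ?_⟩
        rw [mul_smul, inv_smul_eq_iff]
        exact h1.symm
      subst hPQ
      have h2 : (u : F) = w := smul_left_injective F P.rep_nonzero h1
      rw [Units.ext h2]
    · rintro ⟨v, hv, hfv⟩
      obtain ⟨a, ha⟩ := Projectivization.exists_smul_eq_mk_rep F v hv
      refine ⟨⟨⟨Projectivization.mk F v hv, by rwa [hc]⟩, a⁻¹⟩, Subtype.ext ?_⟩
      change ((a⁻¹ : Fˣ) : F) • (Projectivization.mk F v hv).rep = v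
      rw [← ha]
      exact inv_smul_smul a v
  have h1 := Nat.card_congr (Equiv.ofBijective g hg)
  rw [Nat.card_prod, Nat.card_eq_fintype_card (α := Fˣ), Fintype.card_units] at h1
  have h2 : wtv f = Nat.card {v : Fin (n + 1) → F // v ≠ 0 ∧ f v ≠ 0} := by
    rw [Nat.card_eq_fintype_card, Fintype.card_subtype]
    unfold wtv
    congr
  have h3 : wt c = Nat.card {P : Pt F n // c P ≠ 0} := rfl
  rw [h2, ← h1, h3, mul_comm]

end Bridge

section Binary

variable [Fintype F]

theorem zmod_two_eq_zero_or_one (a : ZMod 2) : a = 0 ∨ a = 1 := by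
  fin_cases a
  · exact Or.inl rfl
  · exact Or.inr rfl

theorem eq_zero_or_one_of_card_two (h2 : 𝔮 = 2) (x : F) : x = 0 ∨ x = 1 := by
  by_contra! h
  have h3 : ({0, 1, x} : Finset F).card = 3 := by
    rw [Finset.card_insert_of_notMem, Finset.card_insert_of_notMem, Finset.card_singleton]
    · simpa using h.2.symm
    · simpa using h.1.symm
  have := Finset.card_le_univ ({0, 1, x} : Finset F)
  omega

variable {V : Type} [AddCommGroup V] [Module F V]

/-- A binary word is a hyperplane or the complement of one. -/
theorem exists_of_card_two (h2 : 𝔮 = 2) {f : V → ZMod 2} (hf : f ∈ lcode F 2 V) :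
    ∃ (a : ZMod 2) (φ : Module.Dual F V), ∀ v, f v = a + hyp 2 φ v := by
  have hadd (φ ψ : Module.Dual F V) (v) : hyp 2 φ v + hyp 2 ψ v = 1 + hyp 2 (φ + ψ) v := by
    have h11 : (1 + 1 : F) = 0 := by
      have := FiniteField.cast_card_eq_zero F
      rw [h2] at this
      rw [← this]
      norm_num
    have h11' : (1 + 1 : ZMod 2) = 0 := rfl
    simp only [hyp, LinearMap.add_apply]
    rcases eq_zero_or_one_of_card_two h2 (φ v) with h | h <;>
      rcases eq_zero_or_one_of_card_two h2 (ψ v) with h' | h' <;> simp [h, h', h11, h11']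
  induction hf using lcode_induction with
  | h0 => exact ⟨1, 0, fun v => by simp [hyp]; rfl⟩
  | hadd f g _ _ hf hg =>
    obtain ⟨a, φ, h1⟩ := hf
    obtain ⟨b, ψ, h2⟩ := hg
    exact ⟨a + b + 1, φ + ψ, fun v => by
      rw [Pi.add_apply, h1, h2]
      linear_combination hadd φ ψ v⟩
  | hsmul a f _ hf =>
    obtain ⟨b, φ, h1⟩ := hf
    rcases zmod_two_eq_zero_or_one a with rfl | rfl
    · exact ⟨1, 0, fun v => by simp [hyp]; rfl⟩
    · exact ⟨b, φ, fun v => by simp [h1]⟩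
  | hhyp φ => exact ⟨0, φ, fun v => by simp⟩

theorem spaceIsType_of_card_two [Algebra (ZMod 2) F] {n : ℕ} (h2 : 𝔮 = 2) (hn : 2 ≤ n)
    {c : Pt F n → ZMod 2}
    (hcode : c ∈ code F 2 n) (hwt : wt c ≤ 2 ^ n) :
    ∃ t, SpaceIsType 2 𝔮 c (⊤ : Submodule F (Fin (n + 1) → F)) n t := by
  obtain ⟨f, hfm, hc⟩ := exists_lcode_of_mem_code hcode
  have hw := wtv_eq_mul_wt hc hfm
  rw [h2, show 2 - 1 = 1 from rfl, one_mul] at hw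
  obtain ⟨a, φ, hf⟩ := exists_of_card_two h2 hfm
  obtain ⟨m, rfl⟩ : ∃ m, n = m + 1 := ⟨n - 1, by omega⟩
  have hV : Fintype.card (Fin (m + 1 + 1) → F) = 𝔮 ^ (m + 2) := by simp
  have h11 : (1 + 1 : ZMod 2) = 0 := rfl
  by_cases hφ : φ = 0
  · have hf' : ∀ v, f v = a + 1 := fun v => by rw [hf, hφ]; simp [hyp]
    rcases zmod_two_eq_zero_or_one a with rfl | rfl
    · exfalso
      have h3 := nz_eq f
      have h4 : nz f = 2 ^ (m + 2) := by
        have h5 : nz f = Fintype.card (Fin (m + 1 + 1) → F) := by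
          rw [← Finset.card_univ]
          unfold nz
          congr 1
          simp [hf']
        rw [h5, hV, h2]
      have h5 : (if f 0 ≠ 0 then 1 else 0) ≤ 1 := by split_ifs <;> omega
      have h6 : 2 ^ 1 ≤ 2 ^ m := Nat.pow_le_pow_right (by omega) (by omega)
      rw [pow_add] at h4 hwt
      omega
    · obtain ⟨φ, hφ⟩ : ∃ φ : Module.Dual F (Fin (m + 1 + 1) → F), φ ≠ 0 :=
        ⟨LinearMap.proj 0, fun h => by
          have := LinearMap.congr_fun h (fun _ => 1)
          simp at this⟩
      obtain ⟨ψ, e₁, e₂, he11, he12, he21, he22⟩ := exists_dual_partner hV hφ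
      exact spaceIsType_of_pencil_combination hn hc he11 he12 he21 he22 (α₁ := 0) (α₂ := 0)
        (α₃ := 0) fun v => by rw [hf', h11]; ring
  · obtain ⟨ψ, e₁, e₂, he11, he12, he21, he22⟩ := exists_dual_partner hV hφ
    rcases zmod_two_eq_zero_or_one a with rfl | rfl
    · exact spaceIsType_of_pencil_combination hn hc he11 he12 he21 he22 (α₁ := 0) (α₂ := 1)
        (α₃ := 0) fun v => by rw [hf]; ring
    · refine spaceIsType_of_pencil_combination hn hc he11 he12 he21 he22 (α₁ := 1) (α₂ := 0)
        (α₃ := 1) fun v => ?_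
      rw [hf]
      simp only [hyp, LinearMap.sub_apply]
      rcases eq_zero_or_one_of_card_two h2 (φ v) with h | h <;>
        rcases eq_zero_or_one_of_card_two h2 (ψ v) with h' | h' <;> simp [h, h', h11]

end Binary

section Dispatch

theorem eq_of_isPrimePow_of_lt {q : ℕ} (hq : IsPrimePow q) (hlt : q < 37) :
    (q < 7 ∨ q = 8 ∨ q = 9 ∨ q = 16 ∨ q = 25 ∨ q = 27) ∨ q = 7 ∨ q = 11 ∨ q = 13 ∨ q = 17 ∨
      q = 19 ∨ q = 23 ∨ q = 29 ∨ q = 31 ∨ q = 32 := by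
  have key : ∀ r s, Nat.Prime r → Nat.Prime s → r ≠ s → ¬ (r ∣ q ∧ s ∣ q) := by
    obtain ⟨p, k, hp, hk, rfl⟩ := hq
    rintro r s hr hs hrs ⟨hrq, hsq⟩
    have := (Nat.prime_dvd_prime_iff_eq hr hp.nat_prime).mp (hr.dvd_of_dvd_pow hrq)
    have := (Nat.prime_dvd_prime_iff_eq hs hp.nat_prime).mp (hs.dvd_of_dvd_pow hsq)
    omega
  have h1 := key 2 3 (by norm_num) (by norm_num) (by norm_num)
  have h2 := key 2 5 (by norm_num) (by norm_num) (by norm_num)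
  have h3 := key 2 7 (by norm_num) (by norm_num) (by norm_num)
  have h4 := key 2 11 (by norm_num) (by norm_num) (by norm_num)
  have h5 := key 2 13 (by norm_num) (by norm_num) (by norm_num)
  have h6 := key 2 17 (by norm_num) (by norm_num) (by norm_num)
  have h7 := key 3 5 (by norm_num) (by norm_num) (by norm_num)
  have h8 := key 3 7 (by norm_num) (by norm_num) (by norm_num)
  have h9 := key 3 11 (by norm_num) (by norm_num) (by norm_num)
  have h10 := key 5 7 (by norm_num) (by norm_num) (by norm_num)
  interval_cases q <;> omega

/-- The three ranges in which the weight bound is used. -/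
theorem weight_cases {q m w : ℕ} (hq : IsPrimePow q) (hw : (w : ℝ) ≤ B (m + 3) q) :
    w ≤ 2 * q ^ (m + 2) ∨ (q = 7 ∧ (q - 1) * w < 14 * q ^ (m + 2)) ∨
      (8 ≤ q ∧ (q - 1) * w < 3 * (q - 2) * q ^ (m + 2)) ∨
      (37 ≤ q ∧ w ≤ (4 * q - 33) * q ^ (m + 1)) := by
  have hmain : ∀ (b : ℝ) (M : ℕ), 1 ≤ q → (w : ℝ) ≤ b * (q : ℝ) ^ (m + 1) →
      ((q : ℝ) - 1) * b < M * q → (q - 1) * w < M * q ^ (m + 2) := by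
    intro b M h1 hb hlt
    have h1' : (1 : ℝ) ≤ q := by exact_mod_cast h1
    have h : ((q - 1 : ℕ) : ℝ) * w < M * (q : ℝ) ^ (m + 2) := by
      rw [Nat.cast_sub h1, Nat.cast_one]
      calc ((q : ℝ) - 1) * w ≤ (q - 1) * (b * (q : ℝ) ^ (m + 1)) :=
            mul_le_mul_of_nonneg_left hb (by linarith)
        _ = ((q - 1) * b) * (q : ℝ) ^ (m + 1) := by ring
        _ < (M * q) * (q : ℝ) ^ (m + 1) := mul_lt_mul_of_pos_right hlt (by positivity)
        _ = _ := by ring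
    exact_mod_cast h
  unfold B at hw
  rw [show m + 3 - 1 = m + 2 from rfl, show m + 3 - 2 = m + 1 from rfl] at hw
  split_ifs at hw with c1 c2 c3 c4
  · left
    exact_mod_cast hw
  · have h7 : (7 : ℝ) ≤ q := by exact_mod_cast (show 7 ≤ q by omega)
    have hs := Real.le_sqrt_of_sq_le (x := 6) (y := 6 * (q : ℝ)) (by linarith)
    rcases Nat.lt_or_ge q 8 with h8 | h8
    · refine .inr (.inl ⟨by omega, hmain _ _ (by omega) hw ?_⟩)
      obtain rfl : q = 7 := by omega
      generalize Real.sqrt _ = x at hs ⊢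
      push_cast
      linarith
    · refine .inr (.inr (.inl ⟨h8, hmain _ _ (by omega) hw ?_⟩))
      generalize Real.sqrt _ = x at hs ⊢
      rcases c2 with rfl | rfl | rfl | rfl <;> push_cast <;> linarith
  · refine .inr (.inr (.inl ⟨by omega, hmain _ _ (by omega) hw ?_⟩))
    rcases c3 with rfl | rfl <;> push_cast
    · have := Real.le_sqrt_of_sq_le (x := 10) (y := 6 * 19) (by norm_num)
      generalize Real.sqrt _ = x at this ⊢
      linarith
    · have := Real.le_sqrt_of_sq_le (x := 26) (y := 6 * 121) (by norm_num)
      generalize Real.sqrt _ = x at this ⊢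
      linarith
  · refine .inr (.inr (.inl ⟨by omega, hmain _ _ (by omega) hw ?_⟩))
    rcases c4 with rfl | rfl | rfl <;> push_cast
    · have := Real.le_sqrt_of_sq_le (x := 5.3) (y := 29) (by norm_num)
      linarith
    · have := Real.le_sqrt_of_sq_le (x := 5.5) (y := 31) (by norm_num)
      linarith
    · have := Real.le_sqrt_of_sq_le (x := 5.65) (y := 32) (by norm_num)
      linarith
  · rcases lt_or_ge q 37 with hlt | h37
    · obtain rfl : q = 23 := by
        have := eq_of_isPrimePow_of_lt hq hlt
        omega
      refine .inr (.inr (.inl ⟨by omega, hmain _ _ (by omega) hw ?_⟩))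
      push_cast
      have := Real.le_sqrt_of_sq_le (x := 13) (y := 8 * 23) (by norm_num)
      generalize Real.sqrt _ = x at this ⊢
      linarith
    · refine .inr (.inr (.inr ⟨h37, ?_⟩))
      have h37' : (37 : ℝ) ≤ q := by exact_mod_cast h37
      have hs := Real.le_sqrt_of_sq_le (x := 16.5) (y := 8 * (q : ℝ)) (by norm_num; linarith)
      have h : (w : ℝ) ≤ ((4 * q - 33 : ℕ) : ℝ) * (q : ℝ) ^ (m + 1) := by
        refine hw.trans (mul_le_mul_of_nonneg_right ?_ (by positivity))
        rw [Nat.cast_sub (by omega)]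
        push_cast
        linarith
      exact_mod_cast h

variable [Fintype F] {p : ℕ} [Fact p.Prime]

theorem covered_three_of_weight_cases [Algebra (ZMod p) F] {m w : ℕ}
    {f : (Fin (m + 3 + 1) → F) → ZMod p} (h3 : 3 ≤ 𝔮) (hf : f ∈ lcode F p (Fin (m + 3 + 1) → F))
    (hfw : wtv f = (𝔮 - 1) * w)
    (hw : w ≤ 2 * 𝔮 ^ (m + 2) ∨ (𝔮 = 7 ∧ (𝔮 - 1) * w < 14 * 𝔮 ^ (m + 2)) ∨
      (8 ≤ 𝔮 ∧ (𝔮 - 1) * w < 3 * (𝔮 - 2) * 𝔮 ^ (m + 2)) ∨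
      (37 ≤ 𝔮 ∧ w ≤ (4 * 𝔮 - 33) * 𝔮 ^ (m + 1))) : Covered F 3 f := by
  rcases hw with hw | ⟨h7, hw⟩ | ⟨h8, hw⟩ | ⟨h37, hw⟩
  · refine (covered_two_of_le h3 hf (n := m + 2) (by simp) ?_).succ
    rw [hfw]
    calc 𝔮 * ((𝔮 - 1) * w) ≤ 𝔮 * ((𝔮 - 1) * (2 * 𝔮 ^ (m + 2))) := by gcongr
      _ = _ := by ring
  · have hV : Fintype.card (Fin (m + 3 + 1) → F) = 𝔮 ^ (m + 2 + 2) := by simp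
    rw [← hfw] at hw
    refine (covered_two h7.ge (m + 3) _ f hf (by simp)
      (lineGap_of_wtv hf hV (M := 14) (by norm_num) (by omega) ?_ hw) ?_).succ
    · intro s hs1 hs2
      rw [h7] at hs2 ⊢
      have hs3 : s ≤ 4 := by omega
      interval_cases s <;> norm_num
    · rw [h7] at hw ⊢
      rw [pow_succ' _ (m + 2)]
      omega
  · exact (covered_two_of_lt h8 hf (n := m + 2) (by simp) (by rwa [hfw])).succ
  · refine Sparse.covered (n := m) ⟨h37, hf, by simp, ?_⟩
    rw [hfw, mul_assoc]
    gcongr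

end Dispatch

/-- Corollary 9 of the paper: a code word of `C_{n-1}(n,q)` of weight at most
`B_{n,q}` is a code word of type `𝒯`. -/
theorem statement1 [Fintype F] {p h q n : ℕ} [Fact p.Prime] (hh : 1 ≤ h) (hq : q = p ^ h)
    (hF : Fintype.card F = q) (hn : 3 ≤ n)
    (c : Pt F n → ZMod p) (hc : c ∈ code F p n) (hwt : (wt c : ℝ) ≤ B n q) :
    ∃ t : PlaneT, SpaceIsType p q c (⊤ : Submodule F (Fin (n + 1) → F)) n t := by
  have hp := Fact.out (p := p.Prime)
  have hpow : IsPrimePow q := ⟨p, h, hp.prime, hh, hq.symm⟩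
  have : CharP F p := by
    obtain ⟨r, hr⟩ := CharP.exists F
    obtain ⟨k, hr', hk⟩ := FiniteField.card F r
    have h1 : r ∣ p ^ h := by
      rw [← hq, ← hF, hk]
      exact dvd_pow_self r k.pos.ne'
    rwa [← (Nat.prime_dvd_prime_iff_eq hr' hp).mp (hr'.dvd_of_dvd_pow h1)]
  let _ : Algebra (ZMod p) F := ZMod.algebra F p
  clear hq
  subst hF
  obtain ⟨m, rfl⟩ : ∃ m, n = m + 3 := ⟨n - 3, by omega⟩
  have h2 := hpow.two_le
  have hcases := weight_cases hpow hwt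
  rcases h2.eq_or_lt with h2 | h3
  · obtain rfl : p = 2 := by
      have h1 : (p : F) = 0 := CharP.cast_eq_zero F p
      have h4 : ((2 : ℕ) : F) = 0 := by
        rw [h2]
        exact FiniteField.cast_card_eq_zero F
      exact (Nat.prime_dvd_prime_iff_eq hp Nat.prime_two).mp ((CharP.cast_eq_zero_iff F p 2).mp h4)
    refine spaceIsType_of_card_two h2.symm (by omega) hc ?_
    rw [← h2] at hcases
    rw [pow_succ']
    omega
  · obtain ⟨f, hf, hcf⟩ := exists_lcode_of_mem_code hc
    exact spaceIsType_of_covered (by omega) hcf h3 hf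
      (covered_three_of_weight_cases h3 hf (wtv_eq_mul_wt hcf hf) hcases)

end PGCode
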